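/- For every integer n ≥ 0, M_ω(2,5,5n+4) − M_ω(3,5,5n+4) = 2·NT(1,5,5n+4) − 2·NT(4,5,5n+4). -/

import Mathlib

/-!
Common definitions: for a partition `π` of `n`,
`numParts` is the number of parts, `largestPart` the largest part,
`omegaOnes` the number of parts equal to 1, `rank` and `crank` the
Dyson rank and Andrews–Garvan crank.  `NT m j n` is the total number of
parts over partitions of `n` with rank ≡ m (mod j), and `Mw m j n` is
the total number of ones over partitions of `n` with crank ≡ m (mod j).
`poch a q = (a; q)_∞ = ∏_{n ≥ 0} (1 - a qⁿ)`.
-/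

namespace Beck

/-- number of parts of a partition -/
def numParts {n : ℕ} (π : n.Partition) : ℕ := Multiset.card π.parts

/-- largest part of a partition (0 for the empty partition) -/
def largestPart {n : ℕ} (π : n.Partition) : ℕ := π.parts.sup

/-- number of ones in a partition -/
def omegaOnes {n : ℕ} (π : n.Partition) : ℕ := π.parts.count 1

/-- number of parts strictly larger than the number of ones -/
def muParts {n : ℕ} (π : n.Partition) : ℕ :=
  Multiset.card (π.parts.filter fun x => omegaOnes π < x)

/-- Dyson's rank: largest part minus number of parts -/
def rank {n : ℕ} (π : n.Partition) : ℤ :=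
  (largestPart π : ℤ) - (numParts π : ℤ)

/-- the Andrews–Garvan crank -/
def crank {n : ℕ} (π : n.Partition) : ℤ :=
  if omegaOnes π = 0 then (largestPart π : ℤ)
  else (muParts π : ℤ) - (omegaOnes π : ℤ)

/-- `NT m j n`: total number of parts in partitions of `n` with rank ≡ m (mod j) -/
def NT (m j n : ℕ) : ℤ :=
  ∑ π : n.Partition,
    if rank π % (j : ℤ) = (m : ℤ) % (j : ℤ) then (numParts π : ℤ) else 0

/-- `Mw m j n`: total number of ones in partitions of `n` with crank ≡ m (mod j) -/
def Mw (m j n : ℕ) : ℤ :=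
  ∑ π : n.Partition,
    if crank π % (j : ℤ) = (m : ℤ) % (j : ℤ) then (omegaOnes π : ℤ) else 0

/-- `(a; q)_∞ = ∏_{n ≥ 0} (1 - a qⁿ)` -/
noncomputable def poch (a q : ℂ) : ℂ := ∏' n : ℕ, (1 - a * q ^ n)

open Filter Topology

/-- `(-1)^m p^(m(m+1)/2)` -/
noncomputable def gv (p : ℂ) (m : ℤ) : ℂ := (-1) ^ m * p ^ (m * (m + 1) / 2)

/-- the bilateral theta series `∑ (-1)^n p^(n(n-1)/2) x^n`, summed over `m = -n` -/
noncomputable def theta (p x : ℂ) : ℂ := ∑' m : ℤ, gv p m * x ^ (-m)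

/-- the partial fraction series of the reciprocal theta function -/
noncomputable def kap (p x : ℂ) : ℂ := ∑' m : ℤ, gv p m * (1 - x * p ^ m)⁻¹

/-- the Kronecker series -/
noncomputable def kron (p x y : ℂ) : ℂ := ∑' m : ℤ, x ^ m * (1 - y * p ^ m)⁻¹

section Basic
variable {p : ℂ}

lemma gv_zero : gv p 0 = 1 := by simp [gv]

lemma gv_ne_zero (hp : p ≠ 0) (m : ℤ) : gv p m ≠ 0 := by
  unfold gv
  exact mul_ne_zero (zpow_ne_zero _ (by norm_num)) (zpow_ne_zero _ hp)

lemma gv_add (hp : p ≠ 0) (m n : ℤ) : gv p (m + n) = gv p m * gv p n * p ^ (m * n) := by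
  unfold gv
  obtain ⟨a, ha⟩ := Int.even_mul_succ_self m
  obtain ⟨b, hb⟩ := Int.even_mul_succ_self n
  have h1 : m * (m + 1) / 2 = a := by omega
  have h2 : n * (n + 1) / 2 = b := by omega
  have h3 : (m + n) * (m + n + 1) / 2 = a + b + m * n := by
    have : (m + n) * (m + n + 1) = 2 * (a + b + m * n) := by linear_combination ha + hb
    omega
  rw [h1, h2, h3, zpow_add₀ (by norm_num : (-1 : ℂ) ≠ 0), zpow_add₀ hp, zpow_add₀ hp]
  ring

lemma gv_one : gv p 1 = -p := by simp [gv]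

lemma gv_succ (hp : p ≠ 0) (m : ℤ) : gv p (m + 1) = -p ^ (m + 1) * gv p m := by
  rw [gv_add hp, gv_one, mul_one, zpow_add_one₀ hp]; ring

lemma gv_neg (hp : p ≠ 0) (m : ℤ) : gv p (-m) = p ^ (-m) * gv p m := by
  unfold gv
  obtain ⟨a, ha⟩ := Int.even_mul_succ_self m
  have h1 : m * (m + 1) / 2 = a := by omega
  have h3 : (-m) * (-m + 1) / 2 = a - m := by
    have : (-m) * (-m + 1) = 2 * (a - m) := by linear_combination ha
    omega
  rw [h1, h3, zpow_sub₀ hp, zpow_neg, zpow_neg]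
  have : ((-1 : ℂ) ^ m)⁻¹ = (-1) ^ m := by
    rw [← inv_zpow]; norm_num
  rw [this]; field_simp

lemma gv_reflect (hp : p ≠ 0) (m : ℤ) : gv p (-1 - m) = -gv p m := by
  have h1 := gv_succ hp (-1 - m)
  have h2 : -1 - m + 1 = -m := by ring
  rw [h2, gv_neg hp] at h1
  have h3 : p ^ (-m) ≠ 0 := zpow_ne_zero _ hp
  have h4 : p ^ (-m) * (gv p (-1 - m) + gv p m) = 0 := by linear_combination h1
  have := (mul_eq_zero.mp h4).resolve_left h3
  linear_combination this

lemma summable_norm_gv_mul (hp : p ≠ 0) (hp1 : ‖p‖ < 1) {x : ℂ} (hx : x ≠ 0) :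
    Summable fun m : ℤ => ‖gv p m * x ^ m‖ := by
  have hz : ∀ m : ℤ, gv p m * x ^ m ≠ 0 := fun m =>
    mul_ne_zero (gv_ne_zero hp m) (zpow_ne_zero _ hx)
  have hpow : Tendsto (fun n : ℕ => ‖p‖ ^ n) atTop (𝓝 0) :=
    tendsto_pow_atTop_nhds_zero_of_lt_one (norm_nonneg _) hp1
  apply Summable.of_nat_of_neg
  · apply summable_of_ratio_test_tendsto_lt_one (l := 0) one_pos
    · exact Eventually.of_forall fun n => (norm_pos_iff.mpr (hz n)).ne'
    · have h : Tendsto (fun n : ℕ => ‖p‖ ^ n * (‖p‖ * ‖x‖)) atTop (𝓝 (0 * (‖p‖ * ‖x‖))) :=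
        hpow.mul_const _
      rw [zero_mul] at h
      refine h.congr fun n => ?_
      have hn := norm_ne_zero_iff.mpr (hz n)
      rw [norm_norm, norm_norm, eq_div_iff hn, ← norm_pow, ← norm_mul, ← norm_mul, ← norm_mul,
        ← norm_neg (_ * _)]
      congr 1
      push_cast
      rw [gv_succ hp, zpow_add_one₀ hx, zpow_add_one₀ hp]
      simp only [zpow_natCast]; ring
  · apply summable_of_ratio_test_tendsto_lt_one (l := 0) one_pos
    · exact Eventually.of_forall fun n => (norm_pos_iff.mpr (hz _)).ne'
    · have h : Tendsto (fun n : ℕ => ‖p‖ ^ n * (‖x‖⁻¹)) atTop (𝓝 (0 * (‖x‖⁻¹))) :=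
        hpow.mul_const _
      rw [zero_mul] at h
      refine h.congr fun n => ?_
      have hn := norm_ne_zero_iff.mpr (hz (-n))
      rw [norm_norm, norm_norm, eq_div_iff hn, ← norm_pow, ← norm_inv, ← norm_mul, ← norm_mul,
        ← norm_neg (_ * _)]
      congr 1
      have h1 := gv_succ hp (-(n + 1 : ℤ))
      have h2 : -(n + 1 : ℤ) + 1 = -n := by ring
      rw [h2] at h1
      have h3 : x ^ (-(n : ℤ)) = x ^ (-(n + 1 : ℤ)) * x := by
        rw [← zpow_add_one₀ hx]; congr 1; ring
      push_cast
      rw [h1, h3]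
      simp only [zpow_neg, zpow_natCast]
      have : p ^ n ≠ 0 := pow_ne_zero _ hp
      field_simp

lemma summable_norm_gv (hp : p ≠ 0) (hp1 : ‖p‖ < 1) : Summable fun m : ℤ => ‖gv p m‖ := by
  simpa using summable_norm_gv_mul hp hp1 (one_ne_zero (α := ℂ))

lemma tsum_gv (hp : p ≠ 0) : ∑' m : ℤ, gv p m = 0 := by
  have h := (Equiv.subLeft (-1 : ℤ)).tsum_eq (gv p)
  simp only [Equiv.subLeft_apply, gv_reflect hp, tsum_neg] at h
  linear_combination (-1 / 2) * h

lemma exists_bound_inv (hp : p ≠ 0) (hp1 : ‖p‖ < 1) {x : ℂ} (hx : x ≠ 0) :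
    ∃ C : ℝ, ∀ m : ℤ, ‖(1 - x * p ^ m)⁻¹‖ ≤ C := by
  have hpow : Tendsto (fun n : ℕ => p ^ n) atTop (𝓝 0) :=
    tendsto_pow_atTop_nhds_zero_of_norm_lt_one hp1
  have h1 : Tendsto (fun n : ℕ => ‖(1 - x * p ^ (n : ℤ))⁻¹‖) atTop (𝓝 ‖(1 - x * 0 : ℂ)⁻¹‖) := by
    refine Tendsto.norm (Tendsto.inv₀ ?_ (by simp))
    simp only [zpow_natCast]
    exact tendsto_const_nhds.sub (hpow.const_mul x)
  have h2 : Tendsto (fun n : ℕ => ‖(1 - x * p ^ (-(n : ℤ)))⁻¹‖) atTop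
      (𝓝 ‖(0 : ℂ) * (0 - x : ℂ)⁻¹‖) := by
    have : Tendsto (fun n : ℕ => p ^ n * (p ^ n - x)⁻¹) atTop (𝓝 ((0 : ℂ) * (0 - x : ℂ)⁻¹)) := by
      refine hpow.mul (Tendsto.inv₀ (hpow.sub_const x) (by simpa using hx))
    refine this.norm.congr fun n => ?_
    congr 1
    have hn : p ^ n ≠ 0 := pow_ne_zero _ hp
    have h3 : (1 - x * p ^ (-(n : ℤ))) = (p ^ n)⁻¹ * (p ^ n - x) := by
      rw [zpow_neg, zpow_natCast]; field_simp
    rw [h3, mul_inv, inv_inv]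
  obtain ⟨C1, hC1⟩ := h1.bddAbove_range
  obtain ⟨C2, hC2⟩ := h2.bddAbove_range
  refine ⟨max C1 C2, fun m => ?_⟩
  obtain ⟨n, rfl | rfl⟩ := m.eq_nat_or_neg
  · exact le_max_of_le_left (hC1 ⟨n, rfl⟩)
  · exact le_max_of_le_right (hC2 ⟨n, rfl⟩)

lemma summable_norm_kap (hp : p ≠ 0) (hp1 : ‖p‖ < 1) {x : ℂ} (hx : x ≠ 0) :
    Summable fun m : ℤ => ‖gv p m * (1 - x * p ^ m)⁻¹‖ := by
  obtain ⟨C, hC⟩ := exists_bound_inv hp hp1 hx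
  refine Summable.of_nonneg_of_le (fun _ => norm_nonneg _) (fun m => ?_)
    ((summable_norm_gv hp hp1).mul_right C)
  rw [norm_mul]
  exact mul_le_mul_of_nonneg_left (hC m) (norm_nonneg _)

lemma kap_div (hp : p ≠ 0) (hp1 : ‖p‖ < 1) {x : ℂ} (hx : x ≠ 0) (hxp : ∀ m : ℤ, x * p ^ m ≠ 1) :
    kap p (x * p⁻¹) = -(p * x⁻¹) * kap p x := by
  have h := (Equiv.addRight (1 : ℤ)).tsum_eq (fun m : ℤ => gv p m * (1 - x * p⁻¹ * p ^ m)⁻¹)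
  unfold kap
  rw [← h]
  have e : ∀ m : ℤ, gv p (m + 1) * (1 - x * p⁻¹ * p ^ (m + 1))⁻¹ =
      -(p * x⁻¹) * (gv p m * (1 - x * p ^ m)⁻¹) - (-(p * x⁻¹)) * gv p m := by
    intro m
    have hd : 1 - x * p ^ m ≠ 0 := fun h => hxp m (by linear_combination -h)
    have : x * p⁻¹ * p ^ (m + 1) = x * p ^ m := by rw [zpow_add_one₀ hp]; field_simp
    have hd' : (1 - x * p ^ m) * (1 - x * p ^ m)⁻¹ = 1 := mul_inv_cancel₀ hd
    have hxx : x⁻¹ * x = 1 := inv_mul_cancel₀ hx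
    rw [this, gv_succ hp, zpow_add_one₀ hp]
    linear_combination (p * x⁻¹ * gv p m) * hd' +
      (p * gv p m * p ^ m * (1 - x * p ^ m)⁻¹) * hxx
  simp only [Equiv.coe_addRight, e]
  rw [Summable.tsum_sub, tsum_mul_left, tsum_mul_left, tsum_gv hp]
  · ring
  · exact (summable_norm_kap hp hp1 hx).of_norm.mul_left _
  · exact (summable_norm_gv hp hp1).of_norm.mul_left _

lemma mul_zpow_ne (hp : p ≠ 0) {x : ℂ} (hxp : ∀ m : ℤ, x * p ^ m ≠ 1) (a : ℤ) :
    ∀ m : ℤ, x * p ^ a * p ^ m ≠ 1 := by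
  intro m; rw [mul_assoc, ← zpow_add₀ hp]; exact hxp _

lemma kap_zpow_neg (hp : p ≠ 0) (hp1 : ‖p‖ < 1) {x : ℂ} (hx : x ≠ 0)
    (hxp : ∀ m : ℤ, x * p ^ m ≠ 1) (a : ℤ) :
    kap p (x * p ^ (-a)) = gv p a * x ^ (-a) * kap p x := by
  have step : ∀ a : ℤ, kap p (x * p ^ (-(a + 1))) =
      -(p ^ (a + 1) * x⁻¹) * kap p (x * p ^ (-a)) := by
    intro a
    have h := kap_div hp hp1 (x := x * p ^ (-a)) (mul_ne_zero hx (zpow_ne_zero _ hp))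
      (mul_zpow_ne hp hxp _)
    have e : x * p ^ (-a) * p⁻¹ = x * p ^ (-(a + 1)) := by
      rw [mul_assoc, ← zpow_sub_one₀ hp]; congr 2; ring
    rw [e] at h
    rw [h]; congr 2
    rw [zpow_add_one₀ hp, zpow_neg]; field_simp
  induction a using Int.induction_on with
  | zero => simp [gv_zero]
  | succ n ih =>
    rw [step, ih, gv_succ hp]
    have : x ^ (-((n : ℤ) + 1)) = x ^ (-(n : ℤ)) * x⁻¹ := by
      rw [← zpow_sub_one₀ hx]; congr 1; ring
    rw [this]; ring
  | pred n ih =>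
    have h := step (-(n : ℤ) - 1)
    have g := gv_succ hp (-(n : ℤ) - 1)
    simp only [sub_add_cancel] at h g
    rw [ih, g] at h
    have : x ^ (-(-(n : ℤ) - 1)) = x ^ (-(-(n : ℤ))) * x := by
      rw [← zpow_add_one₀ hx]; congr 1; ring
    rw [this]
    have h0 : p ^ (-(n : ℤ)) ≠ 0 := zpow_ne_zero _ hp
    have : p ^ (-(n : ℤ)) * (kap p (x * p ^ (-(-(n : ℤ) - 1))) -
      gv p (-(n : ℤ) - 1) * (x ^ (-(-(n : ℤ))) * x) * kap p x) = 0 := by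
      have hxx : x⁻¹ * x = 1 := inv_mul_cancel₀ hx
      linear_combination x * h - p ^ (-(n : ℤ)) * kap p (x * p ^ (-(-(n : ℤ) - 1))) * hxx
    have := (mul_eq_zero.mp this).resolve_left h0
    linear_combination this

lemma kap_inv (hp : p ≠ 0) {x : ℂ} (hx : x ≠ 0) (hxp : ∀ m : ℤ, x * p ^ m ≠ 1) :
    kap p x⁻¹ = -x * kap p x := by
  have h := (Equiv.neg ℤ).tsum_eq (fun m : ℤ => gv p m * (1 - x⁻¹ * p ^ m)⁻¹)
  unfold kap
  rw [← h, ← tsum_mul_left]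
  congr 1; ext m
  have hd : 1 - x * p ^ m ≠ 0 := fun h => hxp m (by linear_combination -h)
  have hm : p ^ m ≠ 0 := zpow_ne_zero _ hp
  have e : 1 - x⁻¹ * p ^ (-m) = -(x * p ^ m)⁻¹ * (1 - x * p ^ m) := by
    rw [zpow_neg]; field_simp; ring
  rw [Equiv.neg_apply, gv_neg hp, e, mul_inv, zpow_neg, inv_neg, inv_inv]
  field_simp

/-- the reflection `x ↦ p / x` -/
lemma kap_reflect (hp : p ≠ 0) (hp1 : ‖p‖ < 1) {x : ℂ} (hx : x ≠ 0)
    (hxp : ∀ m : ℤ, x * p ^ m ≠ 1) : kap p (p * x⁻¹) = kap p x := by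
  have h1 := kap_div hp hp1 hx hxp
  have h2 := kap_inv hp (x := x * p⁻¹) (mul_ne_zero hx (inv_ne_zero hp)) (by
    have := mul_zpow_ne hp hxp (-1); simpa using this)
  rw [mul_inv, inv_inv, mul_comm x⁻¹ p] at h2
  rw [h2, h1]; field_simp

lemma norm_ne_one_of_annulus (hp : p ≠ 0) (hp1 : ‖p‖ < 1) {x : ℂ} (h1 : ‖p‖ < ‖x‖) (h2 : ‖x‖ < 1) :
    ∀ m : ℤ, x * p ^ m ≠ 1 := by
  intro m hm
  have hpp : 0 < ‖p‖ := norm_pos_iff.mpr hp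
  have hn : ‖x‖ * ‖p‖ ^ m = 1 := by rw [← norm_zpow, ← norm_mul, hm, norm_one]
  rcases le_or_gt 0 m with h | h
  · have : ‖p‖ ^ m ≤ 1 := zpow_le_one₀ hpp hp1.le h
    nlinarith [norm_nonneg x]
  · have : ‖p‖ ^ (-1 : ℤ) ≤ ‖p‖ ^ m := by
      apply zpow_le_zpow_right_of_le_one₀ hpp hp1.le; omega
    rw [zpow_neg_one] at this
    have h3 : ‖x‖ * ‖p‖⁻¹ ≤ 1 := by
      rw [← hn]; exact mul_le_mul_of_nonneg_left this (norm_nonneg _)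
    rw [← div_eq_mul_inv, div_le_one hpp] at h3
    linarith

end Basic

/-- the finite product `(p; p)_n` -/
noncomputable def pfac (p : ℂ) (n : ℕ) : ℂ := ∏ i ∈ Finset.range n, (1 - p * p ^ i)

/-- Euler's series for `(x; p)_∞` -/
noncomputable def eul (p x : ℂ) : ℂ := ∑' k : ℕ, gv p (-k) * x ^ k / pfac p k

section Euler
variable {p : ℂ}

lemma one_sub_mul_pow_ne (hp1 : ‖p‖ < 1) (n : ℕ) : 1 - p * p ^ n ≠ 0 := by
  intro h
  have h1 : ‖p * p ^ n‖ = 1 := by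
    rw [show p * p ^ n = 1 by linear_combination -h, norm_one]
  rw [← pow_succ', norm_pow] at h1
  exact (pow_lt_one₀ (norm_nonneg p) hp1 n.succ_ne_zero).ne h1

lemma pfac_ne_zero (hp1 : ‖p‖ < 1) (n : ℕ) : pfac p n ≠ 0 :=
  Finset.prod_ne_zero_iff.mpr fun i _ => one_sub_mul_pow_ne hp1 i

lemma pfac_zero : pfac p 0 = 1 := by simp [pfac]

lemma pfac_succ (n : ℕ) : pfac p (n + 1) = pfac p n * (1 - p * p ^ n) := by
  simp [pfac, Finset.prod_range_succ]

lemma gv_neg_succ (hp : p ≠ 0) (k : ℕ) : gv p (-(k + 1 : ℕ)) = -(p ^ k * gv p (-k)) := by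
  have h := gv_succ hp (-(k + 1 : ℤ))
  have e : -(k + 1 : ℤ) + 1 = -k := by ring
  rw [e, zpow_neg, zpow_natCast] at h
  have : p ^ k ≠ 0 := pow_ne_zero _ hp
  push_cast
  rw [h]; field_simp

lemma tendsto_inv_one_sub (hp1 : ‖p‖ < 1) :
    Tendsto (fun n : ℕ => (1 - p * p ^ n)⁻¹) atTop (𝓝 1) := by
  have h := tendsto_pow_atTop_nhds_zero_of_norm_lt_one hp1
  have := ((tendsto_const_nhds (x := (1 : ℂ))).sub (h.const_mul p)).inv₀ (by simp)
  simpa using this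

lemma summable_norm_eul (hp : p ≠ 0) (hp1 : ‖p‖ < 1) (x : ℂ) :
    Summable fun k : ℕ => ‖gv p (-k) * x ^ k / pfac p k‖ := by
  rcases eq_or_ne x 0 with rfl | hx
  · apply summable_of_ne_finset_zero (s := {0})
    intro b hb
    simp only [Finset.mem_singleton] at hb
    simp [hb]
  have hz : ∀ k : ℕ, gv p (-k) * x ^ k / pfac p k ≠ 0 := fun k =>
    div_ne_zero (mul_ne_zero (gv_ne_zero hp _) (pow_ne_zero _ hx)) (pfac_ne_zero hp1 k)
  apply summable_of_ratio_test_tendsto_lt_one (l := 0) one_pos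
  · exact Eventually.of_forall fun k => (norm_pos_iff.mpr (hz k)).ne'
  · have h := ((tendsto_pow_atTop_nhds_zero_of_norm_lt_one hp1).mul
      (tendsto_inv_one_sub hp1)).mul_const x
    have h' := h.norm
    simp only [zero_mul, norm_zero] at h'
    refine h'.congr fun n => ?_
    rw [norm_norm, norm_norm, eq_div_iff (norm_ne_zero_iff.mpr (hz n)), ← norm_mul, ← norm_neg]
    congr 1
    rw [gv_neg_succ hp, pfac_succ, pow_succ]
    have := one_sub_mul_pow_ne hp1 n
    have := pfac_ne_zero hp1 n
    field_simp

lemma eul_step (hp : p ≠ 0) (hp1 : ‖p‖ < 1) (x : ℂ) : eul p x = (1 - x) * eul p (x * p) := by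
  have s1 := (summable_norm_eul hp hp1 x).of_norm
  have s2 := (summable_norm_eul hp hp1 (x * p)).of_norm
  have h : eul p x - eul p (x * p) = -x * eul p (x * p) := by
    unfold eul
    rw [← Summable.tsum_sub s1 s2, (s1.sub s2).tsum_eq_zero_add, ← tsum_mul_left]
    simp only [pow_zero, sub_self, zero_add]
    congr 1; ext k
    rw [gv_neg_succ hp, pfac_succ]
    have h1 := one_sub_mul_pow_ne hp1 k
    have h2 := pfac_ne_zero hp1 k
    obtain ⟨d, hd⟩ : ∃ d, d = 1 - p * p ^ k := ⟨_, rfl⟩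
    rw [← hd] at h1 ⊢
    simp only [mul_pow, pow_succ]
    field_simp
    rw [hd]
    ring
  linear_combination h

lemma eul_iterate (hp : p ≠ 0) (hp1 : ‖p‖ < 1) (x : ℂ) (n : ℕ) :
    eul p x = (∏ i ∈ Finset.range n, (1 - x * p ^ i)) * eul p (x * p ^ n) := by
  induction n with
  | zero => simp
  | succ n ih =>
    rw [ih, eul_step hp hp1, Finset.prod_range_succ, pow_succ]
    ring_nf

lemma eul_tendsto (hp : p ≠ 0) (hp1 : ‖p‖ < 1) {α : Type*} {l : Filter α} {f : α → ℂ} {x : ℂ}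
    (hf : Tendsto f l (𝓝 x)) : Tendsto (fun a => eul p (f a)) l (𝓝 (eul p x)) := by
  apply tendsto_tsum_of_dominated_convergence
    (summable_norm_eul hp hp1 ((‖x‖ + 1 : ℝ) : ℂ))
  · intro k
    exact ((hf.pow k).const_mul _).div_const _
  · have : ∀ᶠ a in l, ‖f a‖ < ‖x‖ + 1 := hf.norm.eventually_lt_const (by linarith)
    filter_upwards [this] with a ha k
    have h0 : 0 ≤ ‖x‖ + 1 := by positivity
    rw [norm_div, norm_mul, norm_div, norm_mul, norm_pow, norm_pow, Complex.norm_real,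
      Real.norm_of_nonneg h0]
    gcongr

lemma eul_zero (hp : p ≠ 0) (hp1 : ‖p‖ < 1) : eul p 0 = 1 := by
  unfold eul
  rw [(summable_norm_eul hp hp1 0).of_norm.tsum_eq_zero_add]
  simp [gv_zero, pfac_zero]

lemma summable_norm_geom (hp1 : ‖p‖ < 1) (x : ℂ) : Summable fun n : ℕ => ‖-(x * p ^ n)‖ := by
  simp only [norm_neg, norm_mul, norm_pow]
  exact (summable_geometric_of_lt_one (norm_nonneg _) hp1).mul_left _

lemma poch_hasProd (hp1 : ‖p‖ < 1) (x : ℂ) : HasProd (fun n : ℕ => 1 - x * p ^ n) (poch x p) := by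
  have := (multipliable_one_add_of_summable (summable_norm_geom hp1 x)).hasProd
  simpa only [← sub_eq_add_neg, poch] using this

lemma poch_eq_eul (hp : p ≠ 0) (hp1 : ‖p‖ < 1) (x : ℂ) : poch x p = eul p x := by
  have h1 := (poch_hasProd hp1 x).tendsto_prod_nat
  have h2 : Tendsto (fun n : ℕ => eul p (x * p ^ n)) atTop (𝓝 1) := by
    have := (tendsto_pow_atTop_nhds_zero_of_norm_lt_one hp1).const_mul x
    rw [mul_zero] at this
    have := eul_tendsto hp hp1 this
    rwa [eul_zero hp hp1] at this
  have h3 := h1.mul h2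
  rw [mul_one] at h3
  refine tendsto_nhds_unique h3 (tendsto_const_nhds.congr fun n => eul_iterate hp hp1 x n)

lemma poch_step (hp : p ≠ 0) (hp1 : ‖p‖ < 1) (x : ℂ) :
    poch x p = (1 - x) * poch (x * p) p := by
  rw [poch_eq_eul hp hp1, poch_eq_eul hp hp1, eul_step hp hp1]

lemma poch_tendsto (hp : p ≠ 0) (hp1 : ‖p‖ < 1) {α : Type*} {l : Filter α} {f : α → ℂ} {x : ℂ}
    (hf : Tendsto f l (𝓝 x)) : Tendsto (fun a => poch (f a) p) l (𝓝 (poch x p)) := by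
  simp only [poch_eq_eul hp hp1]
  exact eul_tendsto hp hp1 hf

lemma poch_ne_zero (hp1 : ‖p‖ < 1) {x : ℂ} (hx : ∀ n : ℕ, x * p ^ n ≠ 1) : poch x p ≠ 0 := by
  have := tprod_one_add_ne_zero_of_summable (f := fun n : ℕ => -(x * p ^ n))
    (fun i h => hx i (by linear_combination -h)) (summable_norm_geom hp1 x)
  simpa only [← sub_eq_add_neg, poch] using this

/-- Euler's series for `1 / (y; p)_∞` -/
noncomputable def eulInv (p y : ℂ) : ℂ := ∑' k : ℕ, y ^ k / pfac p k

lemma summable_norm_eulInv (hp1 : ‖p‖ < 1) {y : ℂ} (hy : ‖y‖ < 1) :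
    Summable fun k : ℕ => ‖y ^ k / pfac p k‖ := by
  rcases eq_or_ne y 0 with rfl | hx
  · apply summable_of_ne_finset_zero (s := {0})
    intro b hb
    simp only [Finset.mem_singleton] at hb
    simp [hb]
  have hz : ∀ k : ℕ, y ^ k / pfac p k ≠ 0 := fun k =>
    div_ne_zero (pow_ne_zero _ hx) (pfac_ne_zero hp1 k)
  apply summable_of_ratio_test_tendsto_lt_one hy
  · exact Eventually.of_forall fun k => (norm_pos_iff.mpr (hz k)).ne'
  · have h' := ((tendsto_inv_one_sub hp1).mul_const y).norm
    simp only [one_mul] at h'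
    refine h'.congr fun n => ?_
    rw [norm_norm, norm_norm, eq_div_iff (norm_ne_zero_iff.mpr (hz n)), ← norm_mul]
    congr 1
    rw [pfac_succ, pow_succ]
    have := one_sub_mul_pow_ne hp1 n
    have := pfac_ne_zero hp1 n
    field_simp

lemma eulInv_step (hp1 : ‖p‖ < 1) {y : ℂ} (hy : ‖y‖ < 1) :
    (1 - y) * eulInv p y = eulInv p (y * p) := by
  have hyp : ‖y * p‖ < 1 := by
    rw [norm_mul]; nlinarith [norm_nonneg y, norm_nonneg p]
  have s1 := (summable_norm_eulInv hp1 hy).of_norm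
  have s2 := (summable_norm_eulInv hp1 hyp).of_norm
  have h : eulInv p y - eulInv p (y * p) = y * eulInv p y := by
    unfold eulInv
    rw [← Summable.tsum_sub s1 s2, (s1.sub s2).tsum_eq_zero_add, ← tsum_mul_left]
    simp only [pow_zero, sub_self, zero_add]
    congr 1; ext k
    rw [pfac_succ]
    have h1 := one_sub_mul_pow_ne hp1 k
    have h2 := pfac_ne_zero hp1 k
    obtain ⟨d, hd⟩ : ∃ d, d = 1 - p * p ^ k := ⟨_, rfl⟩
    rw [← hd] at h1 ⊢
    simp only [mul_pow, pow_succ]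
    field_simp
    rw [hd]
    ring
  linear_combination h

lemma norm_mul_pow_lt (hp1 : ‖p‖ < 1) {y : ℂ} (hy : ‖y‖ < 1) (n : ℕ) : ‖y * p ^ n‖ < 1 := by
  rw [norm_mul, norm_pow]
  have := pow_le_one₀ (norm_nonneg p) hp1.le (n := n)
  nlinarith [norm_nonneg y, pow_nonneg (norm_nonneg p) n]

lemma eulInv_iterate (hp1 : ‖p‖ < 1) {y : ℂ} (hy : ‖y‖ < 1) (n : ℕ) :
    (∏ i ∈ Finset.range n, (1 - y * p ^ i)) * eulInv p y = eulInv p (y * p ^ n) := by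
  induction n with
  | zero => simp
  | succ n ih =>
    have := eulInv_step hp1 (norm_mul_pow_lt hp1 hy n)
    rw [pow_succ, ← mul_assoc, ← this, ← ih, Finset.prod_range_succ]
    ring

lemma poch_mul_eulInv (hp1 : ‖p‖ < 1) {y : ℂ} (hy : ‖y‖ < 1) :
    poch y p * eulInv p y = 1 := by
  have h1 := ((poch_hasProd hp1 y).tendsto_prod_nat).mul_const (eulInv p y)
  have h2 : Tendsto (fun n : ℕ => eulInv p (y * p ^ n)) atTop (𝓝 (eulInv p 0)) := by
    apply tendsto_tsum_of_dominated_convergence (summable_norm_eulInv hp1 hy)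
    · intro k
      have := (tendsto_pow_atTop_nhds_zero_of_norm_lt_one hp1).const_mul y
      rw [mul_zero] at this
      exact (this.pow k).div_const _
    · refine Eventually.of_forall fun n k => ?_
      rw [norm_div, norm_div, norm_pow, norm_pow]
      gcongr
      rw [norm_mul, norm_pow]
      exact mul_le_of_le_one_right (norm_nonneg _) (pow_le_one₀ (norm_nonneg p) hp1.le)
  have h3 : eulInv p 0 = 1 := by
    unfold eulInv
    rw [(summable_norm_eulInv hp1 (by simp : ‖(0 : ℂ)‖ < 1)).of_norm.tsum_eq_zero_add]
    simp [pfac_zero]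
  rw [h3] at h2
  exact tendsto_nhds_unique h1 (h2.congr fun n => (eulInv_iterate hp1 hy n).symm)

/-- The Jacobi triple product identity. -/
theorem theta_eq_poch (hp : p ≠ 0) (hp1 : ‖p‖ < 1) {x : ℂ} (hx : ‖p‖ < ‖x‖) :
    theta p x = poch p p * poch x p * poch (p * x⁻¹) p := by
  have hx0 : x ≠ 0 := by
    rintro rfl; simp at hx; linarith [norm_nonneg p]
  have hy : ‖p * x⁻¹‖ < 1 := by
    rw [norm_mul, norm_inv, ← div_eq_mul_inv, div_lt_one (norm_pos_iff.mpr hx0)]; exact hx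
  have key : theta p x * eulInv p (p * x⁻¹) = poch p p * poch x p := by
    have st : Summable fun m : ℤ => ‖gv p m * x ^ (-m)‖ := by
      have := summable_norm_gv_mul hp hp1 (inv_ne_zero hx0)
      simpa only [inv_zpow'] using this
    have sg := summable_norm_eulInv (p := p) hp1 hy
    have sm := summable_mul_of_summable_norm sg st
    let e : ℕ × ℤ ≃ ℕ × ℤ := Equiv.prodShear (Equiv.refl ℕ) fun k => Equiv.subLeft (-k : ℤ)
    have sm' := (e.summable_iff).mpr sm
    have term : ∀ (k : ℕ) (n : ℤ),
        ((fun z : ℕ × ℤ => (p * x⁻¹) ^ z.1 / pfac p z.1 * (gv p z.2 * x ^ (-z.2))) ∘ e) (k, n) =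
        gv p (-n) * x ^ n * (gv p (-k) * (p ^ (n + 1)) ^ k / pfac p k) := by
      intro k n
      simp only [Function.comp_apply, e, Equiv.prodShear_apply, Equiv.refl_apply,
        Equiv.subLeft_apply]
      have h1 : -(k : ℤ) - n = -n + -k := by ring
      have h2 : -(-n + -k : ℤ) = n + k := by ring
      have h3 : p ^ (-n * -(k : ℤ)) = (p ^ n) ^ k := by
        rw [neg_mul_neg, zpow_mul, zpow_natCast]
      rw [h1, gv_add hp, h2, zpow_add₀ hx0, h3, zpow_add_one₀ hp, mul_pow, mul_pow, inv_pow,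
        zpow_natCast]
      have : x ^ k ≠ 0 := pow_ne_zero _ hx0
      field_simp
    calc theta p x * eulInv p (p * x⁻¹)
        = ∑' z : ℕ × ℤ, (p * x⁻¹) ^ z.1 / pfac p z.1 * (gv p z.2 * x ^ (-z.2)) := by
          rw [mul_comm]; exact tsum_mul_tsum_of_summable_norm sg st
      _ = ∑' z : ℕ × ℤ, ((fun z : ℕ × ℤ =>
            (p * x⁻¹) ^ z.1 / pfac p z.1 * (gv p z.2 * x ^ (-z.2))) ∘ e) z :=
          (e.tsum_eq _).symm
      _ = ∑' (n : ℤ) (k : ℕ), gv p (-n) * x ^ n * (gv p (-k) * (p ^ (n + 1)) ^ k / pfac p k) := by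
          rw [sm'.tsum_prod, ← Summable.tsum_comm]
          · simp only [term]
          · exact sm'
      _ = ∑' n : ℤ, gv p (-n) * x ^ n * eul p (p ^ (n + 1)) := by
          simp only [tsum_mul_left]; rfl
      _ = ∑' n : ℕ, poch p p * (gv p (-n) * x ^ n / pfac p n) := by
          have hinj : Function.Injective (fun n : ℕ => (n : ℤ)) := Nat.cast_injective
          rw [← hinj.tsum_eq]
          · congr 1; ext n
            have h := eul_iterate hp hp1 p n
            rw [← poch_eq_eul hp hp1] at h
            have h5 : p ^ ((n : ℤ) + 1) = p * p ^ n := by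
              rw [zpow_add_one₀ hp, zpow_natCast, mul_comm]
            have := pfac_ne_zero hp1 n
            rw [h, h5, zpow_natCast]
            change _ = pfac p n * _ * _
            field_simp
          · intro n hn
            by_contra hcon
            apply hn
            have hneg : n < 0 := by
              by_contra h
              exact hcon ⟨n.toNat, by simp; omega⟩
            obtain ⟨j, hj⟩ : ∃ j : ℕ, n + 1 = -j := ⟨(-(n + 1)).toNat, by omega⟩
            have hz : eul p (p ^ (n + 1)) = 0 := by
              rw [eul_iterate hp hp1 _ (j + 1), Finset.prod_range_succ, hj, zpow_neg, zpow_natCast,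
                inv_mul_cancel₀ (pow_ne_zero _ hp)]
              simp
            simp [hz]
      _ = poch p p * poch x p := by
          rw [tsum_mul_left, poch_eq_eul hp hp1 x]; rfl
  linear_combination (-theta p x) * poch_mul_eulInv hp1 hy + poch (p * x⁻¹) p * key

end Euler

section Kronecker
variable {p : ℂ}

lemma theta_summable (hp : p ≠ 0) (hp1 : ‖p‖ < 1) {x : ℂ} (hx : x ≠ 0) :
    Summable fun m : ℤ => ‖gv p m * x ^ (-m)‖ := by
  have := summable_norm_gv_mul hp hp1 (inv_ne_zero hx)
  simpa only [inv_zpow'] using this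

lemma theta_mul_nome (hp : p ≠ 0) {x : ℂ} (hx : x ≠ 0) :
    theta p (x * p) = -x⁻¹ * theta p x := by
  have h := (Equiv.addRight (1 : ℤ)).tsum_eq (fun m : ℤ => gv p m * (x * p) ^ (-m))
  unfold theta
  rw [← h, ← tsum_mul_left]
  congr 1; ext m
  rw [Equiv.coe_addRight, gv_succ hp, mul_zpow, zpow_neg, zpow_neg, zpow_neg, zpow_add_one₀ hx]
  have : p ^ (m + 1) ≠ 0 := zpow_ne_zero _ hp
  have : x ^ m ≠ 0 := zpow_ne_zero _ hx
  field_simp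

lemma exists_bound_inv_neg (hp : p ≠ 0) (hp1 : ‖p‖ < 1) {y : ℂ} (hy : y ≠ 0) :
    ∃ C : ℝ, ∀ n : ℕ, ‖(1 - y * p ^ (-(n : ℤ)))⁻¹‖ ≤ C * ‖p‖ ^ n := by
  obtain ⟨C, hC⟩ := exists_bound_inv hp hp1 (inv_ne_zero hy)
  refine ⟨‖y⁻¹‖ * C, fun n => ?_⟩
  have e : (1 - y * p ^ (-(n : ℤ)))⁻¹ = -(y⁻¹) * (1 - y⁻¹ * p ^ (n : ℤ))⁻¹ * p ^ n := by
    have hn : p ^ n ≠ 0 := pow_ne_zero _ hp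
    have : (1 - y * p ^ (-(n : ℤ))) = -y * (p ^ n)⁻¹ * (1 - y⁻¹ * p ^ (n : ℤ)) := by
      rw [zpow_neg, zpow_natCast]; field_simp; ring
    rw [this, mul_inv, mul_inv, inv_inv, inv_neg]; ring
  rw [e, norm_mul, norm_mul, norm_neg, norm_pow]
  gcongr
  exact hC n

lemma summable_norm_kron (hp : p ≠ 0) (hp1 : ‖p‖ < 1) {x y : ℂ} (h1 : ‖p‖ < ‖x‖) (h2 : ‖x‖ < 1)
    (hy : y ≠ 0) : Summable fun m : ℤ => ‖x ^ m * (1 - y * p ^ m)⁻¹‖ := by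
  obtain ⟨C, hC⟩ := exists_bound_inv hp hp1 hy
  obtain ⟨D, hD⟩ := exists_bound_inv_neg hp hp1 hy
  have hx : 0 < ‖x‖ := (norm_nonneg p).trans_lt h1
  apply Summable.of_nat_of_neg
  · refine Summable.of_nonneg_of_le (fun _ => norm_nonneg _) (fun n => ?_)
      ((summable_geometric_of_lt_one (norm_nonneg x) h2).mul_right C)
    rw [norm_mul, zpow_natCast, norm_pow]
    exact mul_le_mul_of_nonneg_left (by simpa using hC n) (by positivity)
  · have h3 : ‖p‖ * ‖x‖⁻¹ < 1 := by rwa [← div_eq_mul_inv, div_lt_one hx]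
    refine Summable.of_nonneg_of_le (fun _ => norm_nonneg _) (fun n => ?_)
      ((summable_geometric_of_lt_one (by positivity) h3).mul_right D)
    rw [norm_mul, zpow_neg, zpow_natCast, norm_inv, norm_pow, mul_pow, inv_pow]
    calc (‖x‖ ^ n)⁻¹ * ‖(1 - y * p ^ (-(n : ℤ)))⁻¹‖ ≤ (‖x‖ ^ n)⁻¹ * (D * ‖p‖ ^ n) := by
          gcongr; exact hD n
      _ = _ := by ring

lemma theta_mul_kron (hp : p ≠ 0) (hp1 : ‖p‖ < 1) {x y : ℂ} (h1 : ‖p‖ < ‖x‖) (h2 : ‖x‖ < 1)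
    (hy : y ≠ 0) (hyp : ∀ m : ℤ, y * p ^ m ≠ 1) :
    theta p x * kron p x y = kap p y * theta p (x * y) := by
  have hx : x ≠ 0 := norm_pos_iff.mp ((norm_nonneg p).trans_lt h1)
  have s1 := theta_summable hp hp1 hx
  have s2 := summable_norm_kron hp hp1 h1 h2 hy
  have sm := summable_mul_of_summable_norm s1 s2
  let e : ℤ × ℤ ≃ ℤ × ℤ := Equiv.prodShear (Equiv.refl ℤ) fun k => Equiv.addRight k
  have sm' := (e.summable_iff).mpr sm
  have term : ∀ k n : ℤ,
      ((fun z : ℤ × ℤ => gv p z.1 * x ^ (-z.1) * (x ^ z.2 * (1 - y * p ^ z.2)⁻¹)) ∘ e) (k, n) =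
      x ^ n * (gv p k * (1 - y * p ^ n * p ^ k)⁻¹) := by
    intro k n
    simp only [Function.comp_apply, e, Equiv.prodShear_apply, Equiv.refl_apply,
      Equiv.coe_addRight]
    rw [zpow_add₀ hx, zpow_add₀ hp, zpow_neg, mul_assoc y]
    have : x ^ k ≠ 0 := zpow_ne_zero _ hx
    field_simp
  have hs : theta p (x * y) = ∑' n : ℤ, gv p (-n) * (x * y) ^ n := by
    unfold theta
    rw [← (Equiv.neg ℤ).tsum_eq]
    simp only [Equiv.neg_apply, neg_neg]
  calc theta p x * kron p x y
      = ∑' z : ℤ × ℤ, gv p z.1 * x ^ (-z.1) * (x ^ z.2 * (1 - y * p ^ z.2)⁻¹) :=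
        tsum_mul_tsum_of_summable_norm s1 s2
    _ = ∑' z : ℤ × ℤ, ((fun z : ℤ × ℤ =>
          gv p z.1 * x ^ (-z.1) * (x ^ z.2 * (1 - y * p ^ z.2)⁻¹)) ∘ e) z := (e.tsum_eq _).symm
    _ = ∑' (n : ℤ) (k : ℤ), x ^ n * (gv p k * (1 - y * p ^ n * p ^ k)⁻¹) := by
        rw [sm'.tsum_prod, ← Summable.tsum_comm]
        · simp only [term]
        · exact sm'
    _ = ∑' n : ℤ, x ^ n * kap p (y * p ^ n) := by simp only [tsum_mul_left]; rfl
    _ = kap p y * theta p (x * y) := by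
        rw [hs, ← tsum_mul_left]
        congr 1; ext n
        have := kap_zpow_neg hp hp1 hy hyp (-n)
        rw [neg_neg] at this
        rw [this, mul_zpow]; ring

/-- the double series expansion of the Kronecker series -/
lemma kron_expand (hp : p ≠ 0) (hp1 : ‖p‖ < 1) {x y : ℂ} (h1 : ‖p‖ < ‖x‖) (h2 : ‖x‖ < 1)
    (h3 : ‖p‖ < ‖y‖) (h4 : ‖y‖ < 1) :
    kron p x y = ∑' (n : ℕ) (k : ℕ), x ^ n * y ^ k * p ^ (n * k) -
      ∑' (n : ℕ) (k : ℕ), (x⁻¹) ^ (n + 1) * (y⁻¹) ^ (k + 1) * p ^ ((n + 1) * (k + 1)) := by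
  have hy : y ≠ 0 := norm_pos_iff.mp ((norm_nonneg p).trans_lt h3)
  have s := (summable_norm_kron hp hp1 h1 h2 hy).of_norm
  have hpy : ‖y⁻¹ * p‖ < 1 := by
    rw [norm_mul, norm_inv, mul_comm, ← div_eq_mul_inv, div_lt_one (norm_pos_iff.mpr hy)]; exact h3
  have s1 : Summable fun n : ℕ => x ^ (n : ℤ) * (1 - y * p ^ (n : ℤ))⁻¹ :=
    s.comp_injective (i := fun n : ℕ => (n : ℤ)) Nat.cast_injective
  have s2 : Summable fun n : ℕ => x ^ (-((n : ℤ) + 1)) * (1 - y * p ^ (-((n : ℤ) + 1)))⁻¹ :=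
    s.comp_injective (i := fun n : ℕ => (-((n : ℤ) + 1))) (fun a b h => by simpa using h)
  have t1 : ∀ n : ℕ, x ^ (n : ℤ) * (1 - y * p ^ (n : ℤ))⁻¹ =
      ∑' k : ℕ, x ^ n * y ^ k * p ^ (n * k) := by
    intro n
    have := tsum_geometric_of_norm_lt_one (norm_mul_pow_lt hp1 h4 n)
    rw [zpow_natCast, zpow_natCast, ← this, ← tsum_mul_left]
    congr 1; ext k
    rw [mul_pow, pow_mul]; ring
  have t2 : ∀ n : ℕ, x ^ (-((n : ℤ) + 1)) * (1 - y * p ^ (-((n : ℤ) + 1)))⁻¹ =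
      -∑' k : ℕ, (x⁻¹) ^ (n + 1) * (y⁻¹) ^ (k + 1) * p ^ ((n + 1) * (k + 1)) := by
    intro n
    have hb : ‖y⁻¹ * p * p ^ n‖ < 1 := norm_mul_pow_lt hp1 hpy n
    have hg := tsum_geometric_of_norm_lt_one hb
    have hn : p ^ (n + 1) ≠ 0 := pow_ne_zero _ hp
    have hc : (-((n : ℤ) + 1)) = -((n + 1 : ℕ) : ℤ) := by push_cast; ring
    have hz : ∀ z : ℂ, z ^ (-((n : ℤ) + 1)) = (z⁻¹) ^ (n + 1) := by
      intro z; rw [hc, zpow_neg, zpow_natCast, inv_pow]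
    have e : (1 - y * p ^ (-((n : ℤ) + 1)))⁻¹ =
        -(y⁻¹ * p * p ^ n) * (1 - y⁻¹ * p * p ^ n)⁻¹ := by
      have : (1 - y * p ^ (-((n : ℤ) + 1))) = -y * (p ^ (n + 1))⁻¹ * (1 - y⁻¹ * p * p ^ n) := by
        rw [hz, inv_pow, mul_assoc y⁻¹ p, ← pow_succ']
        field_simp; ring
      rw [this, mul_inv, mul_inv, inv_inv, inv_neg, pow_succ]; ring
    rw [e, ← hg, ← tsum_mul_left, ← tsum_mul_left, ← tsum_neg]
    congr 1; ext k
    rw [hz, pow_mul, pow_succ (p ^ (n + 1)), pow_succ y⁻¹ k, mul_assoc y⁻¹ p, ← pow_succ',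
      mul_pow]
    ring
  have h := tsum_of_nat_of_neg_add_one (f := fun m : ℤ => x ^ m * (1 - y * p ^ m)⁻¹) s1 s2
  rw [tsum_congr t1, tsum_congr t2, tsum_neg, ← sub_eq_add_neg] at h
  exact h

lemma kron_symm (hp : p ≠ 0) (hp1 : ‖p‖ < 1) {x y : ℂ} (h1 : ‖p‖ < ‖x‖) (h2 : ‖x‖ < 1)
    (h3 : ‖p‖ < ‖y‖) (h4 : ‖y‖ < 1) : kron p x y = kron p y x := by
  rw [kron_expand hp hp1 h1 h2 h3 h4, kron_expand hp hp1 h3 h4 h1 h2]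
  have hx : 0 < ‖x‖ := (norm_nonneg p).trans_lt h1
  have hy : 0 < ‖y‖ := (norm_nonneg p).trans_lt h3
  have gen : ∀ {a b : ℂ}, ‖a‖ < 1 → ‖b‖ < 1 →
      Summable (Function.uncurry fun n k : ℕ => a ^ n * b ^ k * p ^ (n * k)) := by
    intro a b ha hb
    have ga : Summable fun n : ℕ => ‖a ^ n‖ := by
      simpa only [norm_pow] using summable_geometric_of_lt_one (norm_nonneg a) ha
    have gb : Summable fun n : ℕ => ‖b ^ n‖ := by
      simpa only [norm_pow] using summable_geometric_of_lt_one (norm_nonneg b) hb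
    refine Summable.of_norm_bounded (g := fun z : ℕ × ℕ => ‖a ^ z.1‖ * ‖b ^ z.2‖)
      (ga.mul_of_nonneg gb (fun _ => norm_nonneg _) (fun _ => norm_nonneg _)) ?_
    rintro ⟨n, k⟩
    simp only [Function.uncurry_apply_pair, norm_mul, norm_pow]
    exact mul_le_of_le_one_right (by positivity) (pow_le_one₀ (norm_nonneg p) hp1.le)
  have e1 := (gen h2 h4).tsum_comm
  have hpx : ‖x⁻¹ * p‖ < 1 := by
    rw [norm_mul, norm_inv, mul_comm, ← div_eq_mul_inv, div_lt_one hx]; exact h1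
  have hpy : ‖y⁻¹ * p‖ < 1 := by
    rw [norm_mul, norm_inv, mul_comm, ← div_eq_mul_inv, div_lt_one hy]; exact h3
  have e2 := ((gen hpx hpy).mul_left (x⁻¹ * y⁻¹ * p)).tsum_comm (f := fun n k : ℕ =>
    (x⁻¹ * y⁻¹ * p) * ((x⁻¹ * p) ^ n * (y⁻¹ * p) ^ k * p ^ (n * k)))
  have t : ∀ n k : ℕ, (x⁻¹ * y⁻¹ * p) * ((x⁻¹ * p) ^ n * (y⁻¹ * p) ^ k * p ^ (n * k)) =
      (x⁻¹) ^ (n + 1) * (y⁻¹) ^ (k + 1) * p ^ ((n + 1) * (k + 1)) := by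
    intro n k
    rw [mul_pow, mul_pow, show (n + 1) * (k + 1) = n * k + n + k + 1 by ring]
    ring
  simp only [t] at e2
  rw [← e1, ← e2]
  congr 1
  · congr 1; ext n; congr 1; ext k; rw [mul_comm n k]; ring
  · congr 1; ext n; congr 1; ext k; rw [mul_comm (n + 1)]; ring

end Kronecker

/-- `x` lies in the fundamental annulus of `p` -/
def Ann (p x : ℂ) : Prop := ‖p‖ < ‖x‖ ∧ ‖x‖ < 1

section Annulus
variable {p : ℂ}

lemma Ann.ne_zero {x : ℂ} (hx : Ann p x) : x ≠ 0 :=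
  norm_pos_iff.mp ((norm_nonneg p).trans_lt hx.1)

lemma Ann.mul_zpow_ne_one {x : ℂ} (hx : Ann p x) (hp : p ≠ 0) (hp1 : ‖p‖ < 1) :
    ∀ m : ℤ, x * p ^ m ≠ 1 := norm_ne_one_of_annulus hp hp1 hx.1 hx.2

lemma Ann.norm_div {x : ℂ} (hx : Ann p x) : ‖p * x⁻¹‖ < 1 := by
  rw [norm_mul, norm_inv, ← div_eq_mul_inv, div_lt_one (norm_pos_iff.mpr hx.ne_zero)]
  exact hx.1

lemma eventually_ann {x : ℂ} (hx : Ann p x) {α : Type*} {l : Filter α} {f : α → ℂ}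
    (hf : Tendsto f l (𝓝 x)) : ∀ᶠ a in l, Ann p (f a) :=
  (hf.norm.eventually_const_lt hx.1).and (hf.norm.eventually_lt_const hx.2)

lemma poch_ne_zero_of_norm_lt (hp1 : ‖p‖ < 1) {x : ℂ} (hx : ‖x‖ < 1) : poch x p ≠ 0 := by
  refine poch_ne_zero hp1 fun n h => ?_
  have := norm_mul_pow_lt hp1 hx n
  rw [h, norm_one] at this
  exact lt_irrefl _ this

lemma theta_ne_zero (hp : p ≠ 0) (hp1 : ‖p‖ < 1) {x : ℂ} (hx : Ann p x) : theta p x ≠ 0 := by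
  rw [theta_eq_poch hp hp1 hx.1]
  exact mul_ne_zero (mul_ne_zero (poch_ne_zero_of_norm_lt hp1 hp1)
    (poch_ne_zero_of_norm_lt hp1 hx.2)) (poch_ne_zero_of_norm_lt hp1 hx.norm_div)

lemma kap_mul_one_sub_tendsto (hp : p ≠ 0) (hp1 : ‖p‖ < 1) :
    Tendsto (fun u => kap p u * (1 - u)) (𝓝[≠] 1) (𝓝 1) := by
  have hid : Tendsto (fun u : ℂ => u) (𝓝[≠] 1) (𝓝 1) := tendsto_id.mono_left nhdsWithin_le_nhds
  have e1 : (1 : ℂ) = ∑' m : ℤ, if m = 0 then (1 : ℂ) else 0 := by simp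
  have hpp : 0 < ‖p‖ := norm_pos_iff.mpr hp
  obtain ⟨r, hr⟩ : ∃ r, r = (1 + ‖p‖) / 2 := ⟨_, rfl⟩
  have hr1 : r < 1 := by linarith
  have hr0 : 0 < r := by linarith
  have key : Tendsto (fun u => ∑' m : ℤ, gv p m * (1 - u * p ^ m)⁻¹ * (1 - u)) (𝓝[≠] 1)
      (𝓝 (∑' m : ℤ, if m = 0 then (1 : ℂ) else 0)) := by
    apply tendsto_tsum_of_dominated_convergence
      ((summable_norm_gv hp hp1).mul_right ((1 - r)⁻¹))
    · intro m
      by_cases hm : m = 0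
      · subst hm
        refine tendsto_const_nhds.congr' ?_
        filter_upwards [self_mem_nhdsWithin] with u hu
        have : (1 : ℂ) - u ≠ 0 := sub_ne_zero.mpr (Ne.symm hu)
        simp [gv_zero, this]
      · simp only [hm, if_false]
        have hd : (1 : ℂ) - 1 * p ^ m ≠ 0 := by
          intro h
          have h' : ‖p‖ ^ m = 1 := by
            rw [← norm_zpow, show p ^ m = 1 by linear_combination -h, norm_one]
          rcases (zpow_eq_one_iff_of_ne_zero₀ hm).mp h' with h | h <;> linarith
        have := (((tendsto_const_nhds (x := (1 : ℂ))).sub (hid.mul_const (p ^ m))).inv₀ hd).const_mul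
          (gv p m) |>.mul ((tendsto_const_nhds (x := (1 : ℂ))).sub hid)
        simpa using this
    · have n1 : ∀ᶠ u : ℂ in 𝓝[≠] 1, ‖u‖ * ‖p‖ < r := by
        apply (hid.norm.mul_const ‖p‖).eventually_lt_const
        rw [norm_one]; linarith
      have n2 : ∀ᶠ u : ℂ in 𝓝[≠] 1, ‖p‖ < r * ‖u‖ := by
        apply (hid.norm.const_mul r).eventually_const_lt
        rw [norm_one]; linarith
      have n3 : ∀ᶠ u : ℂ in 𝓝[≠] 1, ‖1 - u‖ < 1 := by
        apply ((tendsto_const_nhds (x := (1 : ℂ))).sub hid).norm.eventually_lt_const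
        simp
      filter_upwards [n1, n2, n3, self_mem_nhdsWithin] with u h1 h2 h3 hu m
      have hu' : (1 : ℂ) - u ≠ 0 := sub_ne_zero.mpr (Ne.symm hu)
      rw [mul_assoc, norm_mul]
      refine mul_le_mul_of_nonneg_left ?_ (norm_nonneg _)
      have hr2 : 1 ≤ (1 - r)⁻¹ := (one_le_inv₀ (by linarith)).mpr (by linarith)
      by_cases hm : m = 0
      · subst hm
        simpa [hu'] using hr2
      · have hlow : 1 - r ≤ ‖1 - u * p ^ m‖ := by
          rcases lt_or_gt_of_ne hm with h | h
          · have a1 : ‖p‖⁻¹ ≤ ‖p‖ ^ m := by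
              rw [← zpow_neg_one]
              apply zpow_le_zpow_right_of_le_one₀ hpp hp1.le; omega
            have a2 : ‖u * p ^ m‖ - ‖(1 : ℂ)‖ ≤ ‖1 - u * p ^ m‖ := by
              rw [norm_sub_rev]; exact norm_sub_norm_le _ _
            rw [norm_mul, norm_zpow, norm_one] at a2
            have a3 : 1 ≤ r * (‖u‖ * ‖p‖⁻¹) := by
              rw [← mul_assoc, ← div_eq_mul_inv, one_le_div hpp]; exact h2.le
            have a4 : ‖u‖ * ‖p‖⁻¹ ≤ ‖u‖ * ‖p‖ ^ m := by gcongr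
            nlinarith
          · have a1 : ‖p‖ ^ m ≤ ‖p‖ ^ (1 : ℤ) := by
              apply zpow_le_zpow_right_of_le_one₀ hpp hp1.le; omega
            rw [zpow_one] at a1
            have a2 := norm_sub_norm_le (1 : ℂ) (u * p ^ m)
            rw [norm_mul, norm_zpow, norm_one] at a2
            have a4 : ‖u‖ * ‖p‖ ^ m ≤ ‖u‖ * ‖p‖ := by gcongr
            linarith
        rw [norm_mul, norm_inv]
        have : ‖1 - u * p ^ m‖⁻¹ ≤ (1 - r)⁻¹ := by
          apply inv_anti₀ (by linarith) hlow
        calc _ ≤ (1 - r)⁻¹ * 1 := by gcongr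
          _ = _ := mul_one _
  rw [← e1] at key
  refine key.congr fun u => ?_
  rw [tsum_mul_right]; rfl

/-- approach to `1` from inside the unit disc -/
noncomputable def inner1 : Filter ℂ := 𝓝[Metric.ball 0 1] 1

instance : inner1.NeBot := by
  apply mem_closure_iff_nhdsWithin_neBot.mp
  rw [closure_ball _ one_ne_zero]; simp

lemma inner1_le : inner1 ≤ 𝓝[≠] 1 := by
  apply nhdsWithin_mono
  intro u hu
  simp only [Metric.mem_ball, dist_zero_right] at hu
  simp only [Set.mem_compl_iff, Set.mem_singleton_iff]
  rintro rfl
  simp at hu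

lemma inner1_tendsto : Tendsto (fun u : ℂ => u) inner1 (𝓝 1) :=
  tendsto_id.mono_left nhdsWithin_le_nhds

lemma inner1_norm : ∀ᶠ u in inner1, ‖u‖ < 1 := by
  have : ∀ᶠ u in inner1, u ∈ Metric.ball (0 : ℂ) 1 := self_mem_nhdsWithin
  filter_upwards [this] with u hu
  simpa using hu

lemma inner1_ann (hp1 : ‖p‖ < 1) : ∀ᶠ u in inner1, Ann p u := by
  have h : ∀ᶠ u in inner1, ‖p‖ < ‖u‖ := inner1_tendsto.norm.eventually_const_lt (by simpa using hp1)
  exact h.and inner1_norm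

lemma inner1_ne : ∀ᶠ u in inner1, (1 : ℂ) - u ≠ 0 := by
  filter_upwards [inner1_norm] with u hu h
  rw [← sub_eq_zero.mp h, norm_one] at hu
  exact lt_irrefl _ hu

theorem theta_mul_kap (hp : p ≠ 0) (hp1 : ‖p‖ < 1) {x : ℂ} (hx : Ann p x) :
    theta p x * kap p x = poch p p ^ 3 := by
  have hid := inner1_tendsto
  have l1 : Tendsto (fun u => theta p u * kap p u) inner1 (𝓝 (poch p p ^ 3)) := by
    have a1 := poch_tendsto hp hp1 (hid.mul_const p)
    have a2 := poch_tendsto hp hp1 ((hid.inv₀ one_ne_zero).const_mul p)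
    have a3 := (kap_mul_one_sub_tendsto hp hp1).mono_left inner1_le
    have := ((a1.mul a2).mul a3).const_mul (poch p p)
    simp only [one_mul, inv_one, mul_one] at this
    rw [show poch p p ^ 3 = poch p p * (poch p p * poch p p) by ring]
    refine this.congr' ?_
    filter_upwards [inner1_ann hp1] with u hu
    rw [theta_eq_poch hp hp1 hu.1, poch_step hp hp1 u]; ring
  have l2 : ∀ᶠ u in inner1, theta p u * kap p u = theta p x * kap p x := by
    have h1 : Tendsto (fun u => x * u) inner1 (𝓝 x) := by simpa using hid.const_mul x
    filter_upwards [inner1_ann hp1, eventually_ann hx h1] with u hu hxu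
    have b1 := theta_mul_kron hp hp1 hx.1 hx.2 hu.ne_zero (hu.mul_zpow_ne_one hp hp1)
    have b2 := theta_mul_kron hp hp1 hu.1 hu.2 hx.ne_zero (hx.mul_zpow_ne_one hp hp1)
    rw [kron_symm hp hp1 hu.1 hu.2 hx.1 hx.2, mul_comm u x] at b2
    apply mul_right_cancel₀ (theta_ne_zero hp hp1 hxu)
    linear_combination theta p x * b2 - theta p u * b1
  exact tendsto_nhds_unique (tendsto_const_nhds.congr' (l2.mono fun _ h => h.symm)) l1

lemma poch_self_ne_zero (hp1 : ‖p‖ < 1) : poch p p ≠ 0 := poch_ne_zero_of_norm_lt hp1 hp1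

lemma kap_ne_zero (hp : p ≠ 0) (hp1 : ‖p‖ < 1) {x : ℂ} (hx : Ann p x) : kap p x ≠ 0 := by
  intro h
  have := theta_mul_kap hp hp1 hx
  rw [h, mul_zero] at this
  exact pow_ne_zero 3 (poch_self_ne_zero hp1) this.symm

/-- Kronecker's formula -/
theorem kron_mul_kap (hp : p ≠ 0) (hp1 : ‖p‖ < 1) {x y : ℂ} (hx : Ann p x) (hy : y ≠ 0)
    (hyp : ∀ m : ℤ, y * p ^ m ≠ 1) (hxy : Ann p (x * y)) :
    kron p x y * kap p (x * y) = kap p x * kap p y := by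
  have h := theta_mul_kron hp hp1 hx.1 hx.2 hy hyp
  have h1 := theta_mul_kap hp hp1 hx
  have h2 := theta_mul_kap hp hp1 hxy
  apply mul_left_cancel₀ (pow_ne_zero 3 (poch_self_ne_zero hp1))
  linear_combination kap p x * kap p (x * y) * h - kron p x y * kap p (x * y) * h1
    + kap p x * kap p y * h2

theorem kron_mul_kap_nome (hp : p ≠ 0) (hp1 : ‖p‖ < 1) {x y z : ℂ} (hx : Ann p x) (hy : y ≠ 0)
    (hyp : ∀ m : ℤ, y * p ^ m ≠ 1) (hz : Ann p z) (hxy : x * y = z * p) :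
    kron p x y * (-z * kap p z) = kap p x * kap p y := by
  have h := theta_mul_kron hp hp1 hx.1 hx.2 hy hyp
  have h1 := theta_mul_kap hp hp1 hx
  have h2 := theta_mul_kap hp hp1 hz
  rw [hxy, theta_mul_nome hp hz.ne_zero] at h
  have h3 : z⁻¹ * z = 1 := inv_mul_cancel₀ hz.ne_zero
  apply mul_left_cancel₀ (pow_ne_zero 3 (poch_self_ne_zero hp1))
  linear_combination kap p x * (-z * kap p z) * h - kron p x y * (-z * kap p z) * h1
    + kap p x * kap p y * h2 + kap p x * kap p y * theta p z * kap p z * h3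

lemma eul_differentiable (hp : p ≠ 0) (hp1 : ‖p‖ < 1) : Differentiable ℂ (eul p) := by
  intro x
  have h1 : ∀ k : ℕ, ∀ w : ℂ, w ∈ Metric.ball (0 : ℂ) (‖x‖ + 1) → ‖gv p (-k) * w ^ k / pfac p k‖ ≤
      ‖gv p (-k) * ((‖x‖ + 1 : ℝ) : ℂ) ^ k / pfac p k‖ := by
    intro k w hw
    have ha : ‖w‖ < ‖x‖ + 1 := by simpa using hw
    have h0 : 0 ≤ ‖x‖ + 1 := by positivity
    rw [norm_div, norm_mul, norm_div, norm_mul, norm_pow, norm_pow, Complex.norm_real,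
      Real.norm_of_nonneg h0]
    gcongr
  have h2 : ∀ k : ℕ, DifferentiableOn ℂ (fun w : ℂ => gv p (-k) * w ^ k / pfac p k)
      (Metric.ball 0 (‖x‖ + 1)) := fun k =>
    ((differentiableOn_id.pow k).const_mul _).div_const _
  have h3 : DifferentiableOn ℂ (eul p) (Metric.ball 0 (‖x‖ + 1)) :=
    Complex.differentiableOn_tsum_of_summable_norm
      (summable_norm_eul hp hp1 ((‖x‖ + 1 : ℝ) : ℂ)) h2 Metric.isOpen_ball h1
  exact h3.differentiableAt (Metric.isOpen_ball.mem_nhds (by simp))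

lemma poch_differentiable (hp : p ≠ 0) (hp1 : ‖p‖ < 1) :
    Differentiable ℂ (fun x => poch x p) := by
  simp only [poch_eq_eul hp hp1]
  exact eul_differentiable hp hp1

lemma kap_differentiableAt (hp : p ≠ 0) (hp1 : ‖p‖ < 1) {x : ℂ} (hx : Ann p x) :
    DifferentiableAt ℂ (kap p) x := by
  have h1 : DifferentiableAt ℂ (fun y => poch y p) x := poch_differentiable hp hp1 x
  have hx0 := hx.ne_zero
  have h0 : DifferentiableAt ℂ (fun y : ℂ => p * y⁻¹) x := (differentiableAt_inv hx0).const_mul p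
  have h2 : DifferentiableAt ℂ (fun y => poch (p * y⁻¹) p) x :=
    DifferentiableAt.comp (g := fun y => poch y p) (f := fun y : ℂ => p * y⁻¹) x
      (poch_differentiable hp hp1 (p * x⁻¹)) h0
  have h3 : DifferentiableAt ℂ
      (fun y => poch p p ^ 3 / (poch p p * poch y p * poch (p * y⁻¹) p)) x := by
    refine DifferentiableAt.div (differentiableAt_const _) ((h1.const_mul _).mul h2) ?_
    have := theta_ne_zero hp hp1 hx
    rwa [theta_eq_poch hp hp1 hx.1] at this
  have hid : Tendsto (fun y : ℂ => y) (𝓝 x) (𝓝 x) := tendsto_id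
  refine h3.congr_of_eventuallyEq ?_
  filter_upwards [eventually_ann hx hid] with y hy
  have := theta_mul_kap hp hp1 hy
  rw [← theta_eq_poch hp hp1 hy.1, eq_div_iff (theta_ne_zero hp hp1 hy), ← this, mul_comm]

end Annulus

section Fay
variable {p : ℂ}

lemma inv_mul_inv_split {a b : ℂ} (ha : a ≠ 0) (hb : b ≠ 0) (t : ℂ) (hab : a ≠ b)
    (h1 : 1 - a * t ≠ 0) (h2 : 1 - b * t ≠ 0) :
    (1 - a * t)⁻¹ * (1 - b * t)⁻¹ =
      (1 - b * a⁻¹)⁻¹ * (1 - a * t)⁻¹ + (1 - a * b⁻¹)⁻¹ * (1 - b * t)⁻¹ := by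
  have h3 : a - b ≠ 0 := sub_ne_zero.mpr hab
  have h4 : b - a ≠ 0 := sub_ne_zero.mpr hab.symm
  have e1 : (1 - b * a⁻¹)⁻¹ = a * (a - b)⁻¹ := by
    rw [show 1 - b * a⁻¹ = a⁻¹ * (a - b) by field_simp, mul_inv, inv_inv]
  have e2 : (1 - a * b⁻¹)⁻¹ = b * (b - a)⁻¹ := by
    rw [show 1 - a * b⁻¹ = b⁻¹ * (b - a) by field_simp, mul_inv, inv_inv]
  have e3 : (b - a)⁻¹ = -(a - b)⁻¹ := by rw [← inv_neg, neg_sub]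
  rw [e1, e2, e3]
  have u := mul_inv_cancel₀ h1
  have v := mul_inv_cancel₀ h2
  have w := mul_inv_cancel₀ h3
  generalize (1 - a * t)⁻¹ = A at *
  generalize (1 - b * t)⁻¹ = B at *
  generalize (a - b)⁻¹ = C at *
  linear_combination (a * C * A) * v - (b * C * B) * u - (A * B) * w

/-- Fay's trisecant identity for the Kronecker series -/
theorem kron_mul_kron (hp : p ≠ 0) (hp1 : ‖p‖ < 1) {x x' y y' : ℂ} (hx : Ann p x)
    (hx' : Ann p x') (hxx : Ann p (x * x')) (hy : y ≠ 0) (hy' : y' ≠ 0)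
    (h1 : ∀ m : ℤ, y * p ^ m ≠ 1) (h2 : ∀ m : ℤ, y' * p ^ m ≠ 1)
    (h3 : ∀ m : ℤ, y * y'⁻¹ * p ^ m ≠ 1) :
    kron p x y * kron p x' y' = kron p (x * x') y * kron p x' (y' * y⁻¹) +
      kron p (x * x') y' * kron p x (y * y'⁻¹) := by
  let f (x y : ℂ) (m : ℤ) : ℂ := x ^ m * (1 - y * p ^ m)⁻¹
  have sf : ∀ {x y : ℂ}, Ann p x → y ≠ 0 → Summable fun m => ‖f x y m‖ := fun hx hy =>
    summable_norm_kron hp hp1 hx.1 hx.2 hy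
  have hyy : y * y'⁻¹ ≠ 0 := mul_ne_zero hy (inv_ne_zero hy')
  have hyy' : y' * y⁻¹ ≠ 0 := mul_ne_zero hy' (inv_ne_zero hy)
  have s0 := summable_mul_of_summable_norm (sf hx' hy') (sf hx hy)
  have sA := summable_mul_of_summable_norm (sf hx' hyy') (sf hxx hy)
  have sB := summable_mul_of_summable_norm (sf hxx hy') (sf hx hyy)
  let e : ℤ × ℤ ≃ ℤ × ℤ := Equiv.prodShear (Equiv.refl ℤ) fun m => Equiv.addRight m
  let d : ℤ × ℤ ≃ ℤ × ℤ :=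
    { toFun := fun z => (-z.2, z.2 + z.1)
      invFun := fun z => (z.2 + z.1, -z.1)
      left_inv := fun z => by ext <;> simp
      right_inv := fun z => by ext <;> simp }
  have term : ∀ z : ℤ × ℤ, f x' y' (e z).1 * f x y (e z).2 =
      f x' (y' * y⁻¹) (d z).1 * f (x * x') y (d z).2 + f (x * x') y' z.1 * f x (y * y'⁻¹) z.2 := by
    rintro ⟨m, n⟩
    have g1 : 1 - y * p ^ n * p ^ m ≠ 0 := by
      rw [mul_assoc, ← zpow_add₀ hp]; exact fun h => h1 _ (by linear_combination -h)
    have g2 : 1 - y' * p ^ m ≠ 0 := fun h => h2 _ (by linear_combination -h)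
    have hn : p ^ n ≠ 0 := zpow_ne_zero _ hp
    have g3 : y * p ^ n ≠ y' := by
      intro h
      apply h3 n
      rw [mul_right_comm, h, mul_inv_cancel₀ hy']
    have sp := inv_mul_inv_split (mul_ne_zero hy hn) hy' (p ^ m) g3 g1 g2
    simp only [f, e, d, Equiv.prodShear_apply, Equiv.refl_apply, Equiv.coe_addRight,
      Equiv.coe_fn_mk]
    rw [zpow_add₀ hp, zpow_add₀ hx.ne_zero, mul_zpow, mul_zpow, zpow_add₀ hx.ne_zero,
      zpow_add₀ hx'.ne_zero, zpow_neg, zpow_neg, ← mul_assoc y]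
    rw [mul_inv, ← mul_assoc, mul_right_comm y] at sp
    have hx'n : (x' ^ n)⁻¹ * x' ^ n = 1 := inv_mul_cancel₀ (zpow_ne_zero _ hx'.ne_zero)
    linear_combination (x' ^ m * x ^ n * x ^ m) * sp - (x ^ n * x ^ m * x' ^ m *
      (1 - y' * y⁻¹ * (p ^ n)⁻¹)⁻¹ * (1 - y * p ^ n * p ^ m)⁻¹) * hx'n
  calc kron p x y * kron p x' y'
      = ∑' z : ℤ × ℤ, f x' y' z.1 * f x y z.2 := by
        rw [mul_comm]; exact tsum_mul_tsum_of_summable_norm (sf hx' hy') (sf hx hy)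
    _ = ∑' z : ℤ × ℤ, f x' y' (e z).1 * f x y (e z).2 :=
        (e.tsum_eq (fun z : ℤ × ℤ => f x' y' z.1 * f x y z.2)).symm
    _ = ∑' z : ℤ × ℤ, (f x' (y' * y⁻¹) (d z).1 * f (x * x') y (d z).2 +
          f (x * x') y' z.1 * f x (y * y'⁻¹) z.2) := tsum_congr term
    _ = ∑' z : ℤ × ℤ, f x' (y' * y⁻¹) (d z).1 * f (x * x') y (d z).2 +
          ∑' z : ℤ × ℤ, f (x * x') y' z.1 * f x (y * y'⁻¹) z.2 :=
        Summable.tsum_add ((d.summable_iff).mpr sA) sB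
    _ = ∑' z : ℤ × ℤ, f x' (y' * y⁻¹) z.1 * f (x * x') y z.2 +
          ∑' z : ℤ × ℤ, f (x * x') y' z.1 * f x (y * y'⁻¹) z.2 := by
        rw [d.tsum_eq (fun z : ℤ × ℤ => f x' (y' * y⁻¹) z.1 * f (x * x') y z.2)]
    _ = _ := by
        rw [← tsum_mul_tsum_of_summable_norm (sf hx' hyy') (sf hxx hy),
          ← tsum_mul_tsum_of_summable_norm (sf hxx hy') (sf hx hyy), mul_comm]
        rfl

/-- the cubic analogue of the series `kap` -/
noncomputable def kap3 (p t w : ℂ) : ℂ := ∑' m : ℤ, gv p m ^ 3 * t ^ m * (1 - w * p ^ m)⁻¹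

lemma hasSum_triple (hp : p ≠ 0) (hp1 : ‖p‖ < 1) {f : ℤ → ℂ} (hf : Summable fun m => ‖f m‖)
    {a b : ℂ} (ha : a ≠ 0) (hb : b ≠ 0) (hap : ∀ m : ℤ, a * p ^ m ≠ 1)
    (hbp : ∀ m : ℤ, b * p ^ m ≠ 1) :
    HasSum (fun z : ℤ × ℤ × ℤ => f z.1 * (gv p z.2.1 * (1 - a * p ^ (z.2.1 - z.1))⁻¹ *
      (gv p z.2.2 * (1 - b * p ^ (z.2.2 - z.1))⁻¹)))
      (kap p a * kap p b * ∑' m, f m * gv p m ^ 2 * ((a * b) ^ m)⁻¹) := by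
  obtain ⟨C, hC⟩ := exists_bound_inv hp hp1 ha
  obtain ⟨D, hD⟩ := exists_bound_inv hp hp1 hb
  have hC0 : 0 ≤ C := (norm_nonneg _).trans (hC 0)
  have sg := summable_norm_gv hp hp1
  have sgg : Summable fun z : ℤ × ℤ => ‖gv p z.1‖ * ‖gv p z.2‖ :=
    sg.mul_of_nonneg sg (fun _ => norm_nonneg _) (fun _ => norm_nonneg _)
  have sfg : Summable fun z : ℤ × ℤ × ℤ => ‖f z.1‖ * (‖gv p z.2.1‖ * ‖gv p z.2.2‖) :=
    hf.mul_of_nonneg sgg (fun _ => norm_nonneg _) (fun _ => by positivity)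
  have s : Summable (fun z : ℤ × ℤ × ℤ => f z.1 * (gv p z.2.1 * (1 - a * p ^ (z.2.1 - z.1))⁻¹ *
      (gv p z.2.2 * (1 - b * p ^ (z.2.2 - z.1))⁻¹))) := by
    refine Summable.of_norm_bounded (sfg.mul_right (C * D)) fun z => ?_
    simp only [norm_mul]
    have e1 := hC (z.2.1 - z.1)
    have e2 := hD (z.2.2 - z.1)
    calc _ ≤ ‖f z.1‖ * (‖gv p z.2.1‖ * C * (‖gv p z.2.2‖ * D)) := by gcongr
      _ = _ := by ring
  have hs := s.hasSum
  rw [s.tsum_prod] at hs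
  convert hs using 1
  rw [← tsum_mul_left]
  congr 1; ext i
  have inner : ∀ {c : ℂ}, c ≠ 0 → (∀ m : ℤ, c * p ^ m ≠ 1) →
      ∑' j : ℤ, gv p j * (1 - c * p ^ (j - i))⁻¹ = gv p i * (c ^ i)⁻¹ * kap p c := by
    intro c hc hcp
    rw [← zpow_neg, ← kap_zpow_neg hp hp1 hc hcp i]
    unfold kap
    congr 1; ext j
    rw [mul_assoc c, ← zpow_add₀ hp]; congr 5; ring
  have sn : ∀ {c : ℂ}, c ≠ 0 → Summable fun j : ℤ => ‖gv p j * (1 - c * p ^ (j - i))⁻¹‖ := by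
    intro c hc
    have := summable_norm_kap hp hp1 (x := c * p ^ (-i)) (mul_ne_zero hc (zpow_ne_zero _ hp))
    refine this.congr fun j => ?_
    rw [mul_assoc c, ← zpow_add₀ hp]; congr 5; ring_nf
  change _ = ∑' c : ℤ × ℤ, f i * (gv p c.1 * (1 - a * p ^ (c.1 - i))⁻¹ *
    (gv p c.2 * (1 - b * p ^ (c.2 - i))⁻¹))
  rw [tsum_mul_left, ← tsum_mul_tsum_of_summable_norm (sn ha) (sn hb), inner ha hap, inner hb hbp,
    mul_zpow, mul_inv]
  ring

/-- partial fractions of a product of three reciprocal theta functions -/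
theorem kap_triple (hp : p ≠ 0) (hp1 : ‖p‖ < 1) {z t : ℂ} (hz : z ≠ 0) (ht : t ≠ 0)
    (h1 : ∀ m : ℤ, z * t⁻¹ * p ^ m ≠ 1) (h2 : ∀ m : ℤ, z * p ^ m ≠ 1)
    (h3 : ∀ m : ℤ, z * t * p ^ m ≠ 1)
    (ht1 : ∀ m : ℤ, t * p ^ m ≠ 1) (ht2 : ∀ m : ℤ, t ^ 2 * p ^ m ≠ 1) :
    kap p (z * t⁻¹) * kap p z * kap p (z * t) =
      kap p t * kap p (t ^ 2) * (kap3 p (t ^ 3)⁻¹ (z * t⁻¹) + t ^ 3 * kap3 p (t ^ 3) (z * t)) -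
        t * kap p t ^ 2 * kap3 p 1 z := by
  have inv_lat : ∀ {c : ℂ}, c ≠ 0 → (∀ m : ℤ, c * p ^ m ≠ 1) → ∀ m : ℤ, c⁻¹ * p ^ m ≠ 1 := by
    intro c hc h m hm
    apply h (-m)
    rw [zpow_neg]
    have : p ^ m ≠ 0 := zpow_ne_zero _ hp
    field_simp at hm ⊢
    exact hm.symm
  have hti := inv_ne_zero ht
  have ht2' : t ^ 2 ≠ 0 := pow_ne_zero _ ht
  have sA := summable_norm_kap hp hp1 (x := z * t⁻¹) (mul_ne_zero hz hti)
  have sB := summable_norm_kap hp hp1 (x := z) hz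
  have sC := summable_norm_kap hp hp1 (x := z * t) (mul_ne_zero hz ht)
  have sBC : Summable fun w : ℤ × ℤ => ‖gv p w.1 * (1 - z * p ^ w.1)⁻¹ *
      (gv p w.2 * (1 - z * t * p ^ w.2)⁻¹)‖ := by
    simp only [norm_mul] at sB sC ⊢
    exact sB.mul_of_nonneg sC (fun _ => by positivity) (fun _ => by positivity)
  have A1 := hasSum_triple hp hp1 sA ht ht2' ht1 ht2
  have B1 := hasSum_triple hp hp1 sB hti ht (inv_lat ht ht1) ht1
  have C1 := hasSum_triple hp hp1 sC (inv_ne_zero ht2') hti (inv_lat ht2' ht2) (inv_lat ht ht1)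
  let eB : ℤ × ℤ × ℤ ≃ ℤ × ℤ × ℤ :=
    { toFun := fun w => (w.2.1, w.1, w.2.2)
      invFun := fun w => (w.2.1, w.1, w.2.2)
      left_inv := fun _ => rfl
      right_inv := fun _ => rfl }
  let eC : ℤ × ℤ × ℤ ≃ ℤ × ℤ × ℤ :=
    { toFun := fun w => (w.2.2, w.1, w.2.1)
      invFun := fun w => (w.2.1, w.2.2, w.1)
      left_inv := fun _ => rfl
      right_inv := fun _ => rfl }
  have tot := (A1.add ((eB.hasSum_iff).mpr B1)).add ((eC.hasSum_iff).mpr C1)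
  have lhs : kap p (z * t⁻¹) * kap p z * kap p (z * t) =
      ∑' w : ℤ × ℤ × ℤ, gv p w.1 * (1 - z * t⁻¹ * p ^ w.1)⁻¹ *
        (gv p w.2.1 * (1 - z * p ^ w.2.1)⁻¹ * (gv p w.2.2 * (1 - z * t * p ^ w.2.2)⁻¹)) := by
    have e1 := tsum_mul_tsum_of_summable_norm sB sC
    have e2 := tsum_mul_tsum_of_summable_norm sA sBC
    rw [← e1] at e2
    rw [mul_assoc]; exact e2
  have term : ∀ w : ℤ × ℤ × ℤ, gv p w.1 * (1 - z * t⁻¹ * p ^ w.1)⁻¹ *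
        (gv p w.2.1 * (1 - z * p ^ w.2.1)⁻¹ * (gv p w.2.2 * (1 - z * t * p ^ w.2.2)⁻¹)) =
      gv p w.1 * (1 - z * t⁻¹ * p ^ w.1)⁻¹ * (gv p w.2.1 * (1 - t * p ^ (w.2.1 - w.1))⁻¹ *
        (gv p w.2.2 * (1 - t ^ 2 * p ^ (w.2.2 - w.1))⁻¹)) +
      gv p w.2.1 * (1 - z * p ^ w.2.1)⁻¹ * (gv p w.1 * (1 - t⁻¹ * p ^ (w.1 - w.2.1))⁻¹ *
        (gv p w.2.2 * (1 - t * p ^ (w.2.2 - w.2.1))⁻¹)) +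
      gv p w.2.2 * (1 - z * t * p ^ w.2.2)⁻¹ * (gv p w.1 * (1 - (t ^ 2)⁻¹ * p ^ (w.1 - w.2.2))⁻¹ *
        (gv p w.2.1 * (1 - t⁻¹ * p ^ (w.2.1 - w.2.2))⁻¹)) := by
    rintro ⟨i, j, k⟩
    simp only
    have gA : 1 - z * t⁻¹ * p ^ i ≠ 0 := fun h => h1 _ (by linear_combination -h)
    have gB : 1 - z * p ^ j ≠ 0 := fun h => h2 _ (by linear_combination -h)
    have gC : 1 - z * t * p ^ k ≠ 0 := fun h => h3 _ (by linear_combination -h)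
    have nAB : 1 - t * p ^ (j - i) ≠ 0 := fun h => ht1 _ (by linear_combination -h)
    have nAC : 1 - t ^ 2 * p ^ (k - i) ≠ 0 := fun h => ht2 _ (by linear_combination -h)
    have nBC : 1 - t * p ^ (k - j) ≠ 0 := fun h => ht1 _ (by linear_combination -h)
    rw [zpow_sub₀ hp] at nAB nAC nBC
    rw [zpow_sub₀ hp, zpow_sub₀ hp, zpow_sub₀ hp, zpow_sub₀ hp, zpow_sub₀ hp, zpow_sub₀ hp]
    have hi : p ^ i ≠ 0 := zpow_ne_zero _ hp
    have hj : p ^ j ≠ 0 := zpow_ne_zero _ hp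
    have hk : p ^ k ≠ 0 := zpow_ne_zero _ hp
    generalize p ^ i = a at *
    generalize p ^ j = b at *
    generalize p ^ k = c at *
    have dAB : a - t * b ≠ 0 := by
      intro h; apply nAB; field_simp; linear_combination h
    have dAC : a - t ^ 2 * c ≠ 0 := by
      intro h; apply nAC; field_simp; linear_combination h
    have dBC : b - t * c ≠ 0 := by
      intro h; apply nBC; field_simp; linear_combination h
    have gA' : t - z * a ≠ 0 := by
      intro h; apply gA; field_simp; linear_combination h
    have i1 : (1 - z * t⁻¹ * a)⁻¹ = t * (t - z * a)⁻¹ := by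
      rw [show 1 - z * t⁻¹ * a = t⁻¹ * (t - z * a) by field_simp, mul_inv, inv_inv]
    have i2 : (1 - t * (b / a))⁻¹ = a * (a - t * b)⁻¹ := by
      rw [show 1 - t * (b / a) = a⁻¹ * (a - t * b) by field_simp, mul_inv, inv_inv]
    have i3 : (1 - t ^ 2 * (c / a))⁻¹ = a * (a - t ^ 2 * c)⁻¹ := by
      rw [show 1 - t ^ 2 * (c / a) = a⁻¹ * (a - t ^ 2 * c) by field_simp, mul_inv, inv_inv]
    have i4 : (1 - t⁻¹ * (a / b))⁻¹ = -(t * b) * (a - t * b)⁻¹ := by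
      rw [show 1 - t⁻¹ * (a / b) = -(t * b)⁻¹ * (a - t * b) by field_simp; ring, mul_inv, inv_neg,
        inv_inv]
    have i5 : (1 - t * (c / b))⁻¹ = b * (b - t * c)⁻¹ := by
      rw [show 1 - t * (c / b) = b⁻¹ * (b - t * c) by field_simp, mul_inv, inv_inv]
    have i6 : (1 - (t ^ 2)⁻¹ * (a / c))⁻¹ = -(t ^ 2 * c) * (a - t ^ 2 * c)⁻¹ := by
      rw [show 1 - (t ^ 2)⁻¹ * (a / c) = -(t ^ 2 * c)⁻¹ * (a - t ^ 2 * c) by field_simp; ring,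
        mul_inv, inv_neg, inv_inv]
    have i7 : (1 - t⁻¹ * (b / c))⁻¹ = -(t * c) * (b - t * c)⁻¹ := by
      rw [show 1 - t⁻¹ * (b / c) = -(t * c)⁻¹ * (b - t * c) by field_simp; ring, mul_inv, inv_neg,
        inv_inv]
    rw [i1, i2, i3, i4, i5, i6, i7]
    have gB' : 1 - b * z ≠ 0 := by rwa [mul_comm]
    have gC' : 1 - t * c * z ≠ 0 := fun h => gC (by linear_combination h)
    have gC'' : 1 - z * c * t ≠ 0 := fun h => gC (by linear_combination h)
    have gC3 : 1 - t * z * c ≠ 0 := fun h => gC (by linear_combination h)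
    field_simp
    ring
  have tot' := tot.tsum_eq
  rw [lhs, tsum_congr term]
  refine Eq.trans tot' ?_
  have k1 := kap_inv hp ht ht1
  have k2 := kap_inv hp ht2' ht2
  have z1 : ∑' m : ℤ, gv p m * (1 - z * t⁻¹ * p ^ m)⁻¹ * gv p m ^ 2 * ((t * t ^ 2) ^ m)⁻¹ =
      kap3 p (t ^ 3)⁻¹ (z * t⁻¹) := by
    unfold kap3
    congr 1; ext m
    rw [inv_zpow, ← pow_succ']; ring
  have z2 : ∑' m : ℤ, gv p m * (1 - z * p ^ m)⁻¹ * gv p m ^ 2 * ((t⁻¹ * t) ^ m)⁻¹ =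
      kap3 p 1 z := by
    unfold kap3
    congr 1; ext m
    rw [inv_mul_cancel₀ ht, one_zpow]; ring
  have z3 : ∑' m : ℤ, gv p m * (1 - z * t * p ^ m)⁻¹ * gv p m ^ 2 * (((t ^ 2)⁻¹ * t⁻¹) ^ m)⁻¹ =
      kap3 p (t ^ 3) (z * t) := by
    unfold kap3
    congr 1; ext m
    rw [← mul_inv, inv_zpow, inv_inv, ← pow_succ]; ring
  rw [z1, z2, z3, k1, k2]
  ring

end Fay

section Five
variable {Q : ℂ}

/-- If `κ(u) f(u)` has a limit at `1` with `f(1) = 0`, the limit is `-f'(1)`. -/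
lemma kap_mul_limit {p : ℂ} (hp : p ≠ 0) (hp1 : ‖p‖ < 1) {f R : ℂ → ℂ} {f' r : ℂ}
    (hf : HasDerivAt f f' 1) (f1 : f 1 = 0)
    (h : ∀ᶠ u in inner1, kap p u * f u = R u) (hR : Tendsto R inner1 (𝓝 r)) : r = -f' := by
  have h1 : Tendsto (fun u => (u - 1)⁻¹ * f u) inner1 (𝓝 f') := by
    have := hf.tendsto_slope.mono_left inner1_le
    refine this.congr fun u => ?_
    rw [slope_def_field, f1, sub_zero, div_eq_inv_mul]
  have h2 := ((kap_mul_one_sub_tendsto hp hp1).mono_left inner1_le).mul h1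
  have h3 : Tendsto R inner1 (𝓝 (-(1 * f'))) := by
    refine h2.neg.congr' ?_
    filter_upwards [h, inner1_ne] with u hu hne
    have : u - 1 ≠ 0 := fun h => hne (by linear_combination -h)
    rw [← hu]
    field_simp
    ring
  rw [one_mul] at h3
  exact tendsto_nhds_unique hR h3

lemma norm_pow_five_lt (hQ1 : ‖Q‖ < 1) : ‖Q ^ 5‖ < 1 := by
  rw [norm_pow]; exact pow_lt_one₀ (norm_nonneg _) hQ1 (by norm_num)

lemma ann_pow (hQ : Q ≠ 0) (hQ1 : ‖Q‖ < 1) {j : ℕ} (h0 : 0 < j) (h5 : j < 5) :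
    Ann (Q ^ 5) (Q ^ j) := by
  have := norm_pos_iff.mpr hQ
  refine ⟨?_, ?_⟩ <;> rw [norm_pow]
  · rw [norm_pow]; exact pow_lt_pow_right_of_lt_one₀ this hQ1 h5
  · exact pow_lt_one₀ (norm_nonneg _) hQ1 h0.ne'

lemma ann_one (hQ : Q ≠ 0) (hQ1 : ‖Q‖ < 1) : Ann (Q ^ 5) Q := by
  simpa using ann_pow hQ hQ1 (j := 1) (by norm_num) (by norm_num)

lemma ann_mul_inv {p x : ℂ} (hp : p ≠ 0) (hx : Ann p x) : Ann p (p * x⁻¹) := by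
  have h0 := norm_pos_iff.mpr hx.ne_zero
  refine ⟨?_, hx.norm_div⟩
  rw [norm_mul, norm_inv]
  have := norm_pos_iff.mpr hp
  have h1 : 1 < ‖x‖⁻¹ := (one_lt_inv₀ h0).mpr hx.2
  nlinarith

lemma kap_three (hQ : Q ≠ 0) (hQ1 : ‖Q‖ < 1) : kap (Q ^ 5) (Q ^ 3) = kap (Q ^ 5) (Q ^ 2) := by
  have h := ann_pow hQ hQ1 (j := 2) (by norm_num) (by norm_num)
  have hp := pow_ne_zero 5 hQ
  have hp1 := norm_pow_five_lt hQ1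
  rw [← kap_reflect hp hp1 h.ne_zero (h.mul_zpow_ne_one hp hp1)]
  congr 1; field_simp

lemma kap_four (hQ : Q ≠ 0) (hQ1 : ‖Q‖ < 1) : kap (Q ^ 5) (Q ^ 4) = kap (Q ^ 5) Q := by
  have h := ann_one hQ hQ1
  have hp := pow_ne_zero 5 hQ
  have hp1 := norm_pow_five_lt hQ1
  rw [← kap_reflect hp hp1 h.ne_zero (h.mul_zpow_ne_one hp hp1)]
  congr 1; field_simp

/-- value of `x κ'(x)/κ(x)` at `x` -/
noncomputable def lam (p x : ℂ) : ℂ := x * deriv (kap p) x / kap p x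

lemma kap_hasDerivAt_mul {p x : ℂ} (hp : p ≠ 0) (hp1 : ‖p‖ < 1) (hx : Ann p x) :
    HasDerivAt (fun u => kap p (x * u)) (lam p x * kap p x) 1 := by
  have h := (kap_differentiableAt hp hp1 (x := x * 1) (by rwa [mul_one])).hasDerivAt
  have h2 : HasDerivAt (fun u : ℂ => x * u) x 1 := by simpa using (hasDerivAt_id (1 : ℂ)).const_mul x
  have := HasDerivAt.comp (h₂ := kap p) (h := fun u : ℂ => x * u) 1 h h2
  refine this.congr_deriv ?_
  rw [mul_one, lam, div_mul_cancel₀ _ (kap_ne_zero hp hp1 hx), mul_comm]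

lemma kap_hasDerivAt_div {p x : ℂ} (hp : p ≠ 0) (hp1 : ‖p‖ < 1) (hx : Ann p x) :
    HasDerivAt (fun u => kap p (x * u⁻¹)) (-(lam p x * kap p x)) 1 := by
  have h := kap_hasDerivAt_mul hp hp1 hx
  have h2 : HasDerivAt (fun u : ℂ => u⁻¹) (-1) 1 := by
    simpa using hasDerivAt_inv (one_ne_zero : (1 : ℂ) ≠ 0)
  have h' : HasDerivAt (fun u => kap p (x * u)) (lam p x * kap p x) ((1 : ℂ)⁻¹) := by simpa using h
  have := HasDerivAt.comp (h₂ := fun u => kap p (x * u)) (h := fun u : ℂ => u⁻¹) 1 h' h2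
  exact this.congr_deriv (by ring)

lemma tendsto_mul_inner {x : ℂ} : Tendsto (fun u : ℂ => x * u) inner1 (𝓝 x) := by
  simpa using inner1_tendsto.const_mul x

lemma tendsto_div_inner {x : ℂ} : Tendsto (fun u : ℂ => x * u⁻¹) inner1 (𝓝 x) := by
  simpa using (inner1_tendsto.inv₀ one_ne_zero).const_mul x

theorem kap_cube_one (hQ : Q ≠ 0) (hQ1 : ‖Q‖ < 1) :
    kap (Q ^ 5) Q ^ 3 =
      kap (Q ^ 5) (Q ^ 2) ^ 2 * (1 + 3 * lam (Q ^ 5) Q + lam (Q ^ 5) (Q ^ 2)) := by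
  have hp := pow_ne_zero 5 hQ
  have hp1 := norm_pow_five_lt hQ1
  have A1 := ann_one hQ hQ1
  have A2 := ann_pow hQ hQ1 (j := 2) (by norm_num) (by norm_num)
  have A3 := ann_pow hQ hQ1 (j := 3) (by norm_num) (by norm_num)
  have k3 := kap_three hQ hQ1
  set p := Q ^ 5 with hpdef
  set κ1 := kap p Q with hκ1
  set κ2 := kap p (Q ^ 2) with hκ2
  have n1 : κ1 ≠ 0 := kap_ne_zero hp hp1 A1
  have n2 : κ2 ≠ 0 := kap_ne_zero hp hp1 A2
  have da := kap_hasDerivAt_mul hp hp1 A1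
  have da' := kap_hasDerivAt_div hp hp1 A1
  have db := kap_hasDerivAt_mul hp hp1 A2
  have db' := kap_hasDerivAt_div hp hp1 A2
  have du := hasDerivAt_id (1 : ℂ)
  have hf : HasDerivAt (fun u => (κ1 * kap p (Q * u⁻¹) * kap p (Q ^ 2 * u⁻¹) -
      u * κ2 * kap p (Q * u) ^ 2)) _ 1 :=
    (((da'.const_mul κ1).mul db').sub ((du.mul_const κ2).mul (da.pow 2)))
  have ca := da.continuousAt.tendsto.mono_left (inner1_le.trans nhdsWithin_le_nhds)
  have ca' := da'.continuousAt.tendsto.mono_left (inner1_le.trans nhdsWithin_le_nhds)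
  have cb := db.continuousAt.tendsto.mono_left (inner1_le.trans nhdsWithin_le_nhds)
  have cb' := db'.continuousAt.tendsto.mono_left (inner1_le.trans nhdsWithin_le_nhds)
  have hR : Tendsto (fun u => κ1 ^ 2 * (kap p (Q * u) ^ 2 * kap p (Q * u⁻¹) *
      kap p (Q ^ 2 * u⁻¹)) / (κ2 * kap p (Q ^ 2 * u))) inner1 (𝓝 _) :=
    ((((ca.pow 2).mul ca').mul cb').const_mul (κ1 ^ 2)).div (cb.const_mul κ2)
      (by simp [← hκ2, n2])
  have key := kap_mul_limit hp hp1 hf (by simp [← hκ1, ← hκ2]; ring) ?_ hR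
  · simp only [mul_one, inv_one, id, ← hκ1, ← hκ2] at key
    field_simp at key
    apply mul_left_cancel₀ n1
    linear_combination key
  filter_upwards [inner1_ann hp1, eventually_ann A1 (tendsto_mul_inner (x := Q)),
    eventually_ann A1 (tendsto_div_inner (x := Q)), eventually_ann A2 (tendsto_mul_inner (x := Q ^ 2)),
    eventually_ann A2 (tendsto_div_inner (x := Q ^ 2)),
    eventually_ann A3 (tendsto_mul_inner (x := Q ^ 3))] with u hu ha ha' hb hb' hc
  have hu0 := hu.ne_zero
  have hul := hu.mul_zpow_ne_one hp hp1
  have huil : ∀ m : ℤ, u⁻¹ * p ^ m ≠ 1 := by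
    intro m hm
    apply hul (-m)
    rw [zpow_neg]
    have : p ^ m ≠ 0 := zpow_ne_zero _ hp
    field_simp at hm ⊢
    exact hm.symm
  have fay := kron_mul_kron hp hp1 A1 A1 (by rwa [← pow_two]) hQ ha.ne_zero
    (A1.mul_zpow_ne_one hp hp1) (ha.mul_zpow_ne_one hp hp1) (y := Q) (y' := Q * u)
    (by rw [mul_inv, ← mul_assoc, mul_inv_cancel₀ hQ, one_mul]; exact huil)
  rw [mul_inv, ← mul_assoc, mul_inv_cancel₀ hQ, one_mul, mul_right_comm, mul_inv_cancel₀ hQ,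
    one_mul, ← pow_two] at fay
  have r1 := kron_mul_kap hp hp1 A1 hQ (A1.mul_zpow_ne_one hp hp1) (by rwa [← pow_two])
  have r2 := kron_mul_kap hp hp1 A1 ha.ne_zero (ha.mul_zpow_ne_one hp hp1)
    (by rwa [← mul_assoc, ← pow_two])
  have r3 := kron_mul_kap hp hp1 A2 hQ (A1.mul_zpow_ne_one hp hp1) (by rwa [← pow_succ])
  have r4 := kron_mul_kap hp hp1 A1 hu0 hul ha
  have r5 := kron_mul_kap hp hp1 A2 ha.ne_zero (ha.mul_zpow_ne_one hp hp1)
    (by rwa [← mul_assoc, ← pow_succ])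
  have r6 := kron_mul_kap hp hp1 A1 (inv_ne_zero hu0) huil ha'
  rw [kap_inv hp hu0 hul] at r6
  rw [← pow_two] at r1
  rw [← mul_assoc, ← pow_two] at r2
  rw [← pow_succ] at r3
  rw [← mul_assoc, ← pow_succ] at r5
  have rf := kap_reflect hp hp1 hb'.ne_zero (hb'.mul_zpow_ne_one hp hp1)
  rw [show p * (Q ^ 2 * u⁻¹)⁻¹ = Q ^ 3 * u by rw [hpdef]; field_simp] at rf
  norm_num at r3 r5
  rw [rf] at r5
  rw [k3] at r3
  have na := kap_ne_zero hp hp1 ha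
  have na' := kap_ne_zero hp hp1 ha'
  have nb := kap_ne_zero hp hp1 hb
  have nb' := kap_ne_zero hp hp1 hb'
  rw [← hκ1] at r1 r2 r3 r4 r6
  rw [← hκ2] at r1 r3 r5
  rw [← eq_div_iff n2] at r1 r3
  rw [← eq_div_iff nb] at r2
  rw [← eq_div_iff na] at r4
  rw [← eq_div_iff nb'] at r5
  rw [← eq_div_iff na'] at r6
  rw [r1, r2, r3, r4, r5, r6] at fay
  generalize kap p (Q * u) = a at *
  generalize kap p (Q * u⁻¹) = a' at *
  generalize kap p (Q ^ 2 * u) = b at *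
  generalize kap p (Q ^ 2 * u⁻¹) = b' at *
  field_simp at fay ⊢
  linear_combination (-1 : ℂ) * fay

theorem kap_cube_two (hQ : Q ≠ 0) (hQ1 : ‖Q‖ < 1) :
    Q * kap (Q ^ 5) (Q ^ 2) ^ 3 =
      kap (Q ^ 5) Q ^ 2 * (lam (Q ^ 5) Q - 3 * lam (Q ^ 5) (Q ^ 2)) := by
  have hp := pow_ne_zero 5 hQ
  have hp1 := norm_pow_five_lt hQ1
  have A1 := ann_one hQ hQ1
  have A2 := ann_pow hQ hQ1 (j := 2) (by norm_num) (by norm_num)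
  have A4 := ann_pow hQ hQ1 (j := 4) (by norm_num) (by norm_num)
  have k4 := kap_four hQ hQ1
  set p := Q ^ 5 with hpdef
  set κ1 := kap p Q with hκ1
  set κ2 := kap p (Q ^ 2) with hκ2
  have n1 : κ1 ≠ 0 := kap_ne_zero hp hp1 A1
  have n2 : κ2 ≠ 0 := kap_ne_zero hp hp1 A2
  have da := kap_hasDerivAt_mul hp hp1 A1
  have da' := kap_hasDerivAt_div hp hp1 A1
  have db := kap_hasDerivAt_mul hp hp1 A2
  have db' := kap_hasDerivAt_div hp hp1 A2
  have hf : HasDerivAt (fun u => (κ1 * kap p (Q ^ 2 * u) ^ 2 -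
      κ2 * kap p (Q * u) * kap p (Q ^ 2 * u⁻¹))) _ 1 :=
    (((db.pow 2).const_mul κ1).sub ((da.const_mul κ2).mul db'))
  have ca := da.continuousAt.tendsto.mono_left (inner1_le.trans nhdsWithin_le_nhds)
  have ca' := da'.continuousAt.tendsto.mono_left (inner1_le.trans nhdsWithin_le_nhds)
  have cb := db.continuousAt.tendsto.mono_left (inner1_le.trans nhdsWithin_le_nhds)
  have cb' := db'.continuousAt.tendsto.mono_left (inner1_le.trans nhdsWithin_le_nhds)
  have hR : Tendsto (fun u => Q * κ2 ^ 2 * (kap p (Q ^ 2 * u) ^ 2 * kap p (Q * u) *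
      kap p (Q ^ 2 * u⁻¹)) / (κ1 * kap p (Q * u⁻¹))) inner1 (𝓝 _) :=
    ((((cb.pow 2).mul ca).mul cb').const_mul (Q * κ2 ^ 2)).div (ca'.const_mul κ1)
      (by simp [← hκ1, n1])
  have key := kap_mul_limit hp hp1 hf (by simp [← hκ1, ← hκ2]; ring) ?_ hR
  · simp only [mul_one, inv_one, ← hκ1, ← hκ2] at key
    field_simp at key
    apply mul_left_cancel₀ n2
    linear_combination key
  filter_upwards [inner1_ann hp1, eventually_ann A1 (tendsto_mul_inner (x := Q)),
    eventually_ann A1 (tendsto_div_inner (x := Q)), eventually_ann A2 (tendsto_mul_inner (x := Q ^ 2)),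
    eventually_ann A2 (tendsto_div_inner (x := Q ^ 2)),
    eventually_ann A4 (tendsto_mul_inner (x := Q ^ 4))] with u hu ha ha' hb hb' hc
  have hu0 := hu.ne_zero
  have hul := hu.mul_zpow_ne_one hp hp1
  have huil : ∀ m : ℤ, u⁻¹ * p ^ m ≠ 1 := by
    intro m hm
    apply hul (-m)
    rw [zpow_neg]
    have : p ^ m ≠ 0 := zpow_ne_zero _ hp
    field_simp at hm ⊢
    exact hm.symm
  have hQ2 := A2.ne_zero
  have fay := kron_mul_kron hp hp1 A2 A2 (by rwa [← pow_add]) hQ2 hb.ne_zero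
    (A2.mul_zpow_ne_one hp hp1) (hb.mul_zpow_ne_one hp hp1) (y := Q ^ 2) (y' := Q ^ 2 * u)
    (by rw [mul_inv, ← mul_assoc, mul_inv_cancel₀ hQ2, one_mul]; exact huil)
  rw [mul_inv, ← mul_assoc, mul_inv_cancel₀ hQ2, one_mul, mul_right_comm, mul_inv_cancel₀ hQ2,
    one_mul, ← pow_add] at fay
  norm_num at fay
  have r1 := kron_mul_kap hp hp1 A2 hQ2 (A2.mul_zpow_ne_one hp hp1) (by rwa [← pow_add])
  have r2 := kron_mul_kap hp hp1 A2 hb.ne_zero (hb.mul_zpow_ne_one hp hp1)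
    (by rwa [← mul_assoc, ← pow_add])
  have r3 := kron_mul_kap_nome hp hp1 (z := Q) A4 hQ2 (A2.mul_zpow_ne_one hp hp1) A1
    (by rw [hpdef]; ring)
  have r4 := kron_mul_kap hp hp1 A2 hu0 hul hb
  have r5 := kron_mul_kap_nome hp hp1 (z := Q * u) A4 hb.ne_zero (hb.mul_zpow_ne_one hp hp1)
    ha (by rw [hpdef]; ring)
  have r6 := kron_mul_kap hp hp1 A2 (inv_ne_zero hu0) huil hb'
  rw [kap_inv hp hu0 hul] at r6
  rw [← pow_add] at r1
  rw [← mul_assoc, ← pow_add] at r2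
  norm_num at r1 r2
  have rf := kap_reflect hp hp1 ha'.ne_zero (ha'.mul_zpow_ne_one hp hp1)
  rw [show p * (Q * u⁻¹)⁻¹ = Q ^ 4 * u by rw [hpdef]; field_simp] at rf
  rw [rf] at r2
  have na := kap_ne_zero hp hp1 ha
  have na' := kap_ne_zero hp hp1 ha'
  have nb := kap_ne_zero hp hp1 hb
  have nb' := kap_ne_zero hp hp1 hb'
  rw [k4] at r1 r3 r5
  rw [← hκ1] at r3
  rw [← hκ2] at r1 r2 r3 r4 r6
  rw [← eq_div_iff n1] at r1
  rw [← eq_div_iff (mul_ne_zero (neg_ne_zero.mpr hQ) n1)] at r3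
  rw [← eq_div_iff na'] at r2
  rw [← eq_div_iff nb] at r4
  rw [← eq_div_iff (mul_ne_zero (neg_ne_zero.mpr ha.ne_zero) na)] at r5
  rw [← eq_div_iff nb'] at r6
  rw [r1, r2, r3, r4, r5, r6] at fay
  generalize kap p (Q * u) = a at *
  generalize kap p (Q * u⁻¹) = a' at *
  generalize kap p (Q ^ 2 * u) = b at *
  generalize kap p (Q ^ 2 * u⁻¹) = b' at *
  field_simp at fay ⊢
  linear_combination (-1 : ℂ) * fay

end Five

lemma tsum_int_five {f : ℤ → ℂ} (hf : Summable f) (s : ℤ) :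
    ∑' m, f m = ∑' n, f (5 * n + s) + ∑' n, f (5 * n + (s + 1)) + ∑' n, f (5 * n + (s + 2)) +
      ∑' n, f (5 * n + (s + 3)) + ∑' n, f (5 * n + (s + 4)) := by
  let e : Fin 5 × ℤ ≃ ℤ :=
    (Equiv.prodComm _ _).trans ((Int.divModEquiv 5).symm.trans (Equiv.addRight s))
  have he : ∀ (r : Fin 5) (n : ℤ), e (r, n) = 5 * n + r.val + s := by
    intro r n
    simp [e, Int.divModEquiv, mul_comm]
  have h := ((e.summable_iff).mpr hf).tsum_prod
  simp only [Function.comp_def] at h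
  rw [← e.tsum_eq f, h, tsum_fintype, Fin.sum_univ_five]
  simp only [he]
  congr 1; congr 1; congr 1; congr 1
  all_goals (congr 1; ext n; congr 1; simp; try ring)

section Dissection
variable {q Q : ℂ}

lemma theta_one {p : ℂ} (hp : p ≠ 0) : theta p 1 = 0 := by
  rw [← tsum_gv hp]; simp [theta]

lemma theta_self {p : ℂ} (hp : p ≠ 0) : theta p p = 0 := by
  have := theta_mul_nome hp (one_ne_zero (α := ℂ))
  rwa [one_mul, theta_one hp, mul_zero] at this

lemma theta_reflect {p x : ℂ} (hp : p ≠ 0) (hp1 : ‖p‖ < 1) (hx : Ann p x) :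
    theta p (p * x⁻¹) = theta p x := by
  rw [theta_eq_poch hp hp1 hx.1, theta_eq_poch hp hp1 (ann_mul_inv hp hx).1]
  rw [mul_inv, inv_inv, ← mul_assoc, mul_inv_cancel₀ hp, one_mul]
  ring

lemma gv_five_mul_add (hq : q ≠ 0) (n r : ℤ) :
    gv q (5 * n + r) = gv q r * (gv (q ^ 25) n * ((q ^ 5) ^ (2 - r)) ^ (-n)) := by
  rw [gv_add hq]
  have h : gv q (5 * n) = gv (q ^ 25) n * ((q ^ 5) ^ (2 : ℤ)) ^ (-n) := by
    unfold gv
    have e1 : (-1 : ℂ) ^ (5 * n) = (-1) ^ n := by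
      rw [zpow_mul]; norm_num
    rw [e1, ← zpow_natCast q 25, ← zpow_natCast q 5, ← zpow_mul, ← zpow_mul, ← zpow_mul, mul_assoc
      ((-1 : ℂ) ^ n), ← zpow_add₀ hq]
    congr 2
    obtain ⟨c, hc⟩ : (2 : ℤ) ∣ n * (n + 1) := (Int.even_mul_succ_self n).two_dvd
    have e2 : 5 * n * (5 * n + 1) = 2 * (25 * c - 10 * n) := by linear_combination 25 * hc
    rw [e2, hc, Int.mul_ediv_cancel_left _ two_ne_zero, Int.mul_ediv_cancel_left _ two_ne_zero]
    push_cast; ring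
  rw [h, ← zpow_natCast q 5]
  simp only [← zpow_mul]
  rw [show q ^ (((5 : ℕ) : ℤ) * (2 - r) * -n) = q ^ (((5 : ℕ) : ℤ) * 2 * -n) * q ^ (5 * n * r) by
    rw [← zpow_add₀ hq]; congr 1; push_cast; ring]
  ring

lemma theta_five (hq : q ≠ 0) (hq1 : ‖q‖ < 1) {x : ℂ} (hx : x ^ 5 = 1) :
    theta q x = theta (q ^ 25) ((q ^ 5) ^ 2) * (1 - x) +
      q * theta (q ^ 25) (q ^ 5) * (x ^ 2 - x ^ 4) := by
  have hx0 : x ≠ 0 := by rintro rfl; norm_num at hx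
  have hQ : q ^ 5 ≠ 0 := pow_ne_zero _ hq
  have hQ1 : ‖q ^ 5‖ < 1 := norm_pow_five_lt hq1
  have hp : q ^ 25 ≠ 0 := pow_ne_zero _ hq
  have e25 : q ^ 25 = (q ^ 5) ^ 5 := by ring
  have hp1 : ‖q ^ 25‖ < 1 := by rw [e25]; exact norm_pow_five_lt hQ1
  have piece : ∀ r : ℤ, ∑' n : ℤ, gv q (5 * n + r) * x ^ (-(5 * n + r)) =
      gv q r * x ^ (-r) * theta (q ^ 25) ((q ^ 5) ^ (2 - r)) := by
    intro r
    unfold theta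
    rw [← tsum_mul_left]
    congr 1; ext n
    rw [gv_five_mul_add hq]
    have : x ^ (-(5 * n + r)) = x ^ (-r) := by
      rw [neg_add, zpow_add₀ hx0, neg_mul_eq_mul_neg, zpow_mul]
      norm_cast
      rw [hx, one_zpow, one_mul]
    rw [this]; ring
  have H := tsum_int_five (theta_summable hq hq1 hx0).of_norm (-2)
  rw [show (-2 + 1 : ℤ) = -1 by norm_num, show (-2 + 2 : ℤ) = 0 by norm_num,
    show (-2 + 3 : ℤ) = 1 by norm_num, show (-2 + 4 : ℤ) = 2 by norm_num, piece, piece, piece, piece,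
    piece] at H
  have g1 : gv q (-1) = -1 := by simp [gv]
  have g2 : gv q (-2) = q := by simp [gv]
  have g3 : gv q 1 = -q := gv_one
  have A1 := ann_one hQ hQ1
  have A2 := ann_pow hQ hQ1 (j := 2) (by norm_num) (by norm_num)
  have t4 : theta (q ^ 25) ((q ^ 5) ^ (4 : ℤ)) = theta (q ^ 25) (q ^ 5) := by
    rw [e25, ← theta_reflect (pow_ne_zero 5 hQ) (norm_pow_five_lt hQ1) A1]
    congr 1; norm_cast; field_simp
  have t3 : theta (q ^ 25) ((q ^ 5) ^ (3 : ℤ)) = theta (q ^ 25) ((q ^ 5) ^ 2) := by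
    rw [e25, ← theta_reflect (pow_ne_zero 5 hQ) (norm_pow_five_lt hQ1) A2]
    congr 1; norm_cast; field_simp
  have t0 : theta (q ^ 25) ((q ^ 5) ^ (0 : ℤ)) = 0 := by rw [zpow_zero, theta_one hp]
  rw [theta, H, g1, g2, g3, gv_zero, show (2 - -2 : ℤ) = 4 by norm_num,
    show (2 - -1 : ℤ) = 3 by norm_num, show (2 - 2 : ℤ) = 0 by norm_num, t0, t3, t4, sub_zero,
    show (2 - 1 : ℤ) = 1 by norm_num, zpow_one, neg_neg, neg_neg, neg_zero, zpow_zero, zpow_one,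
    zpow_neg_one]
  have xi : x⁻¹ = x ^ 4 := by
    apply inv_eq_of_mul_eq_one_right; rw [← hx]; ring
  rw [xi]
  simp only [zpow_ofNat]
  ring

lemma prod_roots {x : ℂ} (hx : 1 + x + x ^ 2 + x ^ 3 + x ^ 4 = 0) (y : ℂ) :
    (1 - y) * (1 - x * y) * (1 - x ^ 4 * y) * (1 - x ^ 2 * y) * (1 - x ^ 3 * y) = 1 - y ^ 5 := by
  have h5 : x ^ 5 = 1 := by linear_combination (x - 1) * hx
  have e1 : (1 - x * y) * (1 - x ^ 4 * y) = 1 - (x + x ^ 4) * y + y ^ 2 := by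
    linear_combination y ^ 2 * h5
  have e2 : (1 - x ^ 2 * y) * (1 - x ^ 3 * y) = 1 - (x ^ 2 + x ^ 3) * y + y ^ 2 := by
    linear_combination y ^ 2 * h5
  have e3 : (x + x ^ 4) * (x ^ 2 + x ^ 3) = -1 := by
    linear_combination hx + (x + x ^ 2) * h5
  calc _ = (1 - y) * ((1 - x * y) * (1 - x ^ 4 * y)) * ((1 - x ^ 2 * y) * (1 - x ^ 3 * y)) := by ring
    _ = _ := by
      rw [e1, e2]
      linear_combination (1 - y) * y ^ 2 * e3 - (1 - y) * (y + y ^ 3) * hx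

lemma poch_roots (hq1 : ‖q‖ < 1) {x : ℂ} (hx : 1 + x + x ^ 2 + x ^ 3 + x ^ 4 = 0) :
    poch q q * poch (x * q) q * poch (x ^ 4 * q) q * poch (x ^ 2 * q) q * poch (x ^ 3 * q) q =
      poch (q ^ 5) (q ^ 5) := by
  have h := ((((poch_hasProd hq1 q).mul (poch_hasProd hq1 (x * q))).mul
    (poch_hasProd hq1 (x ^ 4 * q))).mul (poch_hasProd hq1 (x ^ 2 * q))).mul
    (poch_hasProd hq1 (x ^ 3 * q))
  refine h.unique ((poch_hasProd (norm_pow_five_lt hq1) (q ^ 5)).congr_fun ?_)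
  intro n
  have := prod_roots hx (q * q ^ n)
  simp only [mul_assoc] at this ⊢
  rw [this]; ring

lemma poch_five (hQ1 : ‖Q‖ < 1) :
    poch Q Q = poch Q (Q ^ 5) * poch (Q ^ 2) (Q ^ 5) * poch (Q ^ 3) (Q ^ 5) *
      poch (Q ^ 4) (Q ^ 5) * poch (Q ^ 5) (Q ^ 5) := by
  have hp1 := norm_pow_five_lt hQ1
  have h := ((((poch_hasProd hp1 Q).mul (poch_hasProd hp1 (Q ^ 2))).mul
    (poch_hasProd hp1 (Q ^ 3))).mul (poch_hasProd hp1 (Q ^ 4))).mul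
    (poch_hasProd hp1 (Q ^ 5))
  have h1 := h.tendsto_prod_nat
  have h2 := (poch_hasProd hQ1 Q).tendsto_prod_nat.comp
    (tendsto_id.const_mul_atTop' (by norm_num : 0 < 5))
  refine tendsto_nhds_unique h2 (h1.congr fun n => ?_)
  simp only [Function.comp_apply, id]
  induction n with
  | zero => simp
  | succ n ih =>
    rw [Finset.prod_range_succ, ih, mul_add, mul_one]
    simp only [Finset.prod_range_succ]
    ring

lemma theta_mul_theta (hQ : Q ≠ 0) (hQ1 : ‖Q‖ < 1) :
    theta (Q ^ 5) Q * theta (Q ^ 5) (Q ^ 2) = poch (Q ^ 5) (Q ^ 5) * poch Q Q := by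
  have hp := pow_ne_zero 5 hQ
  have hp1 := norm_pow_five_lt hQ1
  have A1 := ann_one hQ hQ1
  have A2 := ann_pow hQ hQ1 (j := 2) (by norm_num) (by norm_num)
  rw [theta_eq_poch hp hp1 A1.1, theta_eq_poch hp hp1 A2.1, poch_five hQ1,
    show Q ^ 5 * Q⁻¹ = Q ^ 4 by field_simp, show Q ^ 5 * (Q ^ 2)⁻¹ = Q ^ 3 by field_simp]
  ring

lemma poch_pair (hq : q ≠ 0) (hq1 : ‖q‖ < 1) {x : ℂ} (hx : 1 + x + x ^ 2 + x ^ 3 + x ^ 4 = 0) :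
    poch q q * poch (x * q) q * poch (x ^ 4 * q) q =
      theta (q ^ 25) ((q ^ 5) ^ 2) + q * theta (q ^ 25) (q ^ 5) * (x ^ 2 + x ^ 3) := by
  have h5 : x ^ 5 = 1 := by linear_combination (x - 1) * hx
  have hx1 : 1 - x ≠ 0 := by
    intro h
    have : x = 1 := by linear_combination -h
    rw [this] at hx; norm_num at hx
  have hn : ‖x‖ = 1 := by
    apply (pow_eq_one_iff_of_nonneg (norm_nonneg _) (by norm_num : 5 ≠ 0)).mp
    rw [← norm_pow, h5, norm_one]
  have h := theta_five hq hq1 h5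
  have xi : x⁻¹ = x ^ 4 := by
    apply inv_eq_of_mul_eq_one_right; rw [← h5]; ring
  rw [theta_eq_poch hq hq1 (by rwa [hn]), poch_step hq hq1 x, xi, mul_comm q] at h
  apply mul_left_cancel₀ hx1
  linear_combination h

theorem euler_five (hq : q ≠ 0) (hq1 : ‖q‖ < 1) :
    poch q q = poch (q ^ 25) (q ^ 25) * (kap (q ^ 25) (q ^ 5) / kap (q ^ 25) ((q ^ 5) ^ 2) - q -
      q ^ 2 * (kap (q ^ 25) ((q ^ 5) ^ 2) / kap (q ^ 25) (q ^ 5))) := by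
  obtain ⟨x, hx⟩ : ∃ x : ℂ, 1 + x + x ^ 2 + x ^ 3 + x ^ 4 = 0 := by
    have h := (Complex.isPrimitiveRoot_exp 5 (by norm_num)).geom_sum_eq_zero (by norm_num)
    simp only [Finset.sum_range_succ, Finset.sum_range_zero] at h
    exact ⟨_, by linear_combination h⟩
  have h5 : x ^ 5 = 1 := by linear_combination (x - 1) * hx
  have hx2 : 1 + x ^ 2 + (x ^ 2) ^ 2 + (x ^ 2) ^ 3 + (x ^ 2) ^ 4 = 0 := by
    linear_combination hx + (x + x ^ 3) * h5
  have hQ : q ^ 5 ≠ 0 := pow_ne_zero _ hq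
  have hQ1 : ‖q ^ 5‖ < 1 := norm_pow_five_lt hq1
  have r := poch_roots hq1 hx
  have r1 := poch_pair hq hq1 hx
  have r2 := poch_pair hq hq1 hx2
  have x8 : (x ^ 2) ^ 4 = x ^ 3 := by linear_combination x ^ 3 * h5
  rw [x8] at r2
  have A1 := ann_one hQ hQ1
  have A2 := ann_pow hQ hQ1 (j := 2) (by norm_num) (by norm_num)
  have tt := theta_mul_theta hQ hQ1
  have e25 : q ^ 25 = (q ^ 5) ^ 5 := by ring
  rw [e25] at r1 r2 ⊢
  generalize q ^ 5 = Q at *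
  have hp := pow_ne_zero 5 hQ
  have hp1 := norm_pow_five_lt hQ1
  have c1 := theta_mul_kap hp hp1 A1
  have c2 := theta_mul_kap hp hp1 A2
  have n1 := kap_ne_zero hp hp1 A1
  have n2 := kap_ne_zero hp hp1 A2
  have t1 := theta_ne_zero hp hp1 A1
  have t2 := theta_ne_zero hp hp1 A2
  have nE := poch_self_ne_zero hQ1
  have nE5 := poch_self_ne_zero hp1
  generalize kap (Q ^ 5) Q = κ1 at *
  generalize kap (Q ^ 5) (Q ^ 2) = κ2 at *
  generalize theta (Q ^ 5) Q = T1 at *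
  generalize theta (Q ^ 5) (Q ^ 2) = T2 at *
  generalize poch (Q ^ 5) (Q ^ 5) = E5 at *
  generalize poch Q Q = E at *
  generalize poch q q = e at *
  have main : e * E = T2 ^ 2 - q * T1 * T2 - q ^ 2 * T1 ^ 2 := by
    have := congrArg₂ (· * ·) r1 r2
    have l : e * E = e * poch (x * q) q * poch (x ^ 4 * q) q *
        (e * poch (x ^ 2 * q) q * poch (x ^ 3 * q) q) := by rw [← r]; ring
    rw [l, this]
    linear_combination (q * T1 * T2 + q ^ 2 * T1 ^ 2) * hx + (q * T1 * T2 * x + q ^ 2 * T1 ^ 2 * (x + x ^ 2 + x ^ 3 + x ^ 4)) * h5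
  have q1 : κ1 / κ2 = T2 / T1 := by
    rw [div_eq_div_iff n2 t1]; linear_combination c1 - c2
  have q2 : κ2 / κ1 = T1 / T2 := by
    rw [div_eq_div_iff n1 t2]; linear_combination c2 - c1
  rw [q1, q2]
  apply mul_right_cancel₀ (mul_ne_zero t1 t2)
  rw [show e * (T1 * T2) = E5 * (e * E) by rw [tt]; ring, main]
  field_simp

end Dissection

section Lambert
variable {q : ℂ}

lemma kron_five (hq : q ≠ 0) (hq1 : ‖q‖ < 1) {r : ℕ} (h0 : 0 < r) (h5 : r < 5) :
    kron (q ^ 5) (q ^ r) 1 = kron ((q ^ 5) ^ 5) ((q ^ 5) ^ r) 1 +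
      q ^ r * kron ((q ^ 5) ^ 5) ((q ^ 5) ^ r) (q ^ 5) +
      q ^ (2 * r) * kron ((q ^ 5) ^ 5) ((q ^ 5) ^ r) ((q ^ 5) ^ 2) +
      q ^ (3 * r) * kron ((q ^ 5) ^ 5) ((q ^ 5) ^ r) ((q ^ 5) ^ 3) +
      q ^ (4 * r) * kron ((q ^ 5) ^ 5) ((q ^ 5) ^ r) ((q ^ 5) ^ 4) := by
  have A := ann_pow hq hq1 h0 h5
  have hs := summable_norm_kron (pow_ne_zero 5 hq) (norm_pow_five_lt hq1) A.1 A.2 one_ne_zero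
  have H := tsum_int_five hs.of_norm 0
  have piece : ∀ a : ℕ, ∑' n : ℤ, (q ^ r) ^ (5 * n + (a : ℤ)) *
      (1 - 1 * (q ^ 5) ^ (5 * n + (a : ℤ)))⁻¹ =
      q ^ (a * r) * kron ((q ^ 5) ^ 5) ((q ^ 5) ^ r) ((q ^ 5) ^ a) := by
    intro a
    unfold kron
    rw [← tsum_mul_left]
    congr 1; ext n
    rw [← mul_assoc]
    congr 1
    · simp only [← zpow_natCast, ← zpow_mul]
      rw [← zpow_add₀ hq]; congr 1; push_cast; ring
    · congr 2
      simp only [← zpow_natCast, ← zpow_mul]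
      rw [one_mul, ← zpow_add₀ hq]; congr 1; push_cast; ring
  have p0 := piece 0
  have p1 := piece 1
  have p2 := piece 2
  have p3 := piece 3
  have p4 := piece 4
  simp only [zero_mul, pow_zero, one_mul, pow_one, Nat.cast_zero, Nat.cast_one, Nat.cast_ofNat]
    at p0 p1 p2 p3 p4
  rw [kron, ← p0, ← p1, ← p2, ← p3, ← p4]
  simpa using H

lemma kron_five_one (hq : q ≠ 0) (hq1 : ‖q‖ < 1) :
    kron (q ^ 5) q 1 = kron ((q ^ 5) ^ 5) (q ^ 5) 1 +
      q * (kap ((q ^ 5) ^ 5) (q ^ 5) ^ 2 / kap ((q ^ 5) ^ 5) ((q ^ 5) ^ 2)) +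
      q ^ 2 * kap ((q ^ 5) ^ 5) (q ^ 5) + q ^ 3 * kap ((q ^ 5) ^ 5) ((q ^ 5) ^ 2) := by
  have h := kron_five hq hq1 (r := 1) (by norm_num) (by norm_num)
  simp only [pow_one, mul_one] at h
  rw [h]
  have hQ : q ^ 5 ≠ 0 := pow_ne_zero _ hq
  have hQ1 : ‖q ^ 5‖ < 1 := norm_pow_five_lt hq1
  generalize q ^ 5 = Q at *
  have hp := pow_ne_zero 5 hQ
  have hp1 := norm_pow_five_lt hQ1
  have A1 := ann_one hQ hQ1
  have A2 := ann_pow hQ hQ1 (j := 2) (by norm_num) (by norm_num)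
  have A3 := ann_pow hQ hQ1 (j := 3) (by norm_num) (by norm_num)
  have A4 := ann_pow hQ hQ1 (j := 4) (by norm_num) (by norm_num)
  have n1 := kap_ne_zero hp hp1 A1
  have n2 := kap_ne_zero hp hp1 A2
  have k1 := kron_mul_kap hp hp1 A1 hQ (A1.mul_zpow_ne_one hp hp1) (by rwa [← pow_two])
  have k2 := kron_mul_kap hp hp1 A1 A2.ne_zero (A2.mul_zpow_ne_one hp hp1) (by rwa [← pow_succ'])
  have k3 := kron_mul_kap hp hp1 A1 A3.ne_zero (A3.mul_zpow_ne_one hp hp1) (by rwa [← pow_succ'])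
  have k4 := theta_mul_kron hp hp1 A1.1 A1.2 A4.ne_zero (A4.mul_zpow_ne_one hp hp1)
  rw [← pow_two] at k1
  rw [← pow_succ', kap_three hQ hQ1] at k2
  rw [← pow_succ', kap_three hQ hQ1, kap_four hQ hQ1] at k3
  rw [← pow_succ', theta_self hp, mul_zero] at k4
  have k4' := (mul_eq_zero.mp k4).resolve_left (theta_ne_zero hp hp1 A1)
  rw [← eq_div_iff n2] at k1
  have k2' := mul_right_cancel₀ n2 k2
  rw [mul_comm (kap _ _)] at k3
  have k3' := mul_right_cancel₀ n1 k3
  rw [k1, k2', k3', k4']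
  ring

lemma kron_five_two (hq : q ≠ 0) (hq1 : ‖q‖ < 1) :
    kron (q ^ 5) (q ^ 2) 1 = kron ((q ^ 5) ^ 5) ((q ^ 5) ^ 2) 1 +
      q ^ 2 * kap ((q ^ 5) ^ 5) (q ^ 5) +
      q ^ 4 * (kap ((q ^ 5) ^ 5) ((q ^ 5) ^ 2) ^ 2 / kap ((q ^ 5) ^ 5) (q ^ 5)) -
      q ^ 3 * kap ((q ^ 5) ^ 5) ((q ^ 5) ^ 2) := by
  have h := kron_five hq hq1 (r := 2) (by norm_num) (by norm_num)
  rw [h, show q ^ (4 * 2) = q ^ 5 * q ^ 3 by ring]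
  have hQ : q ^ 5 ≠ 0 := pow_ne_zero _ hq
  have hQ1 : ‖q ^ 5‖ < 1 := norm_pow_five_lt hq1
  generalize q ^ 5 = Q at *
  have hp := pow_ne_zero 5 hQ
  have hp1 := norm_pow_five_lt hQ1
  have A1 := ann_one hQ hQ1
  have A2 := ann_pow hQ hQ1 (j := 2) (by norm_num) (by norm_num)
  have A3 := ann_pow hQ hQ1 (j := 3) (by norm_num) (by norm_num)
  have A4 := ann_pow hQ hQ1 (j := 4) (by norm_num) (by norm_num)
  have n1 := kap_ne_zero hp hp1 A1
  have n2 := kap_ne_zero hp hp1 A2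
  have k1 := kron_mul_kap hp hp1 A2 hQ (A1.mul_zpow_ne_one hp hp1) (by rwa [← pow_succ])
  have k2 := kron_mul_kap hp hp1 A2 A2.ne_zero (A2.mul_zpow_ne_one hp hp1) (by rwa [← pow_add])
  have k3 := theta_mul_kron hp hp1 A2.1 A2.2 A3.ne_zero (A3.mul_zpow_ne_one hp hp1)
  have k4 := kron_mul_kap_nome hp hp1 (z := Q) A2 A4.ne_zero (A4.mul_zpow_ne_one hp hp1) A1
    (by ring)
  rw [← pow_succ, kap_three hQ hQ1, mul_comm (kap _ _)] at k1
  rw [← pow_add, kap_four hQ hQ1, ← eq_div_iff n1] at k2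
  rw [← pow_add, theta_self hp, mul_zero] at k3
  have k3' := (mul_eq_zero.mp k3).resolve_left (theta_ne_zero hp hp1 A2)
  rw [kap_four hQ hQ1, ← eq_div_iff (mul_ne_zero (neg_ne_zero.mpr hQ) n1)] at k4
  have k1' := mul_right_cancel₀ n2 k1
  rw [k1', k2, k3', k4]
  field_simp
  ring

/-- the Lambert series attached to `ζ` -/
noncomputable def lambert (z q : ℂ) : ℂ :=
  ∑' n : ℕ, (z * q ^ (n + 1) * (1 - z * q ^ (n + 1))⁻¹ -
    z⁻¹ * q ^ (n + 1) * (1 - z⁻¹ * q ^ (n + 1))⁻¹)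

lemma tsum_kron_one (hq : q ≠ 0) (hq1 : ‖q‖ < 1) {r : ℕ} (h0 : 0 < r) (h5 : r < 5) :
    HasSum (fun n : ℕ => ((q ^ (n + 1)) ^ r - (q ^ (n + 1)) ^ (5 - r)) *
      (1 - (q ^ (n + 1)) ^ 5)⁻¹) (kron (q ^ 5) (q ^ r) 1) := by
  have A := ann_pow hq hq1 h0 h5
  have hs := summable_norm_kron (pow_ne_zero 5 hq) (norm_pow_five_lt hq1) A.1 A.2 one_ne_zero
  have h := hs.of_norm.hasSum
  have s1 : Summable fun n : ℕ => (q ^ r) ^ ((n : ℤ) + 1) * (1 - 1 * (q ^ 5) ^ ((n : ℤ) + 1))⁻¹ :=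
    hs.of_norm.comp_injective (i := fun n : ℕ => (n : ℤ) + 1) (fun a b h => by simpa using h)
  have s2 : Summable fun n : ℕ => (q ^ r) ^ (-((n : ℤ) + 1)) *
      (1 - 1 * (q ^ 5) ^ (-((n : ℤ) + 1)))⁻¹ :=
    hs.of_norm.comp_injective (i := fun n : ℕ => -((n : ℤ) + 1)) (fun a b h => by simpa using h)
  have e := (s1.hasSum.add s2.hasSum)
  have e2 := (HasSum.of_add_one_of_neg_add_one
    (f := fun m : ℤ => (q ^ r) ^ m * (1 - 1 * (q ^ 5) ^ m)⁻¹) s1.hasSum s2.hasSum)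
  have e3 := h.unique e2
  rw [kron, e3]
  simp only [zpow_zero, one_mul, sub_self, inv_zero, mul_zero, add_zero]
  simp only [one_mul] at e
  refine e.congr_fun fun n => ?_
  have hx0 : q ^ (n + 1) ≠ 0 := pow_ne_zero _ hq
  have hn : ‖(q ^ (n + 1)) ^ 5‖ < 1 := by
    rw [← pow_mul, norm_pow]; exact pow_lt_one₀ (norm_nonneg _) hq1 (by simp)
  have hx1 : 1 - (q ^ (n + 1)) ^ 5 ≠ 0 := by
    intro h
    have : (q ^ (n + 1)) ^ 5 = 1 := by linear_combination -h
    rw [this] at hn; simp at hn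
  have c1 : (q ^ r) ^ ((n : ℤ) + 1) = (q ^ (n + 1)) ^ r := by
    norm_cast; rw [← pow_mul, ← pow_mul, mul_comm]
  have c2 : (q ^ 5) ^ ((n : ℤ) + 1) = (q ^ (n + 1)) ^ 5 := by
    norm_cast; rw [← pow_mul, ← pow_mul, mul_comm]
  rw [zpow_neg, zpow_neg, c1, c2]
  generalize q ^ (n + 1) = x at *
  have hx2 : x ^ 5 - 1 ≠ 0 := fun h => hx1 (by linear_combination -h)
  have e4 : x ^ 5 = x ^ r * x ^ (5 - r) := by rw [← pow_add]; congr 1; omega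
  have e5 : (1 - (x ^ 5)⁻¹)⁻¹ = - (x ^ 5) * (1 - x ^ 5)⁻¹ := by
    rw [show 1 - (x ^ 5)⁻¹ = -(x ^ 5)⁻¹ * (1 - x ^ 5) by field_simp; ring, mul_inv, inv_neg, inv_inv]
  have e6 : (x ^ r)⁻¹ * x ^ 5 = x ^ (5 - r) := by
    rw [e4, ← mul_assoc, inv_mul_cancel₀ (pow_ne_zero _ hx0), one_mul]
  rw [e5]
  linear_combination (1 - x ^ 5)⁻¹ * e6

lemma lambert_eq (hq : q ≠ 0) (hq1 : ‖q‖ < 1) {z : ℂ} (hz : z ^ 5 = 1) :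
    lambert z q = (z - z ^ 4) * kron (q ^ 5) q 1 + (z ^ 2 - z ^ 3) * kron (q ^ 5) (q ^ 2) 1 := by
  have h1 := tsum_kron_one hq hq1 (r := 1) (by norm_num) (by norm_num)
  have h2 := tsum_kron_one hq hq1 (r := 2) (by norm_num) (by norm_num)
  rw [pow_one] at h1
  have h := (h1.mul_left (z - z ^ 4)).add (h2.mul_left (z ^ 2 - z ^ 3))
  rw [← h.tsum_eq, lambert]
  congr 1; ext n
  have zi : z⁻¹ = z ^ 4 := by
    apply inv_eq_of_mul_eq_one_right; rw [← hz]; ring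
  have nz : ‖z‖ = 1 := by
    apply (pow_eq_one_iff_of_nonneg (norm_nonneg _) (by norm_num : 5 ≠ 0)).mp
    rw [← norm_pow, hz, norm_one]
  have hn : ‖q ^ (n + 1)‖ < 1 := by
    rw [norm_pow]; exact pow_lt_one₀ (norm_nonneg _) hq1 (by simp)
  have ne1 : ∀ w : ℂ, ‖w‖ < 1 → 1 - w ≠ 0 := by
    intro w hw h
    have : w = 1 := by linear_combination -h
    rw [this] at hw; simp at hw
  rw [zi]
  generalize q ^ (n + 1) = x at *
  have g1 := ne1 (z * x) (by rw [norm_mul, nz, one_mul]; exact hn)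
  have g2 := ne1 (z ^ 4 * x) (by rw [norm_mul, norm_pow, nz, one_pow, one_mul]; exact hn)
  have g3 := ne1 (x ^ 5) (by rw [norm_pow]; exact pow_lt_one₀ (norm_nonneg _) hn (by simp))
  have r : ∀ w : ℂ, w ^ 5 = 1 → 1 - w * x ≠ 0 → w * x * (1 - w * x)⁻¹ =
      (w * x + w ^ 2 * x ^ 2 + w ^ 3 * x ^ 3 + w ^ 4 * x ^ 4 + x ^ 5) * (1 - x ^ 5)⁻¹ := by
    intro w hw h
    rw [← div_eq_mul_inv, ← div_eq_mul_inv, div_eq_div_iff h g3]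
    linear_combination (x ^ 5) * hw
  have z20 : (z ^ 4) ^ 5 = 1 := by rw [← pow_mul, mul_comm, pow_mul, hz, one_pow]
  rw [r z hz g1, r _ z20 g2]
  linear_combination (-(z ^ 3 * x ^ 2 * (1 - x ^ 5)⁻¹) * 1 -
    z ^ 2 * x ^ 3 * (1 + z ^ 5) * (1 - x ^ 5)⁻¹ - z * x ^ 4 * (1 + z ^ 5 + z ^ 10) * (1 - x ^ 5)⁻¹) * hz

/-- the component of the crank generating function in degrees `≡ 4 (mod 5)` -/
theorem crank_component {Q : ℂ} (hQ : Q ≠ 0) (hQ1 : ‖Q‖ < 1) {z : ℂ}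
    (hz : 1 + z + z ^ 2 + z ^ 3 + z ^ 4 = 0) :
    ∃ t0 t1 t2 t3 : ℂ, ∀ q : ℂ, q ^ 5 = Q →
      poch q q / (poch (z * q) q * poch (z⁻¹ * q) q) * lambert z q =
        t0 + t1 * q + t2 * q ^ 2 + t3 * q ^ 3 + poch (Q ^ 5) (Q ^ 5) ^ 4 / poch Q Q *
          (2 * (z ^ 2 - z ^ 3) - 4 * (z - z ^ 4)) * q ^ 4 := by
  set p := Q ^ 5 with hp_def
  set κ1 := kap p Q with hκ1
  set κ2 := kap p (Q ^ 2) with hκ2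
  set d1 := z - z ^ 4 with hd1
  set d2 := z ^ 2 - z ^ 3 with hd2
  set c := z + z ^ 4 with hc
  set l0 := d1 * kron p Q 1 + d2 * kron p (Q ^ 2) 1 with hl0
  set M := poch p p * theta p Q / poch Q Q with hM
  have hp := pow_ne_zero 5 hQ
  have hp1 := norm_pow_five_lt hQ1
  have A1 := ann_one hQ hQ1
  have A2 := ann_pow hQ hQ1 (j := 2) (by norm_num) (by norm_num)
  have n1 : κ1 ≠ 0 := kap_ne_zero hp hp1 A1
  have n2 : κ2 ≠ 0 := kap_ne_zero hp hp1 A2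
  have t1 := theta_ne_zero hp hp1 A1
  have hE := poch_self_ne_zero hQ1
  have k1 := theta_mul_kap hp hp1 A1
  have k2 := theta_mul_kap hp hp1 A2
  have h5 : z ^ 5 = 1 := by linear_combination (z - 1) * hz
  have zi : z⁻¹ = z ^ 4 := by
    apply inv_eq_of_mul_eq_one_right; rw [← h5]; ring
  have hcd1 : c * d1 = d2 := by rw [hc, hd1, hd2]; linear_combination -z ^ 3 * h5
  have hcd2 : c * d2 = d1 - d2 := by
    rw [hc, hd1, hd2]; linear_combination (z - z ^ 2) * h5
  set A := κ1 / κ2 with hA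
  set B := κ2 / κ1 with hB
  refine ⟨M * (A ^ 2 * l0 + Q * ((c - 1) * A * (d2 * (κ2 ^ 2 / κ1)) -
      (1 + c) * ((d1 - d2) * κ2) - c * B * ((d1 + d2) * κ1))),
    M * (A ^ 2 * (d1 * (κ1 ^ 2 / κ2)) + (c - 1) * A * l0 -
      Q * ((1 + c) * (d2 * (κ2 ^ 2 / κ1)) + c * B * ((d1 - d2) * κ2))),
    M * (A ^ 2 * ((d1 + d2) * κ1) + (c - 1) * A * (d1 * (κ1 ^ 2 / κ2)) - (1 + c) * l0 -
      Q * (c * B * (d2 * (κ2 ^ 2 / κ1)))),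
    M * (A ^ 2 * ((d1 - d2) * κ2) + (c - 1) * A * ((d1 + d2) * κ1) -
      (1 + c) * (d1 * (κ1 ^ 2 / κ2)) - c * B * l0), fun q hq5 => ?_⟩
  have hq : q ≠ 0 := by rintro rfl; apply hQ; rw [← hq5]; simp
  have hq1 : ‖q‖ < 1 := by
    by_contra h
    have : ‖q ^ 5‖ < 1 := by rwa [hq5]
    rw [norm_pow] at this
    exact absurd this (not_lt.mpr (one_le_pow₀ (not_lt.mp h)))
  have e25 : q ^ 25 = p := by rw [hp_def, ← hq5]; ring
  have L := lambert_eq hq hq1 h5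
  rw [kron_five_one hq hq1, kron_five_two hq hq1, hq5, ← hp_def, ← hκ1, ← hκ2, ← hd1, ← hd2] at L
  have hz2 : 1 + z ^ 2 + (z ^ 2) ^ 2 + (z ^ 2) ^ 3 + (z ^ 2) ^ 4 = 0 := by
    linear_combination hz + (z + z ^ 3) * h5
  have P := poch_pair hq hq1 hz2
  have R := poch_roots hq1 hz
  have E := euler_five hq hq1
  rw [hq5] at R
  rw [hq5, e25] at P E
  rw [← hκ1, ← hκ2] at E
  have z8 : (z ^ 2) ^ 4 = z ^ 3 := by linear_combination z ^ 3 * h5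
  have z46 : (z ^ 2) ^ 2 + (z ^ 2) ^ 3 = c := by rw [hc]; linear_combination z * h5
  rw [z8, z46] at P
  rw [zi]
  have C : poch q q / (poch (z * q) q * poch (z ^ 4 * q) q) =
      poch q q * (theta p (Q ^ 2) + q * theta p Q * c) / poch Q Q := by
    rw [← P, ← R]
    have a0 : poch q q * poch (z * q) q * poch (z ^ 4 * q) q * poch (z ^ 2 * q) q *
      poch (z ^ 3 * q) q ≠ 0 := by rw [R]; exact hE
    simp only [mul_ne_zero_iff] at a0
    obtain ⟨⟨⟨⟨_, _⟩, _⟩, _⟩, _⟩ := a0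
    field_simp
  have t2 : theta p (Q ^ 2) = theta p Q * (κ1 / κ2) := by
    field_simp; linear_combination k2 - k1
  have hPhi : poch p p ^ 4 / poch Q Q = M * κ1 := by
    rw [hM]; field_simp; linear_combination -poch p p * k1
  rw [hPhi, L, C, E, t2]
  have : poch p p * (κ1 / κ2 - q - q ^ 2 * (κ2 / κ1)) * (theta p Q * (κ1 / κ2) + q * theta p Q * c)
      / poch Q Q = M * ((κ1 / κ2) ^ 2 + q * (c - 1) * (κ1 / κ2) - q ^ 2 * (1 + c) -
        q ^ 3 * c * (κ2 / κ1)) := by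
    rw [hM]; field_simp; ring
  rw [this]
  have m1 : A ^ 2 * (κ2 ^ 2 / κ1) = κ1 := by rw [hA]; field_simp
  have m2 : A * κ2 = κ1 := by rw [hA]; field_simp
  have m3 : B * (κ1 ^ 2 / κ2) = κ1 := by rw [hB]; field_simp
  have t4 : A ^ 2 * (d2 * (κ2 ^ 2 / κ1)) + (c - 1) * A * ((d1 - d2) * κ2) -
      (1 + c) * ((d1 + d2) * κ1) - c * B * (d1 * (κ1 ^ 2 / κ2)) =
      κ1 * (2 * d2 - 4 * d1) := by
    linear_combination d2 * m1 + (c - 1) * (d1 - d2) * m2 - c * d1 * m3 -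
      κ1 * hcd1 - 2 * κ1 * hcd2
  generalize κ1 ^ 2 / κ2 = e1 at *
  generalize κ2 ^ 2 / κ1 = e2 at *
  linear_combination M * q ^ 4 * t4 + M * ((c - 1) * A * (d2 * e2) - (1 + c) * ((d1 - d2) * κ2) -
      c * B * ((d1 + d2) * κ1) - q * ((1 + c) * (d2 * e2) + c * B * ((d1 - d2) * κ2)) -
      q ^ 2 * (c * B * (d2 * e2))) * hq5

end Lambert

section Mock
variable {q Q : ℂ}

/-- a set of at least five points determines the coefficients of a quartic -/
lemma components_unique (hQ : Q ≠ 0) {a b : Fin 5 → ℂ}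
    (h : ∀ q : ℂ, q ^ 5 = Q → ∑ r, a r * q ^ (r : ℕ) = ∑ r, b r * q ^ (r : ℕ)) : a = b := by
  obtain ⟨q0, h0⟩ := IsAlgClosed.exists_pow_nat_eq Q (n := 5) (by norm_num)
  have hq0 : q0 ≠ 0 := by rintro rfl; apply hQ; rw [← h0]; simp
  have hω := Complex.isPrimitiveRoot_exp 5 (by norm_num)
  set ω := Complex.exp (2 * Real.pi * Complex.I / (5 : ℕ)) with hωdef
  have inj : Function.Injective fun i : Fin 5 => ω ^ (i : ℕ) * q0 := by
    intro i j hij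
    have := hω.pow_inj i.2 j.2 (mul_right_cancel₀ hq0 hij)
    exact Fin.ext this
  have := Matrix.eq_zero_of_forall_index_sum_pow_mul_eq_zero inj (v := a - b) (fun j => by
    have e := h (ω ^ (j : ℕ) * q0) (by
      rw [mul_pow, h0, ← pow_mul, mul_comm (j : ℕ) 5, pow_mul, hω.pow_eq_one, one_pow, one_mul])
    rw [← sub_eq_zero, ← Finset.sum_sub_distrib] at e
    rw [← e]
    refine Finset.sum_congr rfl fun r _ => ?_
    rw [Pi.sub_apply]; ring)
  exact sub_eq_zero.mp this

lemma ne_zero_norm_lt_of_pow (hQ : Q ≠ 0) (hQ1 : ‖Q‖ < 1) (h : q ^ 5 = Q) :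
    q ≠ 0 ∧ ‖q‖ < 1 := by
  refine ⟨by rintro rfl; apply hQ; rw [← h]; simp, ?_⟩
  by_contra hlt
  have : ‖q ^ 5‖ < 1 := by rwa [h]
  rw [norm_pow] at this
  exact absurd this (not_lt.mpr (one_le_pow₀ (not_lt.mp hlt)))

/-- the cubic bilateral series underlying the rank generating function -/
noncomputable def cubic (q w : ℂ) : ℂ := ∑' n : ℤ, gv q n ^ 3 * (1 - w * (q ^ 5) ^ n)⁻¹

lemma summable_norm_gv_cube (hq : q ≠ 0) (hq1 : ‖q‖ < 1) {x : ℂ} (hx : x ≠ 0) :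
    Summable fun n : ℤ => ‖gv q n ^ 3 * x ^ n‖ := by
  obtain ⟨C, hC⟩ := (summable_norm_gv hq hq1).tendsto_cofinite_zero.bddAbove_range_of_cofinite
  have hC' : ∀ n, ‖gv q n‖ ≤ C := fun n => hC ⟨n, rfl⟩
  refine Summable.of_nonneg_of_le (fun _ => norm_nonneg _) (fun n => ?_)
    ((summable_norm_gv_mul hq hq1 hx).mul_left (C ^ 2))
  rw [show gv q n ^ 3 * x ^ n = gv q n ^ 2 * (gv q n * x ^ n) by ring, norm_mul, norm_pow]
  gcongr
  exact hC' n

lemma summable_norm_cubic (hq : q ≠ 0) (hq1 : ‖q‖ < 1) {w x : ℂ} (hw : w ≠ 0) (hx : x ≠ 0) :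
    Summable fun n : ℤ => ‖gv q n ^ 3 * x ^ n * (1 - w * (q ^ 5) ^ n)⁻¹‖ := by
  obtain ⟨C, hC⟩ := exists_bound_inv (pow_ne_zero 5 hq) (norm_pow_five_lt hq1) hw
  refine Summable.of_nonneg_of_le (fun _ => norm_nonneg _) (fun m => ?_)
    ((summable_norm_gv_cube hq hq1 hx).mul_right C)
  rw [norm_mul]
  exact mul_le_mul_of_nonneg_left (hC m) (norm_nonneg _)

lemma cubic_five (hq : q ≠ 0) (hq1 : ‖q‖ < 1) {w : ℂ} (hw : w ≠ 0) :
    cubic q w = kap3 ((q ^ 5) ^ 5) (((q ^ 5) ^ 2) ^ 3)⁻¹ w -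
      q ^ 3 * kap3 ((q ^ 5) ^ 5) ((q ^ 5) ^ 3)⁻¹ (w * q ^ 5) +
      q ^ 9 * kap3 ((q ^ 5) ^ 5) 1 (w * (q ^ 5) ^ 2) -
      q ^ 18 * kap3 ((q ^ 5) ^ 5) ((q ^ 5) ^ 3) (w * (q ^ 5) ^ 3) +
      q ^ 30 * kap3 ((q ^ 5) ^ 5) (((q ^ 5) ^ 2) ^ 3) (w * (q ^ 5) ^ 4) := by
  have hs := summable_norm_cubic hq hq1 hw one_ne_zero
  simp only [one_zpow, mul_one] at hs
  have H := tsum_int_five hs.of_norm 0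
  have e25 : q ^ 25 = (q ^ 5) ^ 5 := by ring
  have piece : ∀ r : ℤ, ∑' n : ℤ, gv q (5 * n + r) ^ 3 * (1 - w * (q ^ 5) ^ (5 * n + r))⁻¹ =
      gv q r ^ 3 * kap3 ((q ^ 5) ^ 5) (((q ^ 5) ^ (2 - r)) ^ 3)⁻¹ (w * (q ^ 5) ^ r) := by
    intro r
    unfold kap3
    rw [← tsum_mul_left]
    congr 1; ext n
    have hT : ∀ T : ℂ, ((T ^ 3)⁻¹) ^ n = (T ^ (-n)) ^ 3 := by
      intro T
      rw [inv_zpow, zpow_neg, ← zpow_natCast T 3, ← zpow_mul, mul_comm, zpow_mul, zpow_natCast,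
        inv_pow]
    rw [gv_five_mul_add hq, e25, zpow_add₀ (pow_ne_zero 5 hq), zpow_mul (q ^ 5) 5 n, hT]
    rw [show w * (((q ^ 5) ^ (5 : ℤ)) ^ n * (q ^ 5) ^ r) = w * (q ^ 5) ^ r * ((q ^ 5) ^ 5) ^ n by
      simp only [zpow_ofNat]; ring]
    ring
  have g2 : gv q 2 = q ^ 3 := by norm_num [gv, zpow_ofNat]
  have g3 : gv q 3 = -q ^ 6 := by norm_num [gv, zpow_ofNat]
  have g4 : gv q 4 = q ^ 10 := by norm_num [gv, zpow_ofNat]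
  rw [cubic, H]
  simp only [zero_add, piece, gv_zero, gv_one, g2, g3, g4]
  norm_num [zpow_ofNat]
  ring

lemma cubic_components (hQ : Q ≠ 0) (hQ1 : ‖Q‖ < 1) {w : ℂ} (hw : w ≠ 0)
    (hl : ∀ m : ℤ, w * Q ^ m ≠ 1) (h : q ^ 5 = Q) :
    kap (Q ^ 5) Q * kap (Q ^ 5) (Q ^ 2) * cubic q w =
      kap (Q ^ 5) w * kap (Q ^ 5) (w * Q ^ 2) * kap (Q ^ 5) (w * Q ^ 4) +
        Q ^ 2 * kap (Q ^ 5) (Q ^ 2) ^ 2 * kap3 (Q ^ 5) 1 (w * Q ^ 2) -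
      q ^ 3 * (kap (Q ^ 5) (w * Q) * kap (Q ^ 5) (w * Q ^ 2) * kap (Q ^ 5) (w * Q ^ 3) +
        Q * kap (Q ^ 5) Q ^ 2 * kap3 (Q ^ 5) 1 (w * Q ^ 2)) +
      q ^ 4 * Q * (kap (Q ^ 5) Q * kap (Q ^ 5) (Q ^ 2)) * kap3 (Q ^ 5) 1 (w * Q ^ 2) := by
  obtain ⟨hq, hq1⟩ := ne_zero_norm_lt_of_pow hQ hQ1 h
  have hp := pow_ne_zero 5 hQ
  have hp1 := norm_pow_five_lt hQ1
  have A1 := ann_one hQ hQ1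
  have A2 := ann_pow hQ hQ1 (j := 2) (by norm_num) (by norm_num)
  have A4 := ann_pow hQ hQ1 (j := 4) (by norm_num) (by norm_num)
  have lat : ∀ j m : ℤ, w * Q ^ j * (Q ^ 5) ^ m ≠ 1 := by
    intro j m
    rw [← zpow_natCast Q 5, ← zpow_mul, mul_assoc, ← zpow_add₀ hQ]
    exact hl _
  have T1 := kap_triple hp hp1 (z := w * Q ^ 2) (t := Q) (mul_ne_zero hw A2.ne_zero) hQ
    (by have := lat 1; rwa [show w * Q ^ 2 * Q⁻¹ = w * Q ^ (1 : ℤ) by field_simp])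
    (by simpa [zpow_ofNat] using lat 2)
    (by simpa [zpow_ofNat, pow_succ, mul_assoc] using lat 3)
    (A1.mul_zpow_ne_one hp hp1) (A2.mul_zpow_ne_one hp hp1)
  have T2 := kap_triple hp hp1 (z := w * Q ^ 2) (t := Q ^ 2) (mul_ne_zero hw A2.ne_zero) A2.ne_zero
    (by have := lat 0; simpa [mul_assoc, A2.ne_zero, hQ] using this)
    (by simpa [zpow_ofNat] using lat 2)
    (by have := lat 4; rwa [show w * Q ^ 2 * Q ^ 2 = w * Q ^ (4 : ℤ) by
          simp only [zpow_ofNat]; ring])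
    (A2.mul_zpow_ne_one hp hp1) (by rw [← pow_mul]; exact A4.mul_zpow_ne_one hp hp1)
  rw [show w * Q ^ 2 * Q⁻¹ = w * Q by field_simp, show w * Q ^ 2 * Q = w * Q ^ 3 by ring] at T1
  rw [show w * Q ^ 2 * (Q ^ 2)⁻¹ = w by field_simp, show w * Q ^ 2 * Q ^ 2 = w * Q ^ 4 by ring,
    ← pow_mul, kap_four hQ hQ1] at T2
  rw [cubic_five hq hq1 hw, h, show q ^ 9 = Q * q ^ 4 by rw [← h]; ring,
    show q ^ 18 = Q ^ 3 * q ^ 3 by rw [← h]; ring,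
    show q ^ 30 = (Q ^ 2) ^ 3 by rw [← h]; ring]
  linear_combination q ^ 3 * T1 - T2

/-- `f` agrees on the fifth roots of `Q` with a quartic of leading coefficient `c` -/
def TopCoeff (Q : ℂ) (f : ℂ → ℂ) (c : ℂ) : Prop :=
  ∃ r0 r1 r2 r3 : ℂ, ∀ q : ℂ, q ^ 5 = Q → f q = r0 + r1 * q + r2 * q ^ 2 + r3 * q ^ 3 + c * q ^ 4

lemma TopCoeff.unique (hQ : Q ≠ 0) {f : ℂ → ℂ} {c d : ℂ} (hc : TopCoeff Q f c)
    (hd : TopCoeff Q f d) : c = d := by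
  obtain ⟨r0, r1, r2, r3, h⟩ := hc
  obtain ⟨s0, s1, s2, s3, h'⟩ := hd
  have := components_unique hQ (a := ![r0, r1, r2, r3, c]) (b := ![s0, s1, s2, s3, d]) (by
    intro q hq
    have := (h q hq).symm.trans (h' q hq)
    simpa [Fin.sum_univ_five] using this)
  simpa using congrFun this 4

lemma exists_topCoeff (Q : ℂ) (f : ℂ → ℂ) : ∃ c, TopCoeff Q f c := by
  classical
  set s := (Polynomial.nthRoots 5 Q).toFinset with hs
  set P := Lagrange.interpolate s id f with hP
  have hdeg : P.degree < (5 : ℕ) := by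
    refine (Lagrange.degree_interpolate_lt f (Set.injOn_id _)).trans_le ?_
    exact_mod_cast (Multiset.toFinset_card_le _).trans (Polynomial.card_nthRoots 5 Q)
  have hnat : P.natDegree < 5 := by
    by_cases h0 : P = 0
    · rw [h0]; simp
    · exact (Polynomial.natDegree_lt_iff_degree_lt h0).mpr hdeg
  refine ⟨P.coeff 4, P.coeff 0, P.coeff 1, P.coeff 2, P.coeff 3, fun q hq => ?_⟩
  have hmem : q ∈ s := by
    rw [hs, Multiset.mem_toFinset, Polynomial.mem_nthRoots (by norm_num)]; exact hq
  have e := Lagrange.eval_interpolate_at_node f (Set.injOn_id _) hmem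
  rw [← hP, id, Polynomial.eval_eq_sum_range' hnat] at e
  rw [← e]
  simp [Finset.sum_range_succ]

lemma TopCoeff.const_mul {f : ℂ → ℂ} {c : ℂ} (h : TopCoeff Q f c) (a : ℂ) :
    TopCoeff Q (fun q => a * f q) (a * c) := by
  obtain ⟨r0, r1, r2, r3, h⟩ := h
  exact ⟨a * r0, a * r1, a * r2, a * r3, fun q hq => by
    change a * f q = _
    rw [h q hq]; ring⟩

lemma TopCoeff.congr {f g : ℂ → ℂ} {c : ℂ} (h : TopCoeff Q f c)
    (hg : ∀ q, q ^ 5 = Q → g q = f q) : TopCoeff Q g c := by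
  obtain ⟨r0, r1, r2, r3, h⟩ := h
  exact ⟨r0, r1, r2, r3, fun q hq => by rw [hg q hq, h q hq]⟩

lemma quartic_mul (p0 p1 p2 p3 p4 y0 y1 y2 y3 y4 : ℂ) :
    TopCoeff Q (fun q => (p0 + p1 * q + p2 * q ^ 2 + p3 * q ^ 3 + p4 * q ^ 4) *
      (y0 + y1 * q + y2 * q ^ 2 + y3 * q ^ 3 + y4 * q ^ 4))
      (p0 * y4 + p1 * y3 + p2 * y2 + p3 * y1 + p4 * y0) :=
  ⟨p0 * y0 + Q * (p1 * y4 + p2 * y3 + p3 * y2 + p4 * y1),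
    p0 * y1 + p1 * y0 + Q * (p2 * y4 + p3 * y3 + p4 * y2),
    p0 * y2 + p1 * y1 + p2 * y0 + Q * (p3 * y4 + p4 * y3),
    p0 * y3 + p1 * y2 + p2 * y1 + p3 * y0 + Q * (p4 * y4), fun q hq => by
      linear_combination ((p1 * y4 + p2 * y3 + p3 * y2 + p4 * y1) +
        q * (p2 * y4 + p3 * y3 + p4 * y2) + q ^ 2 * (p3 * y4 + p4 * y3) + q ^ 3 * (p4 * y4)) * hq⟩

/-- the leading coefficient of the interpolating quartic depends smoothly on its values -/
lemma TopCoeff.hasDerivAt (hQ : Q ≠ 0) {F : ℂ → ℂ → ℂ} {F' R : ℂ → ℂ} {z0 c : ℂ}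
    (hF : ∀ q, q ^ 5 = Q → HasDerivAt (fun z => F z q) (F' q) z0)
    (hR : ∀ z, TopCoeff Q (F z) (R z)) (hc : TopCoeff Q F' c) : HasDerivAt R c z0 := by
  obtain ⟨q0, h0⟩ := IsAlgClosed.exists_pow_nat_eq Q (n := 5) (by norm_num)
  have hq0 : q0 ≠ 0 := by rintro rfl; apply hQ; rw [← h0]; simp
  have hω := Complex.isPrimitiveRoot_exp 5 (by norm_num)
  set ω := Complex.exp (2 * Real.pi * Complex.I / (5 : ℕ)) with hωdef
  have g1 : 1 + ω + ω ^ 2 + ω ^ 3 + ω ^ 4 = 0 := by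
    have := hω.geom_sum_eq_zero (by norm_num)
    simpa [Finset.sum_range_succ] using this
  have g5 := hω.pow_eq_one
  have g2 : 1 + ω ^ 2 + ω ^ 4 + ω ^ 6 + ω ^ 8 = 0 := by
    linear_combination g1 + (ω + ω ^ 3) * g5
  have g3 : 1 + ω ^ 3 + ω ^ 6 + ω ^ 9 + ω ^ 12 = 0 := by
    linear_combination g1 + (ω + ω ^ 4 + ω ^ 2 * (ω ^ 5 + 1)) * g5
  have g4 : 1 + ω ^ 4 + ω ^ 8 + ω ^ 12 + ω ^ 16 = 0 := by
    linear_combination g1 + (ω ^ 3 + ω ^ 2 * (ω ^ 5 + 1) + ω * (ω ^ 10 + ω ^ 5 + 1)) * g5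
  have roots : ∀ i : ℕ, (ω ^ i * q0) ^ 5 = Q := by
    intro i
    rw [mul_pow, h0, ← pow_mul, mul_comm i 5, pow_mul, g5, one_pow, one_mul]
  have extract : ∀ (f : ℂ → ℂ) (d : ℂ), TopCoeff Q f d →
      d = (5 * Q)⁻¹ * (f (ω ^ 0 * q0) * (ω ^ 0 * q0) + f (ω ^ 1 * q0) * (ω ^ 1 * q0) +
        f (ω ^ 2 * q0) * (ω ^ 2 * q0) + f (ω ^ 3 * q0) * (ω ^ 3 * q0) +
        f (ω ^ 4 * q0) * (ω ^ 4 * q0)) := by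
    rintro f d ⟨r0, r1, r2, r3, h⟩
    rw [h _ (roots 0), h _ (roots 1), h _ (roots 2), h _ (roots 3), h _ (roots 4)]
    rw [eq_inv_mul_iff_mul_eq₀ (mul_ne_zero (by norm_num) hQ)]
    linear_combination (-d) * (roots 0 + roots 1 + roots 2 + roots 3 + roots 4) - r0 * q0 * g1 -
      r1 * q0 ^ 2 * g2 - r2 * q0 ^ 3 * g3 - r3 * q0 ^ 4 * g4
  have hRe : R = fun z => (5 * Q)⁻¹ * (F z (ω ^ 0 * q0) * (ω ^ 0 * q0) +
      F z (ω ^ 1 * q0) * (ω ^ 1 * q0) + F z (ω ^ 2 * q0) * (ω ^ 2 * q0) +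
      F z (ω ^ 3 * q0) * (ω ^ 3 * q0) + F z (ω ^ 4 * q0) * (ω ^ 4 * q0)) :=
    funext fun z => extract _ _ (hR z)
  rw [hRe, extract _ _ hc]
  exact ((((((hF _ (roots 0)).mul_const _).add ((hF _ (roots 1)).mul_const _)).add
    ((hF _ (roots 2)).mul_const _)).add ((hF _ (roots 3)).mul_const _)).add
    ((hF _ (roots 4)).mul_const _)).const_mul _

/-- the rational function `∑ (x^(5 * k + 1) - x^(5 * k + 4))` -/
noncomputable def hfun (x : ℂ) : ℂ := x * (1 + x + x ^ 2) / (1 + x + x ^ 2 + x ^ 3 + x ^ 4)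

/-- the bilateral series whose derivative at `1` generates the rank differences -/
noncomputable def mock (q z : ℂ) : ℂ := ∑' n : ℤ, gv q n ^ 3 * q⁻¹ ^ n * hfun (z * q ^ n)

lemma mock_eq (hq : q ≠ 0) (hq1 : ‖q‖ < 1) {z : ℂ} (hz : z ≠ 0)
    (hl : ∀ m : ℤ, z ^ 5 * (q ^ 5) ^ m ≠ 1) :
    mock q z = z * cubic q (z ^ 5) + z ^ 4 * (q ^ 3)⁻¹ * cubic q (z ^ 5 * (q ^ 5)⁻¹) := by
  have hQ := pow_ne_zero 5 hq
  have hZ := pow_ne_zero 5 hz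
  have hs := (summable_norm_cubic hq hq1 hZ one_ne_zero).of_norm
  have hs' := (summable_norm_cubic hq hq1 (mul_ne_zero hZ (inv_ne_zero hQ)) one_ne_zero).of_norm
  simp only [one_zpow, mul_one] at hs hs'
  have sh := ((Equiv.addRight (1 : ℤ)).hasSum_iff.mpr hs'.hasSum)
  have := (hs.hasSum.mul_left z).add (sh.mul_left (z ^ 4 * (q ^ 3)⁻¹))
  rw [mock, cubic, cubic, ← this.tsum_eq]
  congr 1; ext n
  simp only [Function.comp_apply, Equiv.coe_addRight]
  have hn := hl n
  have e1 : z ^ 5 * (q ^ 5)⁻¹ * (q ^ 5) ^ (n + 1) = (z * q ^ n) ^ 5 := by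
    rw [zpow_add_one₀ hQ, mul_pow, ← zpow_natCast (q ^ n), ← zpow_mul, mul_comm n, zpow_mul,
      zpow_natCast]
    field_simp
  have e2 : z ^ 5 * (q ^ 5) ^ n = (z * q ^ n) ^ 5 := by
    rw [mul_pow, ← zpow_natCast (q ^ n), ← zpow_mul, mul_comm n, zpow_mul, zpow_natCast]
  rw [e1, e2, gv_succ hq, zpow_add_one₀ hq, inv_zpow]
  rw [e2] at hn
  have hx := zpow_ne_zero n hq
  have hd : 1 - (z * q ^ n) ^ 5 ≠ 0 := fun h => hn (by linear_combination -h)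
  have hd' : 1 + z * q ^ n + (z * q ^ n) ^ 2 + (z * q ^ n) ^ 3 + (z * q ^ n) ^ 4 ≠ 0 := by
    intro h
    apply hd
    linear_combination (1 - z * q ^ n) * h
  have hh : hfun (z * q ^ n) = (z * q ^ n - (z * q ^ n) ^ 4) * (1 - (z * q ^ n) ^ 5)⁻¹ := by
    rw [hfun, ← div_eq_mul_inv, div_eq_div_iff hd' hd]; ring
  rw [hh]
  generalize (1 - (z * q ^ n) ^ 5)⁻¹ = D
  generalize q ^ n = x at *
  field_simp
  ring

/-- the ratio of the two special values of `κ` -/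
noncomputable def kapRatio (Q : ℂ) : ℂ := kap (Q ^ 5) Q / kap (Q ^ 5) (Q ^ 2)

/-- the cofactor of `A - q - q^2/A` in `A^5 - 11 q^5 - q^10/A^5` -/
noncomputable def cofactor (Q A q : ℂ) : ℂ :=
  (A ^ 4 - 3 * Q / A) + (A ^ 3 + 2 * Q / A ^ 2) * q + (2 * A ^ 2 - Q / A ^ 3) * q ^ 2 +
    (3 * A + Q / A ^ 4) * q ^ 3 + 5 * q ^ 4

lemma cofactor_mul {A : ℂ} (hA : A ≠ 0) (h : q ^ 5 = Q) :
    cofactor Q A q * (A - q - q ^ 2 / A) = A ^ 5 - 11 * Q - Q ^ 2 / A ^ 5 := by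
  rw [cofactor, ← h]; field_simp; ring

theorem mock_topCoeff (hQ : Q ≠ 0) (hQ1 : ‖Q‖ < 1) {z : ℂ} (hz : z ≠ 0)
    (hl : ∀ m : ℤ, z ^ 5 * Q ^ m ≠ 1) :
    TopCoeff Q (fun q => cofactor Q (kapRatio Q) q * mock q z)
      ((5 * kap (Q ^ 5) (z ^ 5) * kap (Q ^ 5) (Q ^ 2 * z ^ 5) *
          (z * kap (Q ^ 5) (Q * (z ^ 5)⁻¹) - z ^ 4 * kap (Q ^ 5) (Q * z ^ 5)) -
        z * (kapRatio Q ^ 3 + 2 * Q / kapRatio Q ^ 2) * kap (Q ^ 5) (Q * z ^ 5) *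
          kap (Q ^ 5) (Q ^ 2 * z ^ 5) * kap (Q ^ 5) (Q ^ 2 * (z ^ 5)⁻¹) -
        z⁻¹ * (2 * kapRatio Q ^ 2 - Q / kapRatio Q ^ 3) * kap (Q ^ 5) (Q * z ^ 5) *
          kap (Q ^ 5) (Q ^ 2 * (z ^ 5)⁻¹) * kap (Q ^ 5) (Q * (z ^ 5)⁻¹)) /
        (kap (Q ^ 5) Q * kap (Q ^ 5) (Q ^ 2))) := by
  have hp := pow_ne_zero 5 hQ
  have hp1 := norm_pow_five_lt hQ1
  have n1 := kap_ne_zero hp hp1 (ann_one hQ hQ1)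
  have n2 := kap_ne_zero hp hp1 (ann_pow hQ hQ1 (j := 2) (by norm_num) (by norm_num))
  have hZ := pow_ne_zero 5 hz
  have lat : ∀ j m : ℤ, z ^ 5 * Q ^ j * (Q ^ 5) ^ m ≠ 1 := by
    intro j m
    rw [← zpow_natCast Q 5, ← zpow_mul, mul_assoc, ← zpow_add₀ hQ]
    exact hl _
  have lat' : ∀ j m : ℤ, Q ^ j * (z ^ 5)⁻¹ * (Q ^ 5) ^ m ≠ 1 := by
    intro j m h
    rw [← zpow_natCast Q 5, ← zpow_mul, mul_right_comm, ← zpow_add₀ hQ] at h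
    apply hl (-(j + (5 : ℕ) * m))
    rw [zpow_neg]
    have := zpow_ne_zero (j + (5 : ℕ) * m) hQ
    field_simp at h ⊢
    exact h.symm
  have r3 : kap (Q ^ 5) (z ^ 5 * Q ^ 3) = kap (Q ^ 5) (Q ^ 2 * (z ^ 5)⁻¹) := by
    rw [← kap_reflect hp hp1 (x := Q ^ 2 * (z ^ 5)⁻¹) (by simp [hQ, hz])
      (by simpa [zpow_ofNat] using lat' 2)]
    congr 1; field_simp
  have r4 : kap (Q ^ 5) (z ^ 5 * Q ^ 4) = kap (Q ^ 5) (Q * (z ^ 5)⁻¹) := by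
    rw [← kap_reflect hp hp1 (x := Q * (z ^ 5)⁻¹) (by simp [hQ, hz]) (by simpa using lat' 1)]
    congr 1; field_simp
  have r0 : kap (Q ^ 5) (z ^ 5 * Q⁻¹) = -(Q * (z ^ 5)⁻¹) * kap (Q ^ 5) (Q * (z ^ 5)⁻¹) := by
    rw [← kap_inv hp (by simp [hQ, hz]) (by simpa using lat' 1)]
    congr 1; field_simp
  have key : ∀ q : ℂ, q ^ 5 = Q → _ := fun q hq => by
    obtain ⟨hq0, hq1⟩ := ne_zero_norm_lt_of_pow hQ hQ1 hq
    have c1 := cubic_components hQ hQ1 hZ hl hq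
    have c2 := cubic_components hQ hQ1 (w := z ^ 5 * Q⁻¹) (mul_ne_zero hZ (inv_ne_zero hQ))
      (fun m => by
        rw [mul_assoc, ← zpow_neg_one, ← zpow_add₀ hQ]; exact hl _) hq
    rw [r3, r4] at c1
    rw [show z ^ 5 * Q⁻¹ * Q ^ 2 = z ^ 5 * Q by field_simp, show z ^ 5 * Q⁻¹ * Q = z ^ 5 by field_simp,
      show z ^ 5 * Q⁻¹ * Q ^ 3 = z ^ 5 * Q ^ 2 by field_simp,
      show z ^ 5 * Q⁻¹ * Q ^ 4 = z ^ 5 * Q ^ 3 by field_simp, r3, r0] at c2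
    have m := mock_eq hq0 hq1 hz (by rwa [hq])
    rw [hq] at m
    exact And.intro m (And.intro c1 c2)
  rw [mul_comm Q (z ^ 5), mul_comm (Q ^ 2) (z ^ 5)]
  generalize kap (Q ^ 5) (z ^ 5 * Q) = a at *
  generalize kap (Q ^ 5) (Q * (z ^ 5)⁻¹) = a' at *
  generalize kap (Q ^ 5) (z ^ 5 * Q ^ 2) = b at *
  generalize kap (Q ^ 5) (Q ^ 2 * (z ^ 5)⁻¹) = b' at *
  generalize kap (Q ^ 5) (z ^ 5) = k at *
  generalize kap3 (Q ^ 5) 1 (z ^ 5 * Q ^ 2) = F at *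
  generalize kap3 (Q ^ 5) 1 (z ^ 5 * Q) = F' at *
  rw [kapRatio]
  generalize kap (Q ^ 5) Q = κ1 at *
  generalize kap (Q ^ 5) (Q ^ 2) = κ2 at *
  set A := κ1 / κ2 with hA
  have hA0 : A ≠ 0 := div_ne_zero n1 n2
  have T := (quartic_mul (Q := Q) (A ^ 4 - 3 * Q / A) (A ^ 3 + 2 * Q / A ^ 2) (2 * A ^ 2 - Q / A ^ 3)
    (3 * A + Q / A ^ 4) 5 (z * (k * b * a' + Q ^ 2 * κ2 ^ 2 * F) - z ^ 4 * (k * a * b + Q * κ1 ^ 2 * F'))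
    (z ^ 4 * (Q * (κ1 * κ2) * F'))
    (z ^ 4 * (-(z ^ 5)⁻¹ * a' * a * b' + Q * κ2 ^ 2 * F'))
    (-z * (a * b * b' + Q * κ1 ^ 2 * F)) (z * (Q * (κ1 * κ2) * F))).const_mul (κ1 * κ2)⁻¹
  have T' := T.congr (g := fun q => cofactor Q A q * mock q z) (fun q hq => by
    obtain ⟨m, c1, c2⟩ := key q hq
    have hq0 := (ne_zero_norm_lt_of_pow hQ hQ1 hq).1
    have q3 : (q ^ 3)⁻¹ = q ^ 2 * Q⁻¹ := by rw [← hq]; field_simp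
    rw [cofactor, eq_inv_mul_iff_mul_eq₀ (mul_ne_zero n1 n2), m, q3]
    have q30 : Q⁻¹ * Q = 1 := inv_mul_cancel₀ hQ
    have q31 : q ^ 5 * Q⁻¹ = 1 := by rw [hq]; exact mul_inv_cancel₀ hQ
    rw [← cofactor]
    generalize cofactor Q A q = f
    linear_combination f * z * c1 + f * z ^ 4 * q ^ 2 * Q⁻¹ * c2 +
      f * z ^ 4 * (-(k * a * b + Q * κ1 ^ 2 * F') + q * (Q * (κ1 * κ2) * F')) * q31 +
      f * z ^ 4 * q ^ 2 * (-(z ^ 5)⁻¹ * a' * a * b' + Q * κ2 ^ 2 * F') * q30)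
  convert T' using 1
  rw [hA]
  field_simp
  ring

/-- the Euler operator `x d/dx` applied to `hfun` -/
noncomputable def ffun (x : ℂ) : ℂ :=
  x * (1 + 2 * x + 3 * x ^ 2 - 3 * x ^ 4 - 2 * x ^ 5 - x ^ 6) /
    (1 + x + x ^ 2 + x ^ 3 + x ^ 4) ^ 2

/-- the bilateral series generating the rank differences -/
noncomputable def dmock (q : ℂ) : ℂ := ∑' n : ℤ, gv q n ^ 3 * q⁻¹ ^ n * ffun (q ^ n)

lemma hfun_hasDerivAt {x : ℂ} (hx : 1 + x + x ^ 2 + x ^ 3 + x ^ 4 ≠ 0) :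
    HasDerivAt hfun ((1 + 2 * x + 3 * x ^ 2 - 3 * x ^ 4 - 2 * x ^ 5 - x ^ 6) /
      (1 + x + x ^ 2 + x ^ 3 + x ^ 4) ^ 2) x := by
  have i := hasDerivAt_id x
  have n : HasDerivAt (fun x : ℂ => x * (1 + x + x ^ 2)) _ x :=
    i.mul (((hasDerivAt_const x (1 : ℂ)).add i).add (i.pow 2))
  have d : HasDerivAt (fun x : ℂ => 1 + x + x ^ 2 + x ^ 3 + x ^ 4) _ x :=
    ((((hasDerivAt_const x (1 : ℂ)).add i).add (i.pow 2)).add (i.pow 3)).add (i.pow 4)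
  refine (n.div d hx).congr_deriv ?_
  simp only [id, Pi.add_apply, Pi.pow_apply]
  congr 1
  norm_num
  ring

lemma hfun_bound {x : ℂ} {ρ : ℝ} (hρ : ρ < 1) (hx : ‖x‖ ≤ ρ) :
    1 + x + x ^ 2 + x ^ 3 + x ^ 4 ≠ 0 ∧ ‖hfun x‖ ≤ 2 / (1 - ρ) := by
  have x1 : ‖x‖ ≤ 1 := hx.trans hρ.le
  have h5 : ‖x ^ 5‖ ≤ ρ := by
    rw [norm_pow]
    exact (pow_le_of_le_one (norm_nonneg _) x1 (by norm_num)).trans hx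
  have h4 : ‖x ^ 4‖ ≤ 1 := by
    rw [norm_pow]; exact pow_le_one₀ (norm_nonneg _) x1
  have hd : 1 - ρ ≤ ‖1 - x ^ 5‖ := by
    have := norm_sub_norm_le (1 : ℂ) (x ^ 5)
    rw [norm_one] at this
    linarith
  have hd0 : 1 - x ^ 5 ≠ 0 := by
    intro h; rw [h, norm_zero] at hd; linarith
  have hD : 1 + x + x ^ 2 + x ^ 3 + x ^ 4 ≠ 0 := by
    intro h; apply hd0; linear_combination (1 - x) * h
  refine ⟨hD, ?_⟩
  have e : hfun x = (x - x ^ 4) / (1 - x ^ 5) := by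
    rw [hfun, div_eq_div_iff hD hd0]; ring
  rw [e, norm_div]
  have : ‖x - x ^ 4‖ ≤ 2 := (norm_sub_le _ _).trans (by linarith)
  exact div_le_div₀ (by norm_num) this (by linarith) hd

lemma hfun_inv {x : ℂ} (hx : x ≠ 0) : hfun x⁻¹ = hfun x := by
  by_cases h : 1 + x + x ^ 2 + x ^ 3 + x ^ 4 = 0
  · have : 1 + x⁻¹ + x⁻¹ ^ 2 + x⁻¹ ^ 3 + x⁻¹ ^ 4 = 0 := by
      field_simp; linear_combination h
    rw [hfun, hfun, h, this, div_zero, div_zero]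
  · have : 1 + x⁻¹ + x⁻¹ ^ 2 + x⁻¹ ^ 3 + x⁻¹ ^ 4 ≠ 0 := by
      intro h'; apply h; field_simp at h'; linear_combination h'
    rw [hfun, hfun, div_eq_div_iff this h]
    field_simp
    ring

lemma mock_hasDerivAt (hq : q ≠ 0) (hq1 : ‖q‖ < 1) : HasDerivAt (mock q) (dmock q) 1 := by
  obtain ⟨ρ, hρ, hρ1⟩ := exists_between hq1
  have hid : Tendsto (fun z : ℂ => z) (𝓝 1) (𝓝 1) := tendsto_id
  have D1 : (1 : ℂ) + 1 + 1 ^ 2 + 1 ^ 3 + 1 ^ 4 ≠ 0 := by norm_num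
  have v1 : ∀ᶠ z : ℂ in 𝓝 1, ‖z * q‖ < ρ :=
    (hid.mul_const q).norm.eventually_lt_const (by simpa using hρ)
  have v2 : ∀ᶠ z : ℂ in 𝓝 1, ‖z⁻¹ * q‖ < ρ :=
    ((hid.inv₀ one_ne_zero).mul_const q).norm.eventually_lt_const (by simpa using hρ)
  have v3 : ∀ᶠ z : ℂ in 𝓝 1, z ≠ 0 := hid.eventually_ne one_ne_zero
  have v4 : ∀ᶠ z : ℂ in 𝓝 1, ‖hfun z‖ < ‖hfun 1‖ + 1 :=
    (hfun_hasDerivAt D1).continuousAt.tendsto.norm.eventually_lt_const (by linarith)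
  have v5 : ∀ᶠ z : ℂ in 𝓝 1, 1 + z + z ^ 2 + z ^ 3 + z ^ 4 ≠ 0 := by
    have : Continuous fun z : ℂ => 1 + z + z ^ 2 + z ^ 3 + z ^ 4 := by fun_prop
    exact this.continuousAt.eventually_ne D1
  obtain ⟨U, hU, hUo, hU1⟩ := eventually_nhds_iff.mp (v1.and (v2.and (v3.and (v4.and v5))))
  have good : ∀ z ∈ U, ∀ n : ℤ, 1 + z * q ^ n + (z * q ^ n) ^ 2 + (z * q ^ n) ^ 3 +
      (z * q ^ n) ^ 4 ≠ 0 ∧ ‖hfun (z * q ^ n)‖ ≤ max (2 / (1 - ρ)) (‖hfun 1‖ + 1) := by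
    intro z hz n
    obtain ⟨h1, h2, h3, h4, h5⟩ := hU z hz
    have small : ∀ m : ℕ, ‖q ^ m‖ ≤ 1 := fun m => by
      rw [norm_pow]; exact pow_le_one₀ (norm_nonneg _) hq1.le
    rcases lt_trichotomy n 0 with hn | rfl | hn
    · obtain ⟨m, rfl⟩ : ∃ m : ℕ, n = -((m : ℤ) + 1) := ⟨(-n - 1).toNat, by omega⟩
      have e : z * q ^ (-((m : ℤ) + 1)) = (z⁻¹ * q * q ^ m)⁻¹ := by
        rw [zpow_neg, zpow_add_one₀ hq, zpow_natCast]; field_simp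
      have hb : ‖z⁻¹ * q * q ^ m‖ ≤ ρ := by
        rw [norm_mul]
        exact (mul_le_of_le_one_right (norm_nonneg _) (small m)).trans h2.le
      have hx0 : z⁻¹ * q * q ^ m ≠ 0 := by simp [h3, hq]
      obtain ⟨b1, b2⟩ := hfun_bound hρ1 hb
      rw [e, hfun_inv hx0]
      refine ⟨fun h => b1 ?_, b2.trans (le_max_left _ _)⟩
      generalize z⁻¹ * q * q ^ m = x at *
      field_simp at h; linear_combination h
    · simp only [zpow_zero, mul_one]
      exact ⟨h5, h4.le.trans (le_max_right _ _)⟩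
    · obtain ⟨m, rfl⟩ : ∃ m : ℕ, n = (m : ℤ) + 1 := ⟨(n - 1).toNat, by omega⟩
      have e : z * q ^ ((m : ℤ) + 1) = z * q * q ^ m := by
        rw [zpow_add_one₀ hq, zpow_natCast]; ring
      have hb : ‖z * q * q ^ m‖ ≤ ρ := by
        rw [norm_mul]
        exact (mul_le_of_le_one_right (norm_nonneg _) (small m)).trans h1.le
      obtain ⟨b1, b2⟩ := hfun_bound hρ1 hb
      rw [e]
      exact ⟨b1, b2.trans (le_max_left _ _)⟩
  have hterm : ∀ z ∈ U, ∀ n : ℤ, HasDerivAt (fun z => gv q n ^ 3 * q⁻¹ ^ n * hfun (z * q ^ n))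
      (gv q n ^ 3 * q⁻¹ ^ n * (_ * q ^ n)) z := fun z hz n =>
    (HasDerivAt.comp (h₂ := hfun) (h := fun z : ℂ => z * q ^ n) z
      (hfun_hasDerivAt (good z hz n).1) (by simpa using (hasDerivAt_id z).mul_const (q ^ n))).const_mul _
  have hsum := (summable_norm_gv_cube hq hq1 (inv_ne_zero hq)).mul_right
    (max (2 / (1 - ρ)) (‖hfun 1‖ + 1))
  have hle : ∀ (n : ℤ), ∀ z ∈ U, ‖gv q n ^ 3 * q⁻¹ ^ n * hfun (z * q ^ n)‖ ≤
      ‖gv q n ^ 3 * q⁻¹ ^ n‖ * max (2 / (1 - ρ)) (‖hfun 1‖ + 1) := by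
    intro n z hz
    rw [norm_mul]
    exact mul_le_mul_of_nonneg_left (good z hz n).2 (norm_nonneg _)
  have hdiff : ∀ n : ℤ, DifferentiableOn ℂ (fun z => gv q n ^ 3 * q⁻¹ ^ n * hfun (z * q ^ n)) U :=
    fun n z hz => (hterm z hz n).differentiableAt.differentiableWithinAt
  have h1 := Complex.hasSum_deriv_of_summable_norm hsum hdiff hUo hle hU1
  have h2 := (Complex.differentiableOn_tsum_of_summable_norm hsum hdiff hUo hle).differentiableAt
    (hUo.mem_nhds hU1)
  have h3 := h2.hasDerivAt
  refine h3.congr_deriv ?_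
  rw [← h1.tsum_eq, dmock]
  congr 1; ext n
  rw [(hterm 1 hU1 n).deriv, one_mul, ffun]
  ring

lemma inner1_pow : Tendsto (fun z : ℂ => z ^ 5) inner1 inner1 := by
  refine tendsto_nhdsWithin_iff.mpr ⟨by simpa using inner1_tendsto.pow 5, ?_⟩
  filter_upwards [inner1_norm] with z hz
  simp only [Metric.mem_ball, dist_zero_right, norm_pow]
  exact pow_lt_one₀ (norm_nonneg _) hz (by norm_num)

lemma tendsto_div_sub_one {f : ℂ → ℂ} {d : ℂ} (h : HasDerivAt f d 1) (h1 : f 1 = 0) :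
    Tendsto (fun z => f z / (z - 1)) inner1 (𝓝 d) := by
  have := h.tendsto_slope.mono_left inner1_le
  refine this.congr fun u => ?_
  rw [slope_def_field, h1, sub_zero]

lemma kap_pow_limit {p : ℂ} (hp : p ≠ 0) (hp1 : ‖p‖ < 1) {f g V : ℂ → ℂ} {d e v : ℂ}
    (hf : HasDerivAt f d 1) (hg : HasDerivAt g e 1) (hV : HasDerivAt V v 1)
    (f1 : f 1 = 0) (g1 : g 1 = 0) (V1 : V 1 = 0)
    (h : ∀ᶠ z in inner1, 5 * kap p (z ^ 5) * (f z * g z) = V z) : v = -(d * e) := by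
  have hk : Tendsto (fun z : ℂ => kap p (z ^ 5) * (1 - z ^ 5)) inner1 (𝓝 1) :=
    (kap_mul_one_sub_tendsto hp hp1).comp (inner1_pow.mono_right inner1_le)
  have hz : HasDerivAt (fun z : ℂ => z ^ 5 - 1) 5 1 := by
    simpa using ((hasDerivAt_id (1 : ℂ)).pow 5).sub_const 1
  have l5 := tendsto_div_sub_one hz (by simp)
  have lim := (((hk.const_mul 5).mul ((tendsto_div_sub_one hf f1).mul
    (tendsto_div_sub_one hg g1))).div l5 (by norm_num)).neg
  rw [show -(5 * 1 * (d * e) / 5) = -(d * e) by ring] at lim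
  refine tendsto_nhds_unique (tendsto_div_sub_one hV V1) (lim.congr' ?_)
  filter_upwards [h, inner1_ne, inner1_pow.eventually inner1_ne] with z hz h1 h5
  have h1' : z - 1 ≠ 0 := fun h => h1 (by linear_combination -h)
  have h5' : z ^ 5 - 1 ≠ 0 := fun h => h5 (by linear_combination -h)
  simp only [Pi.div_apply]
  rw [← hz]
  field_simp
  ring

theorem dmock_topCoeff (hQ : Q ≠ 0) (hQ1 : ‖Q‖ < 1) :
    TopCoeff Q (fun q => cofactor Q (kapRatio Q) q * dmock q)
      (kap (Q ^ 5) Q * kap (Q ^ 5) (Q ^ 2) *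
        (kapRatio Q ^ 5 - 11 * Q - Q ^ 2 / kapRatio Q ^ 5)) := by
  have hp := pow_ne_zero 5 hQ
  have hp1 := norm_pow_five_lt hQ1
  have A1 := ann_one hQ hQ1
  have A2 := ann_pow hQ hQ1 (j := 2) (by norm_num) (by norm_num)
  have n1 := kap_ne_zero hp hp1 A1
  have n2 := kap_ne_zero hp hp1 A2
  have X := kap_cube_one hQ hQ1
  have Y := kap_cube_two hQ hQ1
  choose R hR using fun z => exists_topCoeff Q (fun q => cofactor Q (kapRatio Q) q * mock q z)
  obtain ⟨c, hc⟩ := exists_topCoeff Q (fun q => cofactor Q (kapRatio Q) q * dmock q)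
  have dR : HasDerivAt R c 1 := TopCoeff.hasDerivAt hQ (fun q hq =>
    (mock_hasDerivAt (ne_zero_norm_lt_of_pow hQ hQ1 hq).1
      (ne_zero_norm_lt_of_pow hQ hQ1 hq).2).const_mul (cofactor Q (kapRatio Q) q)) hR hc
  have di : HasDerivAt (fun z : ℂ => z⁻¹) (-1) 1 := by
    simpa using hasDerivAt_inv (one_ne_zero : (1 : ℂ) ≠ 0)
  have d5 : HasDerivAt (fun z : ℂ => z ^ 5) 5 1 := by
    simpa using hasDerivAt_pow 5 (1 : ℂ)
  have d4 : HasDerivAt (fun z : ℂ => z ^ 4) 4 1 := by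
    simpa using hasDerivAt_pow 4 (1 : ℂ)
  have comp5 : ∀ {g : ℂ → ℂ} {d : ℂ}, HasDerivAt g d 1 →
      HasDerivAt (fun z : ℂ => g (z ^ 5)) (d * 5) 1 := fun {g d} hg =>
    HasDerivAt.comp (h₂ := g) (h := fun z : ℂ => z ^ 5) 1 (by simpa using hg) d5
  have dRi : HasDerivAt (fun z => R z⁻¹) (c * -1) 1 :=
    HasDerivAt.comp (h₂ := R) (h := fun z : ℂ => z⁻¹) 1 (by simpa using dR) di
  have da := comp5 (kap_hasDerivAt_mul hp hp1 A1)
  have da' := comp5 (kap_hasDerivAt_div hp hp1 A1)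
  have db := comp5 (kap_hasDerivAt_mul hp hp1 A2)
  have db' := comp5 (kap_hasDerivAt_div hp hp1 A2)
  have formula := fun (z : ℂ) (hz : z ≠ 0) (hl : ∀ m : ℤ, z ^ 5 * Q ^ m ≠ 1) =>
    (hR z).unique hQ (mock_topCoeff hQ hQ1 hz hl)
  have id1 := hasDerivAt_id (1 : ℂ)
  set p1 := kapRatio Q ^ 3 + 2 * Q / kapRatio Q ^ 2 with hp1d
  set p2 := 2 * kapRatio Q ^ 2 - Q / kapRatio Q ^ 3 with hp2d
  have df : HasDerivAt (fun z : ℂ => z * kap (Q ^ 5) (Q * (z ^ 5)⁻¹) -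
      z ^ 4 * kap (Q ^ 5) (Q * z ^ 5)) _ 1 := (id1.mul da').sub (d4.mul da)
  have dg := db.sub db'
  have dV : HasDerivAt (fun z : ℂ => kap (Q ^ 5) Q * kap (Q ^ 5) (Q ^ 2) * (R z - R z⁻¹) +
      p1 * (kap (Q ^ 5) (Q ^ 2 * z ^ 5) * kap (Q ^ 5) (Q ^ 2 * (z ^ 5)⁻¹) *
        (z * kap (Q ^ 5) (Q * z ^ 5) - z⁻¹ * kap (Q ^ 5) (Q * (z ^ 5)⁻¹))) -
      p2 * (kap (Q ^ 5) (Q * z ^ 5) * kap (Q ^ 5) (Q * (z ^ 5)⁻¹) *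
        (z * kap (Q ^ 5) (Q ^ 2 * z ^ 5) - z⁻¹ * kap (Q ^ 5) (Q ^ 2 * (z ^ 5)⁻¹)))) _ 1 :=
    (((dR.sub dRi).const_mul _).add (((db.mul db').mul ((id1.mul da).sub
      (di.mul da'))).const_mul p1)).sub (((da.mul da').mul ((id1.mul db).sub
      (di.mul db'))).const_mul p2)
  have key := kap_pow_limit hp hp1 df dg dV (by simp) (by simp) (by simp) ?_
  · simp only [id, one_pow, inv_one, mul_one, Pi.sub_apply, Pi.mul_apply] at key
    have := hc
    convert this using 1
    rw [hp1d, hp2d, kapRatio] at key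
    rw [kapRatio]
    generalize lam (Q ^ 5) Q = l1 at *
    generalize lam (Q ^ 5) (Q ^ 2) = l2 at *
    generalize kap (Q ^ 5) Q = κ1 at *
    generalize kap (Q ^ 5) (Q ^ 2) = κ2 at *
    have hx : κ1 ^ 3 / κ2 ^ 2 = 1 + 3 * l1 + l2 := by rw [X]; field_simp
    have hy : Q * κ2 ^ 3 / κ1 ^ 2 = l1 - 3 * l2 := by rw [Y]; field_simp
    have e1 : ((κ1 / κ2) ^ 3 + 2 * Q / (κ1 / κ2) ^ 2) * κ2 =
        κ1 ^ 3 / κ2 ^ 2 + 2 * (Q * κ2 ^ 3 / κ1 ^ 2) := by field_simp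
    have e2 : (2 * (κ1 / κ2) ^ 2 - Q / (κ1 / κ2) ^ 3) * κ1 =
        2 * (κ1 ^ 3 / κ2 ^ 2) - Q * κ2 ^ 3 / κ1 ^ 2 := by field_simp
    have e3 : κ1 * κ2 * ((κ1 / κ2) ^ 5 - 11 * Q - Q ^ 2 / (κ1 / κ2) ^ 5) =
        (κ1 ^ 3 / κ2 ^ 2) ^ 2 - 11 * (κ1 ^ 3 / κ2 ^ 2) * (Q * κ2 ^ 3 / κ1 ^ 2) -
          (Q * κ2 ^ 3 / κ1 ^ 2) ^ 2 := by field_simp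
    rw [hx, hy] at e1 e2 e3
    rw [e3]
    have h0 : 2 * (κ1 * κ2) ≠ 0 := mul_ne_zero two_ne_zero (mul_ne_zero n1 n2)
    refine mul_left_cancel₀ h0 ?_
    linear_combination -key + κ1 * κ2 * (2 + 10 * l1) * e1 - κ1 * κ2 * (2 + 10 * l2) * e2
  · filter_upwards [inner1_pow.eventually (inner1_ann hQ1), inner1_pow.eventually (inner1_ann hp1)]
      with z hz hz'
    have hz0 : z ≠ 0 := by rintro rfl; exact hz.ne_zero (by simp)
    have hl := hz.mul_zpow_ne_one hQ hQ1
    have hl' : ∀ m : ℤ, z⁻¹ ^ 5 * Q ^ m ≠ 1 := by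
      intro m h
      apply hl (-m)
      have := zpow_ne_zero m hQ
      rw [zpow_neg]
      field_simp at h ⊢
      exact h.symm
    rw [formula z hz0 hl, formula z⁻¹ (inv_ne_zero hz0) hl', inv_pow, inv_inv, inv_inv,
      kap_inv hp (pow_ne_zero 5 hz0) (hz'.mul_zpow_ne_one hp hp1)]
    simp only [Pi.sub_apply, inv_pow]
    generalize kap (Q ^ 5) (Q * z ^ 5) = a at *
    generalize kap (Q ^ 5) (Q * (z ^ 5)⁻¹) = a' at *
    generalize kap (Q ^ 5) (Q ^ 2 * z ^ 5) = b at *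
    generalize kap (Q ^ 5) (Q ^ 2 * (z ^ 5)⁻¹) = b' at *
    generalize kap (Q ^ 5) (z ^ 5) = k at *
    generalize p1 = P1 at *
    generalize p2 = P2 at *
    field_simp
    ring

lemma euler_kapRatio (hQ : Q ≠ 0) (hQ1 : ‖Q‖ < 1) (h : q ^ 5 = Q) :
    poch q q = poch (Q ^ 5) (Q ^ 5) * (kapRatio Q - q - q ^ 2 / kapRatio Q) := by
  obtain ⟨hq, hq1⟩ := ne_zero_norm_lt_of_pow hQ hQ1 h
  rw [euler_five hq hq1, show q ^ 25 = (q ^ 5) ^ 5 by ring, h, kapRatio]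
  congr 2
  rw [div_eq_mul_inv (q ^ 2), inv_div]

lemma kapRatio_ne_zero (hQ : Q ≠ 0) (hQ1 : ‖Q‖ < 1) : kapRatio Q ≠ 0 :=
  div_ne_zero (kap_ne_zero (pow_ne_zero 5 hQ) (norm_pow_five_lt hQ1) (ann_one hQ hQ1))
    (kap_ne_zero (pow_ne_zero 5 hQ) (norm_pow_five_lt hQ1)
      (ann_pow hQ hQ1 (j := 2) (by norm_num) (by norm_num)))

lemma euler_norm_ne_zero (hQ : Q ≠ 0) (hQ1 : ‖Q‖ < 1) :
    kapRatio Q ^ 5 - 11 * Q - Q ^ 2 / kapRatio Q ^ 5 ≠ 0 := by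
  intro h0
  have hA := kapRatio_ne_zero hQ hQ1
  have h : ∀ q, q ^ 5 = Q → cofactor Q (kapRatio Q) q = 0 := by
    intro q hq
    have := cofactor_mul hA hq
    rw [h0] at this
    refine (mul_eq_zero.mp this).resolve_right fun h' => ?_
    have e := euler_kapRatio hQ hQ1 hq
    rw [h', mul_zero] at e
    exact poch_self_ne_zero (ne_zero_norm_lt_of_pow hQ hQ1 hq).2 e
  have c5 : TopCoeff Q (cofactor Q (kapRatio Q)) 5 := ⟨_, _, _, _, fun q _ => rfl⟩
  have c0 : TopCoeff Q (cofactor Q (kapRatio Q)) 0 :=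
    ⟨0, 0, 0, 0, fun q hq => by rw [h q hq]; ring⟩
  have := c5.unique hQ c0
  norm_num at this

theorem rank_component (hQ : Q ≠ 0) (hQ1 : ‖Q‖ < 1) :
    TopCoeff Q (fun q => (poch q q)⁻¹ * dmock q) (poch (Q ^ 5) (Q ^ 5) ^ 4 / poch Q Q) := by
  have hp := pow_ne_zero 5 hQ
  have hp1 := norm_pow_five_lt hQ1
  have k1 := theta_mul_kap hp hp1 (ann_one hQ hQ1)
  have k2 := theta_mul_kap hp hp1 (ann_pow hQ hQ1 (j := 2) (by norm_num) (by norm_num))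
  have t := theta_mul_theta hQ hQ1
  have hK := poch_self_ne_zero hp1
  have hE := poch_self_ne_zero hQ1
  have hA := kapRatio_ne_zero hQ hQ1
  have hN := euler_norm_ne_zero hQ hQ1
  have T := (dmock_topCoeff hQ hQ1).const_mul (poch (Q ^ 5) (Q ^ 5) *
    (kapRatio Q ^ 5 - 11 * Q - Q ^ 2 / kapRatio Q ^ 5))⁻¹
  have e : (poch (Q ^ 5) (Q ^ 5) * (kapRatio Q ^ 5 - 11 * Q - Q ^ 2 / kapRatio Q ^ 5))⁻¹ *
      (kap (Q ^ 5) Q * kap (Q ^ 5) (Q ^ 2) *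
        (kapRatio Q ^ 5 - 11 * Q - Q ^ 2 / kapRatio Q ^ 5)) =
      poch (Q ^ 5) (Q ^ 5) ^ 4 / poch Q Q := by
    generalize kapRatio Q ^ 5 - 11 * Q - Q ^ 2 / kapRatio Q ^ 5 = N at *
    have : kap (Q ^ 5) Q * kap (Q ^ 5) (Q ^ 2) * poch Q Q = poch (Q ^ 5) (Q ^ 5) ^ 5 := by
      refine mul_left_cancel₀ hK ?_
      linear_combination (-kap (Q ^ 5) Q * kap (Q ^ 5) (Q ^ 2)) * t +
        theta (Q ^ 5) (Q ^ 2) * kap (Q ^ 5) (Q ^ 2) * k1 + poch (Q ^ 5) (Q ^ 5) ^ 3 * k2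
    rw [mul_inv]
    field_simp
    linear_combination this
  rw [e] at T
  refine T.congr fun q hq => ?_
  have hP := poch_self_ne_zero (ne_zero_norm_lt_of_pow hQ hQ1 hq).2
  have c := cofactor_mul hA hq
  rw [← c]
  rw [euler_kapRatio hQ hQ1 hq] at hP ⊢
  have hcf : cofactor Q (kapRatio Q) q ≠ 0 := by
    intro h; rw [h, zero_mul] at c; exact hN c.symm
  have hl := right_ne_zero_of_mul hP
  generalize kapRatio Q - q - q ^ 2 / kapRatio Q = l at *
  rw [mul_inv, mul_inv, mul_inv]
  field_simp

end Mock

section Partitions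

/-- partitions of arbitrary size, as multisets of positive integers -/
def Ptn : Type := {m : Multiset ℕ // 0 ∉ m}

/-- the multiset of parts -/
def Ptn.parts (x : Ptn) : Multiset ℕ := x.1

lemma Ptn.ext {x y : Ptn} (h : x.parts = y.parts) : x = y := Subtype.ext h

/-- adjoin a part -/
def Ptn.cons (v : ℕ) (hv : v ≠ 0) (x : Ptn) : Ptn :=
  ⟨v ::ₘ x.1, by simpa [hv.symm] using x.2⟩

lemma Ptn.parts_cons {v : ℕ} (hv : v ≠ 0) (x : Ptn) : (x.cons v hv).parts = v ::ₘ x.parts := rfl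

/-- a partition of arbitrary size is a size together with a partition of that size -/
def ptnEquiv : (Σ n : ℕ, n.Partition) ≃ Ptn where
  toFun p := ⟨p.2.parts, fun h => (p.2.parts_pos h).ne rfl⟩
  invFun x := ⟨x.1.sum, ⟨x.1, fun {i} h => Nat.pos_of_ne_zero fun h0 => x.2 (h0 ▸ h), rfl⟩⟩
  left_inv := by rintro ⟨n, π, h, rfl⟩; rfl
  right_inv _ := rfl

lemma hasSum_ptn {F : Multiset ℕ → ℂ} (hF : Summable fun x : Ptn => F x.parts) :
    HasSum (fun n : ℕ => ∑ π : n.Partition, F π.parts) (∑' x : Ptn, F x.parts) :=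
  HasSum.sigma (f := fun p : Σ n : ℕ, n.Partition => F p.2.parts)
    (ptnEquiv.hasSum_iff.mpr hF.hasSum) fun n => hasSum_fintype fun π : n.Partition => F π.parts

lemma card_partition_le (n : ℕ) : Fintype.card n.Partition ≤ 2 ^ n :=
  (Fintype.card_le_of_surjective _ Nat.Partition.ofComposition_surj).trans
    ((composition_card n).trans_le (Nat.pow_le_pow_right (by norm_num) (Nat.sub_le n 1)))

lemma summable_ptn {q : ℂ} (hq : ‖q‖ < 1 / 2) {c : Ptn → ℂ}
    (hc : ∀ x, ‖c x‖ ≤ x.parts.sum + 1) :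
    Summable fun x : Ptn => ‖c x * q ^ x.parts.sum‖ := by
  rw [← ptnEquiv.summable_iff, summable_sigma_of_nonneg (fun _ => by exact norm_nonneg _)]
  refine ⟨fun n => Summable.of_finite, ?_⟩
  have h2 : ‖2 * ‖q‖‖ < 1 := by
    rw [norm_mul, norm_norm, Real.norm_ofNat]; linarith
  have s := (summable_pow_mul_geometric_of_norm_lt_one 1 h2).add
    (summable_geometric_of_norm_lt_one h2)
  refine Summable.of_nonneg_of_le (fun n => tsum_nonneg fun _ => norm_nonneg _) (fun n => ?_) s
  rw [tsum_fintype]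
  refine (Finset.sum_le_card_nsmul Finset.univ _ ((n + 1) * ‖q‖ ^ n) fun π _ => ?_).trans ?_
  · simp only [Function.comp, norm_mul, norm_pow]
    have := hc (ptnEquiv ⟨n, π⟩)
    have e : (ptnEquiv ⟨n, π⟩).parts.sum = n := π.parts_sum
    rw [e] at this ⊢
    gcongr
  · rw [nsmul_eq_mul, Finset.card_univ]
    have : (Fintype.card n.Partition : ℝ) ≤ 2 ^ n := by exact_mod_cast card_partition_le n
    calc _ ≤ (2 : ℝ) ^ n * ((n + 1) * ‖q‖ ^ n) := by gcongr
      _ = _ := by rw [mul_pow]; ring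

lemma tsum_ptn_split {F : Ptn → ℂ} (hF : Summable F) {v : ℕ} (hv : v ≠ 0) :
    ∑' x, F x = ∑' x : Ptn, (if v ∈ x.parts then 0 else F x) + ∑' x : Ptn, F (x.cons v hv) := by
  classical
  have inj : Function.Injective (Ptn.cons v hv) := fun x y h =>
    Ptn.ext ((Multiset.cons_inj_right v).mp (congrArg Ptn.parts h))
  have s1 : Summable fun x : Ptn => if v ∈ x.parts then F x else 0 :=
    (hF.indicator {x | v ∈ x.parts}).congr fun x => by simp [Set.indicator_apply]
  have s2 : Summable fun x : Ptn => if v ∈ x.parts then 0 else F x := by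
    refine (hF.indicator {x | v ∉ x.parts}).congr fun x => ?_
    by_cases h : v ∈ x.parts <;> simp [h]
  have e : ∑' x : Ptn, F (x.cons v hv) = ∑' x : Ptn, if v ∈ x.parts then F x else 0 := by
    rw [← inj.tsum_eq (f := fun x : Ptn => if v ∈ x.parts then F x else 0)]
    · exact tsum_congr fun x => (if_pos (Multiset.mem_cons_self v x.parts)).symm
    · intro x hx
      have hx : v ∈ x.parts := by
        by_contra h
        exact hx (if_neg h)
      exact ⟨⟨x.1.erase v, fun h => x.2 (Multiset.mem_of_mem_erase h)⟩,
        Ptn.ext (Multiset.cons_erase hx)⟩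
  rw [e, ← s2.tsum_add s1]
  exact tsum_congr fun x => by split_ifs <;> simp

end Partitions

section Cranks
variable {q z : ℂ}

/-- the number of parts larger than `w` -/
def bigParts (w : ℕ) (m : Multiset ℕ) : ℕ := Multiset.card (m.filter fun x => w < x)

/-- partitions counted by the number of parts larger than `w` -/
noncomputable def bigGen (q z : ℂ) (w : ℕ) : ℂ :=
  ∑' x : Ptn, z ^ bigParts w x.parts * q ^ x.parts.sum

/-- the generating function of partitions -/
noncomputable def ptnGen (q : ℂ) : ℂ := ∑' x : Ptn, q ^ x.parts.sum

lemma bigParts_cons_of_lt {w v : ℕ} (h : w < v) (m : Multiset ℕ) :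
    bigParts w (v ::ₘ m) = bigParts w m + 1 := by
  simp [bigParts, h]

lemma bigParts_cons_of_le {w v : ℕ} (h : v ≤ w) (m : Multiset ℕ) :
    bigParts w (v ::ₘ m) = bigParts w m := by
  simp [bigParts, h]

lemma bigParts_succ {w : ℕ} {m : Multiset ℕ} (h : w + 1 ∉ m) :
    bigParts (w + 1) m = bigParts w m := by
  unfold bigParts
  congr 1
  refine Multiset.filter_congr fun x hx => ⟨fun h' => by omega, fun h' => ?_⟩
  have : x ≠ w + 1 := fun e => h (e ▸ hx)
  omega

lemma bigParts_eq_zero {w : ℕ} {m : Multiset ℕ} (h : m.sum ≤ w) : bigParts w m = 0 := by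
  rw [bigParts, Multiset.card_eq_zero, Multiset.filter_eq_nil]
  intro a ha
  have := Multiset.le_sum_of_mem ha
  omega

lemma norm_bigParts_le (hz : ‖z‖ ≤ 1) (w : ℕ) (x : Ptn) :
    ‖z ^ bigParts w x.parts‖ ≤ 1 := by
  rw [norm_pow]; exact pow_le_one₀ (norm_nonneg _) hz

lemma summable_bigGen (hq : ‖q‖ < 1 / 2) (hz : ‖z‖ ≤ 1) (w : ℕ) :
    Summable fun x : Ptn => ‖z ^ bigParts w x.parts * q ^ x.parts.sum‖ :=
  summable_ptn hq fun x => (norm_bigParts_le hz w x).trans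
    (le_add_of_nonneg_left (Nat.cast_nonneg _))

lemma summable_ptnGen (hq : ‖q‖ < 1 / 2) : Summable fun x : Ptn => ‖q ^ x.parts.sum‖ := by
  simpa using summable_bigGen hq (z := 1) (by simp) 0

lemma bigGen_avoid (hq : ‖q‖ < 1 / 2) (hz : ‖z‖ ≤ 1) {v w : ℕ} (hv : v ≠ 0) (h : v ≤ w) :
    ∑' x : Ptn, (if v ∈ x.parts then 0 else z ^ bigParts w x.parts * q ^ x.parts.sum) =
      (1 - q ^ v) * bigGen q z w := by
  have := tsum_ptn_split (summable_bigGen hq hz w).of_norm hv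
  have e : ∀ x : Ptn, z ^ bigParts w (x.cons v hv).parts * q ^ (x.cons v hv).parts.sum =
      q ^ v * (z ^ bigParts w x.parts * q ^ x.parts.sum) := by
    intro x
    rw [Ptn.parts_cons, bigParts_cons_of_le h, Multiset.sum_cons, pow_add]
    ring
  rw [tsum_congr e, tsum_mul_left] at this
  rw [bigGen]
  linear_combination -this

lemma bigGen_step (hq : ‖q‖ < 1 / 2) (hz : ‖z‖ ≤ 1) (w : ℕ) :
    (1 - q ^ (w + 1)) * bigGen q z (w + 1) = (1 - z * q ^ (w + 1)) * bigGen q z w := by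
  have := tsum_ptn_split (summable_bigGen hq hz w).of_norm w.succ_ne_zero
  have e : ∀ x : Ptn, z ^ bigParts w (x.cons (w + 1) w.succ_ne_zero).parts *
      q ^ (x.cons (w + 1) w.succ_ne_zero).parts.sum =
      z * q ^ (w + 1) * (z ^ bigParts w x.parts * q ^ x.parts.sum) := by
    intro x
    rw [Ptn.parts_cons, bigParts_cons_of_lt w.lt_succ_self, Multiset.sum_cons, pow_add, pow_succ]
    ring
  rw [tsum_congr e, tsum_mul_left] at this
  rw [← bigGen_avoid hq hz w.succ_ne_zero le_rfl]
  have e2 : ∀ x : Ptn, (if w + 1 ∈ x.parts then 0 else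
      z ^ bigParts (w + 1) x.parts * q ^ x.parts.sum) =
      if w + 1 ∈ x.parts then 0 else z ^ bigParts w x.parts * q ^ x.parts.sum := by
    intro x
    split_ifs with h
    · rfl
    · rw [bigParts_succ h]
  rw [tsum_congr e2]
  rw [bigGen]
  linear_combination -this

lemma bigGen_tendsto (hq : ‖q‖ < 1 / 2) (hz : ‖z‖ ≤ 1) :
    Tendsto (bigGen q z) atTop (𝓝 (ptnGen q)) := by
  refine tendsto_tsum_of_dominated_convergence (summable_ptnGen hq) (fun x => ?_)
    (Eventually.of_forall fun w x => ?_)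
  · refine tendsto_const_nhds.congr' ?_
    filter_upwards [eventually_ge_atTop x.parts.sum] with w hw
    rw [bigParts_eq_zero hw, pow_zero, one_mul]
  · rw [norm_mul]
    exact mul_le_of_le_one_left (norm_nonneg _) (norm_bigParts_le hz w x)

lemma norm_bigGen_le (hq : ‖q‖ < 1 / 2) (hz : ‖z‖ ≤ 1) (w : ℕ) :
    ‖bigGen q z w‖ ≤ ∑' x : Ptn, ‖q ^ x.parts.sum‖ := by
  refine (norm_tsum_le_tsum_norm (summable_bigGen hq hz w)).trans ?_
  refine (summable_bigGen hq hz w).tsum_le_tsum (fun x => ?_) (summable_ptnGen hq)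
  rw [norm_mul]
  exact mul_le_of_le_one_left (norm_nonneg _) (norm_bigParts_le hz w x)

lemma bigGen_prod (hq : ‖q‖ < 1 / 2) (hz : ‖z‖ ≤ 1) (w : ℕ) :
    (∏ i ∈ Finset.range w, (1 - q * q ^ i)) * bigGen q z w =
      (∏ i ∈ Finset.range w, (1 - z * q * q ^ i)) * bigGen q z 0 := by
  induction w with
  | zero => simp
  | succ w ih =>
    rw [Finset.prod_range_succ, Finset.prod_range_succ]
    have := bigGen_step hq hz w
    rw [pow_succ] at this
    linear_combination (1 - z * q * q ^ w) * ih +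
      (∏ i ∈ Finset.range w, (1 - q * q ^ i)) * this

lemma poch_mul_ptnGen (hq : ‖q‖ < 1 / 2) (hz : ‖z‖ ≤ 1) :
    poch q q * ptnGen q = poch (z * q) q * bigGen q z 0 := by
  have hq1 : ‖q‖ < 1 := hq.trans (by norm_num)
  have h1 := (poch_hasProd hq1 q).tendsto_prod_nat.mul (bigGen_tendsto hq hz)
  have h2 := (poch_hasProd hq1 (z * q)).tendsto_prod_nat.mul_const (bigGen q z 0)
  refine tendsto_nhds_unique h1 (h2.congr fun w => ?_)
  exact (bigGen_prod hq hz w).symm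

lemma poch_self_mul_ptnGen (hq : ‖q‖ < 1 / 2) : poch q q * ptnGen q = 1 := by
  rw [poch_mul_ptnGen hq (z := 0) (by simp)]
  have h0 : poch (0 * q) q = 1 := by simp [poch]
  have : bigGen q 0 0 = 1 := by
    rw [bigGen, tsum_eq_single (show Ptn from ⟨0, by simp⟩)]
    · simp [Ptn.parts, bigParts]
    · intro x hx
      have : bigParts 0 x.parts ≠ 0 := by
        rw [bigParts, Ne, Multiset.card_eq_zero, Multiset.filter_eq_nil]
        intro h
        apply hx
        refine Ptn.ext (Multiset.eq_zero_of_forall_notMem fun a ha => ?_)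
        exact x.2 ((Nat.le_zero.mp (not_lt.mp (h a ha))) ▸ ha)
      rw [zero_pow this, zero_mul]
  rw [h0, this, one_mul]

lemma poch_mul_bigGen (hq : ‖q‖ < 1 / 2) (hz : ‖z‖ ≤ 1) :
    poch (z * q) q * bigGen q z 0 = 1 := by
  rw [← poch_mul_ptnGen hq hz, poch_self_mul_ptnGen hq]

/-- the Andrews–Garvan crank of a multiset of parts -/
def mcrank (m : Multiset ℕ) : ℤ :=
  if m.count 1 = 0 then (m.sup : ℤ) else (bigParts (m.count 1) m : ℤ) - (m.count 1 : ℤ)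

/-- ones counted by cranks -/
noncomputable def crankGen (q z : ℂ) : ℂ :=
  ∑' x : Ptn, (x.parts.count 1 : ℂ) * z ^ mcrank x.parts * q ^ x.parts.sum

/-- separating the ones of a partition -/
def onesEquiv : ℕ × {y : Ptn // 1 ∉ y.parts} ≃ Ptn where
  toFun p := ⟨Multiset.replicate p.1 1 + p.2.1.1, fun h => by
    rcases Multiset.mem_add.mp h with h | h
    · exact zero_ne_one (Multiset.eq_of_mem_replicate h)
    · exact p.2.1.2 h⟩
  invFun x := (x.1.count 1, ⟨⟨x.1.filter fun v => v ≠ 1, fun h => x.2 (Multiset.mem_filter.mp h).1⟩,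
    fun h => (Multiset.mem_filter.mp h).2 rfl⟩)
  left_inv := by
    rintro ⟨w, ⟨y, hy0⟩, hy⟩
    have hy : 1 ∉ y := hy
    refine Prod.ext ?_ (Subtype.ext (Subtype.ext ?_))
    · simp [hy]
    · change Multiset.filter (fun v => v ≠ 1) (Multiset.replicate w 1 + y) = y
      rw [Multiset.filter_add, (Multiset.filter_eq_self (s := y) (p := fun v => v ≠ 1)).mpr
        (fun a ha (h : a = 1) => hy (h ▸ ha))]
      simp +contextual [Multiset.filter_eq_nil, Multiset.mem_replicate]
  right_inv := by
    rintro ⟨x, hx⟩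
    refine Subtype.ext ?_
    change Multiset.replicate (x.count 1) 1 + x.filter (fun v => v ≠ 1) = x
    rw [← Multiset.filter_eq', Multiset.filter_add_not]

lemma parts_onesEquiv (p : ℕ × {y : Ptn // 1 ∉ y.parts}) :
    (onesEquiv p).parts = Multiset.replicate p.1 1 + p.2.1.parts := rfl

lemma count_one_le_sum (m : Multiset ℕ) : m.count 1 ≤ m.sum := by
  obtain ⟨t, ht⟩ := Multiset.le_iff_exists_add.mp (Multiset.le_count_iff_replicate_le.mp le_rfl :
    Multiset.replicate (m.count 1) 1 ≤ m)
  have := congrArg Multiset.sum ht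
  rw [Multiset.sum_add, Multiset.sum_replicate, smul_eq_mul, mul_one] at this
  omega

lemma summable_crankGen (hq : ‖q‖ < 1 / 2) (hz : ‖z‖ = 1) :
    Summable fun x : Ptn =>
      ‖(x.parts.count 1 : ℂ) * z ^ mcrank x.parts * q ^ x.parts.sum‖ := by
  refine summable_ptn hq fun x => ?_
  rw [norm_mul, norm_zpow, hz, one_zpow, mul_one, Complex.norm_natCast]
  have : (x.parts.count 1 : ℝ) ≤ x.parts.sum := by exact_mod_cast count_one_le_sum x.parts
  linarith

lemma crankGen_term (hz : z ≠ 0) (p : ℕ × {y : Ptn // 1 ∉ y.parts}) :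
    ((onesEquiv p).parts.count 1 : ℂ) * z ^ mcrank (onesEquiv p).parts *
      q ^ (onesEquiv p).parts.sum =
    p.1 * (q / z) ^ p.1 * (z ^ bigParts p.1 p.2.1.parts * q ^ p.2.1.parts.sum) := by
  obtain ⟨w, y, hy⟩ := p
  have hc : (onesEquiv (w, ⟨y, hy⟩)).parts.count 1 = w := by
    simp [parts_onesEquiv, hy]
  rw [mcrank, hc]
  rcases Nat.eq_zero_or_pos w with rfl | hw
  · simp
  · have hb : bigParts w (Multiset.replicate w 1 + y.parts) = bigParts w y.parts := by
      rw [bigParts, Multiset.filter_add, Multiset.card_add, bigParts]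
      simp [Multiset.filter_eq_nil, Multiset.mem_replicate]
      omega
    rw [if_neg hw.ne', parts_onesEquiv, hb, Multiset.sum_add, Multiset.sum_replicate, smul_eq_mul,
      mul_one, zpow_sub₀ hz, zpow_natCast, zpow_natCast, pow_add, div_pow]
    ring

lemma crankGen_eq (hq : ‖q‖ < 1 / 2) (hz : ‖z‖ = 1) :
    crankGen q z = (1 - q) * ∑' w : ℕ, w * bigGen q z w * (q / z) ^ w := by
  have hz0 : z ≠ 0 := by rintro rfl; simp at hz
  have hs := (summable_crankGen hq hz).of_norm
  have hs' := onesEquiv.summable_iff.mpr hs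
  rw [crankGen, ← onesEquiv.tsum_eq, ← tsum_mul_left]
  refine (Summable.tsum_prod hs').trans (tsum_congr fun w => ?_)
  change ∑' y, ((onesEquiv (w, y)).parts.count 1 : ℂ) * z ^ mcrank (onesEquiv (w, y)).parts *
    q ^ (onesEquiv (w, y)).parts.sum = _
  have e0 : ∑' y, ((onesEquiv (w, y)).parts.count 1 : ℂ) * z ^ mcrank (onesEquiv (w, y)).parts *
      q ^ (onesEquiv (w, y)).parts.sum = w * (q / z) ^ w *
        ∑' y : {y : Ptn // 1 ∉ y.parts}, z ^ bigParts w y.1.parts * q ^ y.1.parts.sum := by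
    rw [← tsum_mul_left]
    exact tsum_congr fun y => crankGen_term hz0 (w, y)
  rw [e0]
  rcases Nat.eq_zero_or_pos w with rfl | hw
  · simp
  have h := bigGen_avoid hq hz.le one_ne_zero hw
  rw [pow_one] at h
  have e : ∑' y : {y : Ptn // 1 ∉ y.parts}, z ^ bigParts w y.1.parts * q ^ y.1.parts.sum =
      (1 - q) * bigGen q z w := by
    rw [← h]
    refine (tsum_subtype {y : Ptn | 1 ∉ y.parts}
      fun y : Ptn => z ^ bigParts w y.parts * q ^ y.parts.sum).trans (tsum_congr fun x => ?_)
    by_cases h1 : 1 ∈ x.parts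
    · rw [if_pos h1, Set.indicator_of_notMem (not_not.mpr h1)]
    · rw [if_neg h1, Set.indicator_of_mem (show x ∈ {y : Ptn | 1 ∉ y.parts} from h1)]
  rw [e]
  ring

end Cranks

section QDifference
variable {q z : ℂ} {a : ℕ → ℂ} {B : ℝ}

/-- the ordinary generating function of a sequence -/
noncomputable def ogf (a : ℕ → ℂ) (x : ℂ) : ℂ := ∑' w : ℕ, a w * x ^ w

lemma summable_norm_ogf (hB : ∀ w, ‖a w‖ ≤ B) {x : ℂ} (hx : ‖x‖ < 1) :
    Summable fun w : ℕ => ‖a w * x ^ w‖ := by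
  refine Summable.of_nonneg_of_le (fun _ => norm_nonneg _) (fun w => ?_)
    ((summable_geometric_of_lt_one (norm_nonneg x) hx).mul_left B)
  rw [norm_mul, norm_pow]
  exact mul_le_mul_of_nonneg_right (hB w) (by positivity)

lemma summable_norm_ogf_mul (hB : ∀ w, ‖a w‖ ≤ B) {x : ℂ} (hx : ‖x‖ < 1) :
    Summable fun w : ℕ => ‖(w * a w) * x ^ w‖ := by
  have hx' : ‖‖x‖‖ < 1 := by rwa [norm_norm]
  refine Summable.of_nonneg_of_le (fun _ => norm_nonneg _) (fun w => ?_)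
    ((summable_pow_mul_geometric_of_norm_lt_one 1 hx').mul_left B)
  rw [norm_mul, norm_mul, norm_pow, Complex.norm_natCast, pow_one]
  have := hB w
  have h : 0 ≤ (w : ℝ) * ‖x‖ ^ w := by positivity
  nlinarith

lemma ogf_tendsto_zero {b : ℕ → ℂ} {x : ℂ} (hs : Summable fun w : ℕ => ‖b w * x ^ w‖)
    (hq1 : ‖q‖ < 1) : Tendsto (fun n : ℕ => ogf b (x * q ^ n)) atTop (𝓝 (b 0)) := by
  have h0 : ∑' w : ℕ, (if w = 0 then b 0 else 0) = b 0 := tsum_ite_eq 0 _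
  rw [← h0]
  refine tendsto_tsum_of_dominated_convergence hs (fun w => ?_) (Eventually.of_forall fun n w => ?_)
  · rcases Nat.eq_zero_or_pos w with rfl | hw
    · simp
    · rw [if_neg hw.ne']
      have h := (((tendsto_pow_atTop_nhds_zero_of_norm_lt_one hq1).const_mul x).pow w).const_mul
        (b w)
      rwa [mul_zero, zero_pow hw.ne', mul_zero] at h
  · rw [mul_pow, ← mul_assoc, norm_mul]
    refine mul_le_of_le_one_right (norm_nonneg _) ?_
    rw [norm_pow, norm_pow]
    exact pow_le_one₀ (by positivity) (pow_le_one₀ (norm_nonneg _) hq1.le)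

lemma ogf_succ {b : ℕ → ℂ} {x : ℂ} (hs : Summable fun w : ℕ => b w * x ^ w) (h0 : b 0 = 0) :
    ogf b x = x * ogf (fun w => b (w + 1)) x := by
  rw [ogf, hs.tsum_eq_zero_add, h0, zero_mul, zero_add, ogf, ← tsum_mul_left]
  exact tsum_congr fun w => by ring

lemma ogf_qdiff (hq1 : ‖q‖ < 1) (hB : ∀ w, ‖a w‖ ≤ B)
    (ha : ∀ w, (1 - q ^ (w + 1)) * a (w + 1) = (1 - z * q ^ (w + 1)) * a w) {x : ℂ}
    (hx : ‖x‖ < 1) : ogf a x * (1 - x) = ogf a (x * q) * (1 - z * q * x) := by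
  have hxq : ‖x * q‖ < 1 := by
    rw [norm_mul]; exact mul_lt_one_of_nonneg_of_lt_one_left (norm_nonneg _) hx hq1.le
  have s1 := (summable_norm_ogf hB hx).of_norm
  have s2 := (summable_norm_ogf hB hxq).of_norm
  have e1 : ogf a x - ogf a (x * q) = ogf (fun w => (1 - q ^ w) * a w) x := by
    rw [ogf, ogf, ← s1.tsum_sub s2]
    exact tsum_congr fun w => by rw [mul_pow]; ring
  have e2 : x * ogf (fun w => (1 - z * q ^ (w + 1)) * a w) x =
      x * ogf a x - z * q * x * ogf a (x * q) := by
    rw [ogf, ogf, ogf, ← tsum_mul_left, ← tsum_mul_left, ← tsum_mul_left,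
      ← (s1.mul_left _).tsum_sub (s2.mul_left _)]
    exact tsum_congr fun w => by rw [mul_pow]; ring
  have e3 : ogf (fun w => (1 - q ^ w) * a w) x =
      x * ogf (fun w => (1 - z * q ^ (w + 1)) * a w) x := by
    rw [ogf_succ (b := fun w => (1 - q ^ w) * a w) _ (by simp)]
    · simp only [ha]
    · exact (s1.sub s2).congr fun w => by rw [mul_pow]; ring
  linear_combination e1 + e3 + e2

lemma ogf_mul_qdiff (hq1 : ‖q‖ < 1) (hB : ∀ w, ‖a w‖ ≤ B)
    (ha : ∀ w, (1 - q ^ (w + 1)) * a (w + 1) = (1 - z * q ^ (w + 1)) * a w) {x : ℂ}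
    (hx : ‖x‖ < 1) : ogf (fun w => w * a w) x * (1 - x) =
      ogf (fun w => w * a w) (x * q) * (1 - z * q * x) + x * ogf a x -
        z * q * x * ogf a (x * q) := by
  have hxq : ‖x * q‖ < 1 := by
    rw [norm_mul]; exact mul_lt_one_of_nonneg_of_lt_one_left (norm_nonneg _) hx hq1.le
  have s1 := (summable_norm_ogf hB hx).of_norm
  have s2 := (summable_norm_ogf hB hxq).of_norm
  have t1 := (summable_norm_ogf_mul hB hx).of_norm
  have t2 := (summable_norm_ogf_mul hB hxq).of_norm
  have e1 : ogf (fun w => w * a w) x - ogf (fun w => w * a w) (x * q) =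
      ogf (fun w => w * ((1 - q ^ w) * a w)) x := by
    rw [ogf, ogf, ← t1.tsum_sub t2]
    exact tsum_congr fun w => by rw [mul_pow]; ring
  have e2 : x * ogf (fun w => ((w + 1 : ℕ) : ℂ) * ((1 - z * q ^ (w + 1)) * a w)) x =
      x * (ogf (fun w => w * a w) x + ogf a x) -
        z * q * x * (ogf (fun w => w * a w) (x * q) + ogf a (x * q)) := by
    rw [ogf, ogf, ogf, ogf, ogf, ← t1.tsum_add s1, ← t2.tsum_add s2, ← tsum_mul_left,
      ← tsum_mul_left, ← tsum_mul_left,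
      ← ((t1.add s1).mul_left _).tsum_sub ((t2.add s2).mul_left _)]
    exact tsum_congr fun w => by rw [mul_pow]; push_cast; ring
  have e3 : ogf (fun w => w * ((1 - q ^ w) * a w)) x =
      x * ogf (fun w => ((w + 1 : ℕ) : ℂ) * ((1 - z * q ^ (w + 1)) * a w)) x := by
    rw [ogf_succ (b := fun w => w * ((1 - q ^ w) * a w)) _ (by simp)]
    · simp only [ha]
    · exact (t1.sub t2).congr fun w => by rw [mul_pow]; ring
  linear_combination e1 + e3 + e2

lemma norm_mul_pow_lt_one (hq1 : ‖q‖ < 1) {x : ℂ} (hx : ‖x‖ < 1) (n : ℕ) : ‖x * q ^ n‖ < 1 := by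
  rw [norm_mul, norm_pow]
  exact mul_lt_one_of_nonneg_of_lt_one_left (norm_nonneg _) hx (pow_le_one₀ (norm_nonneg _) hq1.le)

lemma one_sub_ne_zero_of_norm_lt {x : ℂ} (hx : ‖x‖ < 1) : 1 - x ≠ 0 := by
  intro h
  rw [← sub_eq_zero.mp h, norm_one] at hx
  exact lt_irrefl _ hx

lemma ogf_mul_poch (hq1 : ‖q‖ < 1) (hB : ∀ w, ‖a w‖ ≤ B)
    (ha : ∀ w, (1 - q ^ (w + 1)) * a (w + 1) = (1 - z * q ^ (w + 1)) * a w) {x : ℂ}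
    (hx : ‖x‖ < 1) : ogf a x * poch x q = a 0 * poch (z * q * x) q := by
  have h1 := (poch_hasProd hq1 x).tendsto_prod_nat.const_mul (ogf a x)
  have h2 := (ogf_tendsto_zero (summable_norm_ogf hB hx) hq1).mul
    (poch_hasProd hq1 (z * q * x)).tendsto_prod_nat
  refine tendsto_nhds_unique h1 (h2.congr fun n => ?_)
  induction n with
  | zero => simp
  | succ n ih =>
    rw [Finset.prod_range_succ, Finset.prod_range_succ, ← mul_assoc _ _ (1 - x * q ^ n), ← ih]
    have := ogf_qdiff hq1 hB ha (norm_mul_pow_lt_one hq1 hx n)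
    rw [pow_succ, ← mul_assoc x]
    linear_combination -(∏ i ∈ Finset.range n, (1 - z * q * x * q ^ i)) * this

lemma summable_geom_div (hq1 : ‖q‖ < 1) {x : ℂ} (hx : ‖x‖ < 1) :
    Summable fun n : ℕ => x * q ^ n * (1 - x * q ^ n)⁻¹ := by
  refine Summable.of_norm_bounded
    ((summable_geometric_of_lt_one (norm_nonneg q) hq1).mul_right (1 - ‖x‖)⁻¹) fun n => ?_
  have hle : ‖x * q ^ n‖ ≤ ‖x‖ := by
    rw [norm_mul, norm_pow]
    exact mul_le_of_le_one_right (norm_nonneg _) (pow_le_one₀ (norm_nonneg _) hq1.le)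
  have hlow : 1 - ‖x‖ ≤ ‖1 - x * q ^ n‖ := by
    have := norm_sub_norm_le 1 (x * q ^ n)
    rw [norm_one] at this
    linarith
  have hpos : 0 < 1 - ‖x‖ := sub_pos.mpr hx
  rw [norm_mul, norm_inv]
  refine mul_le_mul ?_ (inv_anti₀ hpos hlow) (by positivity) (by positivity)
  rw [norm_mul, norm_pow]
  exact mul_le_of_le_one_left (by positivity) hx.le

lemma ogf_mul_eq (hq1 : ‖q‖ < 1) (hB : ∀ w, ‖a w‖ ≤ B) (ha0 : a 0 ≠ 0)
    (ha : ∀ w, (1 - q ^ (w + 1)) * a (w + 1) = (1 - z * q ^ (w + 1)) * a w) {x : ℂ}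
    (hx : ‖x‖ < 1) (hzx : ‖z * q * x‖ < 1) :
    ogf (fun w => w * a w) x = ogf a x * (∑' n : ℕ, x * q ^ n * (1 - x * q ^ n)⁻¹ -
      ∑' n : ℕ, z * q * x * q ^ n * (1 - z * q * x * q ^ n)⁻¹) := by
  have hne : ∀ n : ℕ, ogf a (x * q ^ n) ≠ 0 := by
    intro n h
    have := ogf_mul_poch hq1 hB ha (norm_mul_pow_lt_one hq1 hx n)
    rw [h, zero_mul, ← mul_assoc] at this
    exact mul_ne_zero ha0 (poch_ne_zero_of_norm_lt hq1 (norm_mul_pow_lt_one hq1 hzx n)) this.symm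
  have s := (summable_geom_div hq1 hx).sub (summable_geom_div hq1 hzx)
  rw [← (summable_geom_div hq1 hx).tsum_sub (summable_geom_div hq1 hzx)]
  have h1 := s.hasSum.tendsto_sum_nat
  have h2 := (ogf_tendsto_zero (summable_norm_ogf_mul hB hx) hq1).div
    (ogf_tendsto_zero (summable_norm_ogf hB hx) hq1) ha0
  have h3 := h1.add h2
  simp only [Nat.cast_zero, zero_mul, zero_div, add_zero] at h3
  have h4 : Tendsto (fun _ : ℕ => ogf (fun w => w * a w) x / ogf a x) atTop
      (𝓝 (ogf (fun w => w * a w) x / ogf a x)) := tendsto_const_nhds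
  have key := tendsto_nhds_unique (h4.congr fun n => ?_) h3
  · rw [← key, mul_div_cancel₀]
    simpa using hne 0
  · induction n with
    | zero => simp
    | succ n ih =>
      rw [ih, Finset.sum_range_succ, add_assoc]
      congr 1
      have hxn := norm_mul_pow_lt_one hq1 hx n
      have hzn := norm_mul_pow_lt_one hq1 hzx n
      have A := ogf_qdiff hq1 hB ha hxn
      have D := ogf_mul_qdiff hq1 hB ha hxn
      have n1 := hne n
      have n2 := hne (n + 1)
      have m1 := one_sub_ne_zero_of_norm_lt hxn
      have m2 := one_sub_ne_zero_of_norm_lt hzn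
      simp only [Pi.div_apply]
      rw [pow_succ, ← mul_assoc x] at n2 ⊢
      rw [← mul_assoc (z * q)] at A D
      generalize ogf (fun w => w * a w) (x * q ^ n) = d0 at *
      generalize ogf (fun w => w * a w) (x * q ^ n * q) = d1 at *
      generalize ogf a (x * q ^ n) = f0 at *
      generalize ogf a (x * q ^ n * q) = f1 at *
      generalize z * q * x * q ^ n = v at *
      generalize x * q ^ n = u at *
      field_simp
      linear_combination f1 * (1 - v) * D - d1 * (1 - v) * A + v * f1 * A

lemma crankGen_eq_prod (hq0 : q ≠ 0) (hq : ‖q‖ < 1 / 2) (hz : ‖z‖ = 1) :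
    crankGen q z = poch q q / (poch (z * q) q * poch (z⁻¹ * q) q) *
      (∑' n : ℕ, z⁻¹ * q ^ (n + 1) * (1 - z⁻¹ * q ^ (n + 1))⁻¹ -
        ∑' n : ℕ, q ^ (n + 2) * (1 - q ^ (n + 2))⁻¹) := by
  have hz0 : z ≠ 0 := by rintro rfl; simp at hz
  have hq1 : ‖q‖ < 1 := hq.trans (by norm_num)
  have hx : ‖z⁻¹ * q‖ < 1 := by rwa [norm_mul, norm_inv, hz, inv_one, one_mul]
  have hzq : ‖z * q‖ < 1 := by rwa [norm_mul, hz, one_mul]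
  have ezx : z * q * (z⁻¹ * q) = q ^ 2 := by field_simp
  have hq2 : ‖q ^ 2‖ < 1 := by rw [norm_pow]; exact pow_lt_one₀ (norm_nonneg _) hq1 (by norm_num)
  have h0 := poch_mul_bigGen hq hz.le
  have ha0 : bigGen q z 0 ≠ 0 := right_ne_zero_of_mul_eq_one h0
  have hB := norm_bigGen_le hq hz.le
  have ha := bigGen_step hq hz.le
  have h1 := ogf_mul_eq hq1 hB ha0 ha hx (by rwa [ezx])
  have h2 := ogf_mul_poch hq1 hB ha hx
  rw [ezx] at h1 h2
  have h3 := poch_step hq0 hq1 q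
  rw [← pow_two] at h3
  have e : crankGen q z = (1 - q) * ogf (fun w => w * bigGen q z w) (z⁻¹ * q) := by
    rw [crankGen_eq hq hz, ogf, div_eq_inv_mul]
  have n1 := poch_ne_zero_of_norm_lt hq1 hx
  have n2 := poch_ne_zero_of_norm_lt hq1 hzq
  have e2 : (1 - q) * ogf (bigGen q z) (z⁻¹ * q) =
      poch q q / (poch (z * q) q * poch (z⁻¹ * q) q) := by
    rw [eq_div_iff (mul_ne_zero n2 n1), h3]
    linear_combination (1 - q) * poch (z * q) q * h2 + (1 - q) * poch (q ^ 2) q * h0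
  rw [e, h1, ← mul_assoc, e2]
  congr 2 <;> refine tsum_congr fun n => ?_
  · simp only [pow_succ', mul_assoc]
  · rw [← pow_add, add_comm 2 n]

lemma crankGen_sub (hq0 : q ≠ 0) (hq : ‖q‖ < 1 / 2) (hz : ‖z‖ = 1) :
    crankGen q z - crankGen q z⁻¹ =
      -(poch q q / (poch (z * q) q * poch (z⁻¹ * q) q) * lambert z q) := by
  have hq1 : ‖q‖ < 1 := hq.trans (by norm_num)
  have hz' : ‖z⁻¹‖ = 1 := by rw [norm_inv, hz, inv_one]
  have s : ∀ y : ℂ, ‖y‖ = 1 →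
      Summable fun n : ℕ => y * q ^ (n + 1) * (1 - y * q ^ (n + 1))⁻¹ := by
    intro y hy
    refine (summable_geom_div hq1 (x := y * q) (by rwa [norm_mul, hy, one_mul])).congr fun n => ?_
    simp only [pow_succ', mul_assoc]
  rw [crankGen_eq_prod hq0 hq hz, crankGen_eq_prod hq0 hq hz', inv_inv, lambert,
    (s z hz).tsum_sub (s _ hz'), mul_comm (poch (z⁻¹ * q) q)]
  ring

end QDifference

section Ranks
variable {q : ℂ}

/-- the rank of a multiset of parts -/
def mrank (m : Multiset ℕ) : ℤ := (m.sup : ℤ) - (Multiset.card m : ℤ)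

/-- remove the first column of a Ferrers diagram and insert it, lengthened by `r`, as a row -/
def dysonDown (r : ℕ) (x : Multiset ℕ) : Multiset ℕ :=
  (Multiset.card x + r) ::ₘ (x.map Nat.pred).filter (· ≠ 0)

/-- remove the largest row of a Ferrers diagram and insert it, shortened by `r`, as a column -/
def dysonUp (r : ℕ) (y : Multiset ℕ) : Multiset ℕ :=
  (y.erase y.sup).map Nat.succ + Multiset.replicate (y.sup + 1 - r - Multiset.card y) 1

lemma sup_mem_of_ne_zero {y : Multiset ℕ} (hy : y ≠ 0) : y.sup ∈ y := by
  induction y using Multiset.induction with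
  | empty => exact absurd rfl hy
  | cons a s ih =>
    rw [Multiset.sup_cons]
    rcases le_total a s.sup with h | h
    · rw [sup_eq_right.mpr h]
      rcases eq_or_ne s 0 with rfl | hs
      · simpa [eq_comm] using h
      · exact Multiset.mem_cons_of_mem (ih hs)
    · rw [sup_eq_left.mpr h]
      exact Multiset.mem_cons_self a s

lemma map_succ_pred {x : Multiset ℕ} (hx : 0 ∉ x) :
    ((x.map Nat.pred).filter (· ≠ 0)).map Nat.succ + Multiset.replicate (x.count 1) 1 = x ∧
    Multiset.card ((x.map Nat.pred).filter (· ≠ 0)) + x.count 1 = Multiset.card x ∧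
    ((x.map Nat.pred).filter (· ≠ 0)).sum + Multiset.card x = x.sum := by
  induction x using Multiset.induction with
  | empty => simp
  | cons a s ih =>
    have ha : a ≠ 0 := fun h => hx (h ▸ Multiset.mem_cons_self a s)
    obtain ⟨h1, h2, h3⟩ := ih fun h => hx (Multiset.mem_cons_of_mem h)
    obtain ⟨b, rfl⟩ := Nat.exists_eq_succ_of_ne_zero ha
    rcases Nat.eq_zero_or_pos b with rfl | hb
    · refine ⟨?_, ?_, ?_⟩
      · simp only [Multiset.map_cons, Nat.pred_succ, ne_eq, not_true_eq_false, not_false_eq_true,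
          Multiset.filter_cons_of_neg, Multiset.count_cons_self, Nat.succ_eq_add_one, zero_add,
          Multiset.replicate_succ, Multiset.add_cons]
        exact congrArg _ h1
      · simp at h2 ⊢
        omega
      · simp at h3 ⊢
        omega
    · have hf : ((b ::ₘ s.map Nat.pred).filter (· ≠ 0)) = b ::ₘ (s.map Nat.pred).filter (· ≠ 0) :=
        Multiset.filter_cons_of_pos (p := (· ≠ 0)) _ hb.ne'
      have h1b : 1 ≠ b + 1 := by omega
      refine ⟨?_, ?_, ?_⟩
      · rw [Multiset.map_cons, Nat.pred_succ, hf, Multiset.map_cons,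
          Multiset.count_cons_of_ne h1b, Multiset.cons_add, h1]
      · rw [Multiset.map_cons, Nat.pred_succ, hf,
          Multiset.count_cons_of_ne h1b, Multiset.card_cons, Multiset.card_cons]
        omega
      · rw [Multiset.map_cons, Nat.pred_succ, hf,
          Multiset.sum_cons, Multiset.sum_cons, Multiset.card_cons]
        omega

lemma sup_dysonDown {r : ℕ} {x : Multiset ℕ} (h : x.sup ≤ Multiset.card x + r + 1) :
    (dysonDown r x).sup = Multiset.card x + r := by
  rw [dysonDown, Multiset.sup_cons, sup_eq_left, Multiset.sup_le]
  intro b hb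
  obtain ⟨a, ha, rfl⟩ := Multiset.mem_map.mp (Multiset.mem_filter.mp hb).1
  have := Multiset.le_sup ha
  rw [Nat.pred_eq_sub_one]
  omega

lemma dysonUp_dysonDown {r : ℕ} {x : Multiset ℕ} (hx : 0 ∉ x)
    (h : x.sup ≤ Multiset.card x + r + 1) : dysonUp r (dysonDown r x) = x := by
  obtain ⟨h1, h2, -⟩ := map_succ_pred hx
  rw [dysonUp, sup_dysonDown h, dysonDown, Multiset.erase_cons_head, Multiset.card_cons]
  conv_rhs => rw [← h1]
  congr 2
  omega

lemma mrank_dysonDown {r : ℕ} {x : Multiset ℕ} (hx : 0 ∉ x)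
    (h : x.sup ≤ Multiset.card x + r + 1) : (r : ℤ) - 1 ≤ mrank (dysonDown r x) := by
  obtain ⟨-, h2, -⟩ := map_succ_pred hx
  rw [mrank, sup_dysonDown h, dysonDown, Multiset.card_cons]
  omega

lemma sum_dysonDown {r : ℕ} {x : Multiset ℕ} (hx : 0 ∉ x) :
    (dysonDown r x).sum = x.sum + r := by
  obtain ⟨-, -, h3⟩ := map_succ_pred hx
  rw [dysonDown, Multiset.sum_cons]
  omega

lemma zero_notMem_dysonDown {r : ℕ} (hr : r ≠ 0) (x : Multiset ℕ) : 0 ∉ dysonDown r x := by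
  intro h
  rcases Multiset.mem_cons.mp h with h | h
  · omega
  · exact (Multiset.mem_filter.mp h).2 rfl

lemma zero_notMem_dysonUp (r : ℕ) (y : Multiset ℕ) : 0 ∉ dysonUp r y := by
  intro h
  rcases Multiset.mem_add.mp h with h | h
  · obtain ⟨a, -, ha⟩ := Multiset.mem_map.mp h
    exact Nat.succ_ne_zero a ha
  · exact zero_ne_one (Multiset.eq_of_mem_replicate h)

lemma card_dysonUp {r : ℕ} {y : Multiset ℕ} (hy : y ≠ 0)
    (h : r + Multiset.card y ≤ y.sup + 1) : Multiset.card (dysonUp r y) + r = y.sup := by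
  have hm := sup_mem_of_ne_zero hy
  have hc : 0 < Multiset.card y := Multiset.card_pos.mpr hy
  rw [dysonUp, Multiset.card_add, Multiset.card_map, Multiset.card_erase_of_mem hm,
    Multiset.card_replicate, Nat.pred_eq_sub_one]
  omega

lemma sup_dysonUp (r : ℕ) (y : Multiset ℕ) : (dysonUp r y).sup ≤ y.sup + 1 := by
  rw [Multiset.sup_le]
  intro b hb
  rcases Multiset.mem_add.mp hb with h | h
  · obtain ⟨a, ha, rfl⟩ := Multiset.mem_map.mp h
    exact Nat.succ_le_succ (Multiset.le_sup (Multiset.mem_of_mem_erase ha))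
  · rw [Multiset.eq_of_mem_replicate h]
    omega

lemma dysonDown_dysonUp {r : ℕ} {y : Multiset ℕ} (hy0 : 0 ∉ y) (hy : y ≠ 0)
    (h : r + Multiset.card y ≤ y.sup + 1) : dysonDown r (dysonUp r y) = y := by
  have hm := sup_mem_of_ne_zero hy
  have hf : (y.erase y.sup).filter (· ≠ 0) = y.erase y.sup :=
    Multiset.filter_eq_self.mpr fun a ha (h0 : a = 0) =>
      hy0 (h0 ▸ Multiset.mem_of_mem_erase ha)
  have e : ((dysonUp r y).map Nat.pred).filter (· ≠ 0) = y.erase y.sup := by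
    rw [dysonUp, Multiset.map_add, Multiset.map_map, Multiset.map_replicate, Multiset.filter_add]
    have : (y.erase y.sup).map (Nat.pred ∘ Nat.succ) = y.erase y.sup := by
      simp
    rw [this, hf]
    simp +contextual [Multiset.filter_eq_nil, Multiset.mem_replicate]
  rw [dysonDown, card_dysonUp hy h, e, Multiset.cons_erase hm]

/-- partitions of rank at least `s` -/
noncomputable def rankGen (q : ℂ) (s : ℤ) : ℂ :=
  ∑' x : Ptn, if s ≤ mrank x.parts then q ^ x.parts.sum else 0

lemma summable_ite_ptn (hq : ‖q‖ < 1 / 2) (P : Ptn → Prop) [DecidablePred P] :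
    Summable fun x : Ptn => if P x then q ^ x.parts.sum else 0 := by
  refine Summable.of_norm_bounded (summable_ptnGen hq) fun x => ?_
  split_ifs
  · exact le_rfl
  · rw [norm_zero]; exact norm_nonneg _

lemma rankGen_dyson (hq : ‖q‖ < 1 / 2) (s : ℕ) (hs : s ≠ 0) :
    rankGen q s = q ^ (s + 1) * (ptnGen q - rankGen q ((s + 3 : ℕ) : ℤ)) := by
  have cond : ∀ x : Ptn, mrank x.parts < ((s + 3 : ℕ) : ℤ) →
      x.parts.sup ≤ Multiset.card x.parts + (s + 1) + 1 := by
    intro x hx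
    rw [mrank] at hx
    push_cast at hx
    omega
  have e1 : ptnGen q - rankGen q ((s + 3 : ℕ) : ℤ) =
      ∑' x : Ptn, if mrank x.parts < ((s + 3 : ℕ) : ℤ) then q ^ x.parts.sum else 0 := by
    rw [ptnGen, rankGen, ← (summable_ptnGen hq).of_norm.tsum_sub (summable_ite_ptn hq _)]
    refine tsum_congr fun x => ?_
    rcases lt_or_ge (mrank x.parts) ((s + 3 : ℕ) : ℤ) with h | h
    · rw [if_neg (not_le.mpr h), if_pos h, sub_zero]
    · rw [if_pos h, if_neg (not_lt.mpr h), sub_self]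
  have inj1 : Function.Injective
      (Subtype.val : {x : Ptn // mrank x.parts < ((s + 3 : ℕ) : ℤ)} → Ptn) := Subtype.val_injective
  let g : {x : Ptn // mrank x.parts < ((s + 3 : ℕ) : ℤ)} → Ptn := fun x =>
    ⟨dysonDown (s + 1) x.1.parts, zero_notMem_dysonDown (Nat.succ_ne_zero s) _⟩
  have inj2 : Function.Injective g := by
    intro x y h
    have h : dysonDown (s + 1) x.1.parts = dysonDown (s + 1) y.1.parts := congrArg Ptn.parts h
    have := congrArg (dysonUp (s + 1)) h
    rw [dysonUp_dysonDown (x := x.1.parts) x.1.2 (cond _ x.2),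
      dysonUp_dysonDown (x := y.1.parts) y.1.2 (cond _ y.2)] at this
    exact Subtype.ext (Ptn.ext this)
  rw [e1, ← tsum_mul_left, rankGen, ← inj2.tsum_eq
    (f := fun x : Ptn => if (s : ℤ) ≤ mrank x.parts then q ^ x.parts.sum else 0), ← inj1.tsum_eq
    (f := fun x : Ptn => q ^ (s + 1) *
      if mrank x.parts < ((s + 3 : ℕ) : ℤ) then q ^ x.parts.sum else 0)]
  · refine tsum_congr fun x => ?_
    have h1 : (s : ℤ) ≤ mrank (g x).parts := by
      have := mrank_dysonDown (r := s + 1) x.1.2 (cond _ x.2)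
      push_cast at this
      rw [add_sub_cancel_right] at this
      exact this
    have h2 : (g x).parts.sum = x.1.parts.sum + (s + 1) := sum_dysonDown x.1.2
    rw [if_pos h1, if_pos x.2, h2, pow_add, mul_comm]
  · intro x hx
    by_contra h
    refine hx ?_
    have : ¬ mrank x.parts < ((s + 3 : ℕ) : ℤ) := fun h' => h ⟨⟨x, h'⟩, rfl⟩
    change _ * (if _ then _ else _) = _
    rw [if_neg this, mul_zero]
  · intro y hy
    have h1 : (s : ℤ) ≤ mrank y.parts := by
      by_contra h
      exact hy (if_neg h)
    rw [mrank] at h1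
    have hy0 : y.parts ≠ 0 := by
      intro h
      rw [h] at h1
      simp at h1
      omega
    have h2 : s + 1 + Multiset.card y.parts ≤ y.parts.sup + 1 := by omega
    have h3 : mrank (dysonUp (s + 1) y.parts) < ((s + 3 : ℕ) : ℤ) := by
      have := card_dysonUp hy0 h2
      have := sup_dysonUp (s + 1) y.parts
      rw [mrank]
      push_cast
      omega
    exact ⟨⟨⟨dysonUp (s + 1) y.parts, zero_notMem_dysonUp _ _⟩, h3⟩,
      Ptn.ext (dysonDown_dysonUp y.2 hy0 h2)⟩

lemma norm_rankGen_le (hq : ‖q‖ < 1 / 2) (s : ℤ) :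
    ‖rankGen q s‖ ≤ ∑' x : Ptn, ‖q ^ x.parts.sum‖ := by
  refine tsum_of_norm_bounded (summable_ptnGen hq).hasSum fun x => ?_
  split_ifs
  · exact le_rfl
  · rw [norm_zero]; exact norm_nonneg _

/-- the coefficients of Dyson's rank generating function -/
noncomputable def dysonCoeff (q : ℂ) (j : ℕ) : ℂ :=
  (-1) ^ j * q ^ (3 * ∑ i ∈ Finset.range (j + 1), i + (j + 1))

lemma dysonCoeff_zero : dysonCoeff q 0 = q := by simp [dysonCoeff]

lemma dysonCoeff_succ (j : ℕ) : dysonCoeff q (j + 1) = -q ^ (3 * j + 4) * dysonCoeff q j := by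
  rw [dysonCoeff, dysonCoeff, Finset.sum_range_succ _ (j + 1)]
  ring

lemma norm_dysonCoeff_le (hq : ‖q‖ < 1) (j : ℕ) : ‖dysonCoeff q j‖ ≤ ‖q‖ ^ (j + 1) := by
  rw [dysonCoeff, norm_mul, norm_pow, norm_neg, norm_one, one_pow, one_mul, norm_pow]
  exact pow_le_pow_of_le_one (norm_nonneg _) hq.le (Nat.le_add_left _ _)

lemma norm_dysonCoeff_mul_le (hq : ‖q‖ < 1) (j s : ℕ) :
    ‖dysonCoeff q j * (q ^ (j + 1)) ^ s‖ ≤ ‖q‖ ^ (j + 1) := by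
  rw [norm_mul]
  refine (mul_le_of_le_one_right (norm_nonneg _) ?_).trans (norm_dysonCoeff_le hq j)
  rw [norm_pow, norm_pow]
  exact pow_le_one₀ (by positivity) (pow_le_one₀ (norm_nonneg _) hq.le)

lemma summable_pow_succ (hq : ‖q‖ < 1) : Summable fun j : ℕ => ‖q‖ ^ (j + 1) :=
  (summable_nat_add_iff 1).mpr (summable_geometric_of_lt_one (norm_nonneg q) hq)

lemma summable_dysonCoeff (hq : ‖q‖ < 1) (s : ℕ) :
    Summable fun j : ℕ => dysonCoeff q j * (q ^ (j + 1)) ^ s :=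
  Summable.of_norm_bounded (summable_pow_succ hq) fun j => norm_dysonCoeff_mul_le hq j s

lemma dysonCoeff_tsum_eq (hq : ‖q‖ < 1) (s : ℕ) :
    ∑' j : ℕ, dysonCoeff q j * (q ^ (j + 1)) ^ s =
      q ^ (s + 1) * (1 - ∑' j : ℕ, dysonCoeff q j * (q ^ (j + 1)) ^ (s + 3)) := by
  rw [(summable_dysonCoeff hq s).tsum_eq_zero_add, dysonCoeff_zero, mul_sub, ← tsum_mul_left,
    sub_eq_add_neg, ← tsum_neg]
  congr 1
  · ring
  · refine tsum_congr fun j => ?_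
    rw [dysonCoeff_succ]
    ring

lemma rankGen_eq (hq : ‖q‖ < 1 / 2) {s : ℕ} (hs : s ≠ 0) :
    rankGen q s = ptnGen q * ∑' j : ℕ, dysonCoeff q j * (q ^ (j + 1)) ^ s := by
  have hq1 : ‖q‖ < 1 := hq.trans (by norm_num)
  set E : ℕ → ℂ := fun s =>
    rankGen q s - ptnGen q * ∑' j : ℕ, dysonCoeff q j * (q ^ (j + 1)) ^ s with hE
  set C := (∑' x : Ptn, ‖q ^ x.parts.sum‖) + ‖ptnGen q‖ * ∑' j : ℕ, ‖q‖ ^ (j + 1) with hC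
  have hb : ∀ s, ‖E s‖ ≤ C := by
    intro s
    refine (norm_sub_le _ _).trans (add_le_add (norm_rankGen_le hq _) ?_)
    rw [norm_mul]
    exact mul_le_mul_of_nonneg_left (tsum_of_norm_bounded (summable_pow_succ hq1).hasSum
      fun j => norm_dysonCoeff_mul_le hq1 j s) (norm_nonneg _)
  have C0 : 0 ≤ C := (norm_nonneg _).trans (hb 0)
  have step : ∀ s, s ≠ 0 → E s = -q ^ (s + 1) * E (s + 3) := by
    intro s hs
    simp only [hE]
    rw [rankGen_dyson hq s hs, dysonCoeff_tsum_eq hq1 s]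
    ring
  have key : ∀ n : ℕ, ∀ s, s ≠ 0 → ‖E s‖ ≤ ‖q‖ ^ n * C := by
    intro n
    induction n with
    | zero => intro s _; simpa using hb s
    | succ n ih =>
      intro s hs
      rw [step s hs, norm_mul, norm_neg, norm_pow, pow_succ' _ n, mul_assoc]
      have h1 : ‖q‖ ^ (s + 1) ≤ ‖q‖ := pow_le_of_le_one (norm_nonneg _) hq1.le (by omega)
      exact mul_le_mul h1 (ih (s + 3) (by omega)) (norm_nonneg _) (norm_nonneg _)
  have lim : Tendsto (fun n : ℕ => ‖q‖ ^ n * C) atTop (𝓝 (0 * C)) :=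
    (tendsto_pow_atTop_nhds_zero_of_lt_one (norm_nonneg _) hq1).mul_const C
  rw [zero_mul] at lim
  have h0 : ‖E s‖ ≤ 0 := ge_of_tendsto' lim fun n => key n s hs
  exact sub_eq_zero.mp (norm_le_zero_iff.mp h0)

end Ranks

section RankWeights
variable {q : ℂ}

/-- the positive ranks that are `±1` modulo five, with sign -/
def rankWeight (k : ℤ) : ℤ :=
  if 0 < k then (if k % 5 = 1 then k else if k % 5 = 4 then -k else 0) else 0

lemma abs_rankWeight_le (k : ℤ) : |rankWeight k| ≤ |k| := by
  unfold rankWeight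
  split_ifs <;> simp

lemma hasSum_rankWeight {x : ℂ} (hx : ‖x‖ < 1) :
    HasSum (fun k : ℕ => (rankWeight k : ℂ) * x ^ k) (ffun x) := by
  have hx5 : ‖x ^ 5‖ < 1 := by rw [norm_pow]; exact pow_lt_one₀ (norm_nonneg _) hx (by norm_num)
  have g0 := hasSum_geometric_of_norm_lt_one hx5
  have g1 := hasSum_coe_mul_geometric_of_norm_lt_one hx5
  have inj : ∀ r : ℕ, Function.Injective fun i : ℕ => 5 * i + r := fun r a b h => by
    have h : 5 * a + r = 5 * b + r := h
    omega
  have part : ∀ r : ℕ, r < 5 → HasSum (fun k : ℕ => if k % 5 = r then (k : ℂ) * x ^ k else 0)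
      (x ^ r * (5 * (x ^ 5 / (1 - x ^ 5) ^ 2) + r * (1 - x ^ 5)⁻¹)) := by
    intro r hr
    rw [← (inj r).hasSum_iff]
    · refine (((g1.mul_left 5).add (g0.mul_left (r : ℂ))).mul_left (x ^ r)).congr_fun fun i => ?_
      have : (5 * i + r) % 5 = r := by omega
      change (if (5 * i + r) % 5 = r then ((5 * i + r : ℕ) : ℂ) * x ^ (5 * i + r) else 0) = _
      rw [if_pos this, pow_add, pow_mul]
      push_cast
      ring
    · intro k hk
      refine if_neg fun h => hk ⟨k / 5, ?_⟩
      change 5 * (k / 5) + r = k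
      omega
  have h := (part 1 (by norm_num)).sub (part 4 (by norm_num))
  have val : ffun x = x ^ 1 * (5 * (x ^ 5 / (1 - x ^ 5) ^ 2) + (1 : ℕ) * (1 - x ^ 5)⁻¹) -
      x ^ 4 * (5 * (x ^ 5 / (1 - x ^ 5) ^ 2) + (4 : ℕ) * (1 - x ^ 5)⁻¹) := by
    have n5 := one_sub_ne_zero_of_norm_lt hx5
    have e : 1 - x ^ 5 = (1 - x) * (1 + x + x ^ 2 + x ^ 3 + x ^ 4) := by ring
    have n4 : 1 + x + x ^ 2 + x ^ 3 + x ^ 4 ≠ 0 := fun h => n5 (by rw [e, h, mul_zero])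
    have n1 := one_sub_ne_zero_of_norm_lt hx
    rw [ffun, e]
    field_simp
    push_cast
    ring
  rw [val]
  refine h.congr_fun fun k => ?_
  unfold rankWeight
  have c1 : (k : ℤ) % 5 = 1 ↔ k % 5 = 1 := by omega
  have c4 : (k : ℤ) % 5 = 4 ↔ k % 5 = 4 := by omega
  rcases Nat.eq_zero_or_pos k with rfl | hk
  · simp
  · rw [if_pos (by exact_mod_cast hk)]
    simp only [c1, c4]
    by_cases h1 : k % 5 = 1
    · simp [h1]
    · by_cases h4 : k % 5 = 4
      · simp [h4]
      · simp [h1, h4]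

lemma abs_mrank_le (x : Ptn) : |mrank x.parts| ≤ x.parts.sum := by
  have h1 : x.parts.sup ≤ x.parts.sum := Multiset.sup_le.mpr fun b hb => Multiset.le_sum_of_mem hb
  have h2 : Multiset.card x.parts ≤ x.parts.sum := by
    have := Multiset.card_nsmul_le_sum (s := x.parts) (a := 1) fun b hb =>
      Nat.one_le_iff_ne_zero.mpr fun h => x.2 (h ▸ hb)
    simpa using this
  rw [mrank, abs_le]
  constructor <;> omega

lemma summable_rankWeight (hq : ‖q‖ < 1 / 2) :
    Summable fun x : Ptn => ‖(rankWeight (mrank x.parts) : ℂ) * q ^ x.parts.sum‖ := by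
  refine summable_ptn hq fun x => ?_
  have := (abs_rankWeight_le (mrank x.parts)).trans (abs_mrank_le x)
  rw [Complex.norm_intCast]
  have : |(rankWeight (mrank x.parts) : ℝ)| ≤ ((x.parts.sum : ℤ) : ℝ) := by
    rw [← Int.cast_abs]
    exact Int.cast_le.mpr this
  rw [Int.cast_natCast] at this
  linarith

lemma rankGen_sub (hq : ‖q‖ < 1 / 2) (k : ℤ) :
    rankGen q k - rankGen q (k + 1) =
      ∑' x : Ptn, if mrank x.parts = k then q ^ x.parts.sum else 0 := by
  rw [rankGen, rankGen, ← (summable_ite_ptn hq _).tsum_sub (summable_ite_ptn hq _)]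
  refine tsum_congr fun x => ?_
  rcases lt_trichotomy (mrank x.parts) k with h | h | h
  · rw [if_neg (by omega), if_neg (by omega), if_neg (by omega), sub_zero]
  · rw [if_pos (by omega), if_neg (by omega), if_pos h, sub_zero]
  · rw [if_pos (by omega), if_pos (by omega), if_neg (by omega), sub_self]

lemma hasSum_rankWeight_rankGen (hq : ‖q‖ < 1 / 2) :
    HasSum (fun k : ℕ => (rankWeight k : ℂ) * (rankGen q k - rankGen q ((k + 1 : ℕ) : ℤ)))
      (∑' x : Ptn, (rankWeight (mrank x.parts) : ℂ) * q ^ x.parts.sum) := by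
  have h := (summable_rankWeight hq).of_norm.hasSum.tsum_fiberwise fun x : Ptn => mrank x.parts
  rw [← Nat.cast_injective (R := ℤ).hasSum_iff] at h
  · refine h.congr_fun fun k => ?_
    have e := rankGen_sub hq (k : ℤ)
    push_cast
    rw [e, ← tsum_mul_left]
    change _ = ∑' x : (fun x : Ptn => mrank x.parts) ⁻¹' {(k : ℤ)},
      (rankWeight (mrank x.1.parts) : ℂ) * q ^ x.1.parts.sum
    have mem : ∀ x : Ptn, x ∈ (fun x : Ptn => mrank x.parts) ⁻¹' {(k : ℤ)} ↔ mrank x.parts = k :=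
      fun x => Iff.rfl
    rw [tsum_subtype ((fun x : Ptn => mrank x.parts) ⁻¹' {(k : ℤ)})
      fun x : Ptn => (rankWeight (mrank x.parts) : ℂ) * q ^ x.parts.sum]
    refine tsum_congr fun x => ?_
    by_cases hx : mrank x.parts = k
    · rw [if_pos hx, Set.indicator_of_mem ((mem x).mpr hx), hx]
    · rw [if_neg hx, Set.indicator_of_notMem (mt (mem x).mp hx), mul_zero]
  · intro k hk
    have hk0 : ¬ 0 < k := fun h => hk ⟨k.toNat, by simp [h.le]⟩
    refine (tsum_congr fun x : ↑((fun x : Ptn => mrank x.parts) ⁻¹' {k}) => ?_).trans tsum_zero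
    have hx : mrank x.1.parts = k := x.2
    rw [hx, rankWeight, if_neg hk0, Int.cast_zero, zero_mul]

lemma tsum_rankWeight (hq : ‖q‖ < 1 / 2) :
    ∑' x : Ptn, (rankWeight (mrank x.parts) : ℂ) * q ^ x.parts.sum =
      ptnGen q * ∑' j : ℕ, dysonCoeff q j * (1 - q ^ (j + 1)) * ffun (q ^ (j + 1)) := by
  have hq1 : ‖q‖ < 1 := hq.trans (by norm_num)
  have hqj : ∀ j : ℕ, ‖q ^ (j + 1)‖ < 1 := fun j => by
    rw [norm_pow]; exact pow_lt_one₀ (norm_nonneg _) hq1 (by simp)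
  set F : ℕ → ℕ → ℂ := fun k j =>
    (rankWeight k : ℂ) * (dysonCoeff q j * (1 - q ^ (j + 1)) * (q ^ (j + 1)) ^ k) with hF
  have sF : Summable (Function.uncurry F) := by
    have hq' : ‖‖q‖‖ < 1 := by rwa [norm_norm]
    have s1 := (summable_pow_mul_geometric_of_norm_lt_one 1 hq').mul_of_nonneg
      ((summable_pow_succ hq1).mul_left 2) (fun k => by positivity) (fun j => by positivity)
    refine Summable.of_norm_bounded s1 ?_
    rintro ⟨k, j⟩
    simp only [Function.uncurry_apply_pair, hF, pow_one]
    have b1 : ‖(rankWeight k : ℂ)‖ ≤ k := by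
      rw [Complex.norm_intCast]
      have := abs_rankWeight_le k
      rw [Nat.abs_cast] at this
      exact_mod_cast this
    have b2 := norm_dysonCoeff_le hq1 j
    have b3 : ‖1 - q ^ (j + 1)‖ ≤ 2 := by
      refine (norm_sub_le _ _).trans ?_
      rw [norm_one]
      linarith [hqj j]
    have b4 : ‖(q ^ (j + 1)) ^ k‖ ≤ ‖q‖ ^ k := by
      rw [norm_pow]
      refine pow_le_pow_left₀ (norm_nonneg _) ?_ k
      rw [norm_pow]
      exact pow_le_of_le_one (norm_nonneg _) hq1.le (by simp)
    rw [norm_mul, norm_mul, norm_mul]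
    calc _ ≤ (k : ℝ) * (‖q‖ ^ (j + 1) * 2 * ‖q‖ ^ k) := by gcongr
      _ = _ := by ring
  rw [← (hasSum_rankWeight_rankGen hq).tsum_eq]
  have e1 : ∀ k : ℕ, (rankWeight k : ℂ) * (rankGen q k - rankGen q ((k + 1 : ℕ) : ℤ)) =
      ptnGen q * ∑' j, F k j := by
    intro k
    rcases Nat.eq_zero_or_pos k with rfl | hk
    · simp [hF, rankWeight]
    · rw [rankGen_eq hq hk.ne', rankGen_eq hq (s := k + 1) (Nat.succ_ne_zero k), ← mul_sub,
        ← (summable_dysonCoeff hq1 _).tsum_sub (summable_dysonCoeff hq1 _), mul_left_comm,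
        ← tsum_mul_left]
      congr 1
      refine tsum_congr fun j => ?_
      simp only [hF]
      rw [pow_succ (q ^ (j + 1))]
      ring
  rw [tsum_congr e1, tsum_mul_left, ← sF.tsum_comm]
  congr 1
  refine tsum_congr fun j => ?_
  rw [← (hasSum_rankWeight (hqj j)).tsum_eq, ← tsum_mul_left]
  refine tsum_congr fun k => ?_
  simp only [hF]
  ring

lemma gv_cube_pos (hq : q ≠ 0) (j : ℕ) :
    gv q ((j : ℤ) + 1) ^ 3 * q⁻¹ ^ ((j : ℤ) + 1) = -(dysonCoeff q j * q ^ (j + 1)) := by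
  induction j with
  | zero =>
    rw [dysonCoeff_zero]
    simp [gv_one]
    field_simp
  | succ j ih =>
    have h := gv_succ hq ((j : ℤ) + 1)
    push_cast
    rw [h, zpow_add_one₀ (inv_ne_zero hq) ((j : ℤ) + 1), dysonCoeff_succ]
    have e : gv q ((j : ℤ) + 1) ^ 3 * q⁻¹ ^ ((j : ℤ) + 1) * (-q ^ ((j : ℤ) + 1 + 1)) ^ 3 * q⁻¹ =
      -(dysonCoeff q j * q ^ (j + 1)) * (-q ^ ((j : ℤ) + 1 + 1)) ^ 3 * q⁻¹ := by rw [ih]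
    have z : q ^ ((j : ℤ) + 1 + 1) = q ^ (j + 2) := by
      rw [← zpow_natCast]; congr 1
    rw [z] at e ⊢
    have z2 : (q ^ (j + 2)) ^ 3 * q⁻¹ = q ^ (3 * j + 4) * q := by
      field_simp
      ring
    linear_combination e + dysonCoeff q j * q ^ (j + 1) * z2

lemma ffun_inv {x : ℂ} (hx : x ≠ 0) : ffun x⁻¹ = -ffun x := by
  have e : 1 + x⁻¹ + x⁻¹ ^ 2 + x⁻¹ ^ 3 + x⁻¹ ^ 4 = (1 + x + x ^ 2 + x ^ 3 + x ^ 4) * x⁻¹ ^ 4 := by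
    field_simp
    ring
  rw [ffun, ffun, e, mul_pow, ← neg_div]
  generalize 1 + x + x ^ 2 + x ^ 3 + x ^ 4 = d
  rw [div_mul_eq_div_div_swap]
  congr 1
  field_simp
  ring

lemma dmock_eq (hq : q ≠ 0) (hq1 : ‖q‖ < 1) :
    dmock q = ∑' j : ℕ, dysonCoeff q j * (1 - q ^ (j + 1)) * ffun (q ^ (j + 1)) := by
  have hqj : ∀ j : ℕ, ‖q ^ (j + 1)‖ ≤ ‖q‖ := fun j => by
    rw [norm_pow]; exact pow_le_of_le_one (norm_nonneg _) hq1.le (by simp)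
  have hq' : ‖‖q‖‖ < 1 := by rwa [norm_norm]
  have hK := (summable_pow_mul_geometric_of_norm_lt_one 1 hq').hasSum
  set K := ∑' k : ℕ, (k : ℝ) ^ 1 * ‖q‖ ^ k with hKdef
  have bf : ∀ j : ℕ, ‖ffun (q ^ (j + 1))‖ ≤ K := by
    intro j
    rw [← (hasSum_rankWeight ((hqj j).trans_lt hq1)).tsum_eq]
    refine tsum_of_norm_bounded hK fun k => ?_
    have b1 : ‖(rankWeight k : ℂ)‖ ≤ k := by
      rw [Complex.norm_intCast]
      have := abs_rankWeight_le k
      rw [Nat.abs_cast] at this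
      exact_mod_cast this
    rw [norm_mul, norm_pow, pow_one]
    exact mul_le_mul b1 (pow_le_pow_left₀ (norm_nonneg _) (hqj j) k) (by positivity) (by positivity)
  have s1 : Summable fun j : ℕ => dysonCoeff q j * ffun (q ^ (j + 1)) := by
    refine Summable.of_norm_bounded ((summable_pow_succ hq1).mul_right K) fun j => ?_
    rw [norm_mul]
    exact mul_le_mul (norm_dysonCoeff_le hq1 j) (bf j) (norm_nonneg _) (by positivity)
  have s2 : Summable fun j : ℕ => -(dysonCoeff q j * q ^ (j + 1) * ffun (q ^ (j + 1))) := by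
    refine Summable.of_norm_bounded ((summable_pow_succ hq1).mul_right K) fun j => ?_
    rw [norm_neg, norm_mul, norm_mul]
    refine mul_le_mul ?_ (bf j) (norm_nonneg _) (by positivity)
    exact (mul_le_of_le_one_right (norm_nonneg _) ((hqj j).trans hq1.le)).trans
      (norm_dysonCoeff_le hq1 j)
  have f0 : ffun (q ^ (0 : ℤ)) = 0 := by rw [zpow_zero, ffun]; norm_num
  have zc : ∀ j : ℕ, q ^ ((j : ℤ) + 1) = q ^ (j + 1) := fun j => by
    rw [← zpow_natCast]; push_cast; rfl
  have h := HasSum.of_add_one_of_neg_add_one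
    (f := fun n : ℤ => gv q n ^ 3 * q⁻¹ ^ n * ffun (q ^ n))
    (s2.hasSum.congr_fun fun j => by rw [gv_cube_pos hq, zc]; ring)
    (s1.hasSum.congr_fun fun j => by
      have e := gv_cube_pos hq j
      rw [inv_zpow, zc] at e
      rw [gv_neg hq, zpow_neg q⁻¹, inv_zpow, inv_inv, zpow_neg, zc, ffun_inv (pow_ne_zero _ hq)]
      have n0 := pow_ne_zero (j + 1) hq
      generalize q ^ (j + 1) = u at *
      have e' : u⁻¹ ^ 3 * u = u⁻¹ * u⁻¹ := by field_simp
      have e'' : u * u⁻¹ = 1 := mul_inv_cancel₀ n0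
      linear_combination -gv q ((j : ℤ) + 1) ^ 3 * ffun u * e' - u⁻¹ * ffun u * e +
        dysonCoeff q j * ffun u * e'')
  rw [f0, mul_zero, add_zero, ← s2.tsum_add s1] at h
  rw [dmock, h.tsum_eq]
  exact tsum_congr fun j => by ring

lemma tsum_rankWeight_eq (hq0 : q ≠ 0) (hq : ‖q‖ < 1 / 2) :
    ∑' x : Ptn, (rankWeight (mrank x.parts) : ℂ) * q ^ x.parts.sum =
      (poch q q)⁻¹ * dmock q := by
  rw [tsum_rankWeight hq, dmock_eq hq0 (hq.trans (by norm_num)),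
    eq_inv_of_mul_eq_one_right (poch_self_mul_ptnGen hq)]

end RankWeights

section Conjugation

/-- the Ferrers diagram of a multiset of parts -/
def ferrers (m : Multiset ℕ) : YoungDiagram :=
  YoungDiagram.ofRowLens (m.sort (· ≥ ·)) (m.pairwise_sort (· ≥ ·)).sortedGE

/-- the conjugate of a multiset of parts -/
def conjParts (m : Multiset ℕ) : Multiset ℕ := (ferrers m).transpose.rowLens

lemma rowLens_ferrers {m : Multiset ℕ} (hm : ∀ x ∈ m, 0 < x) :
    ((ferrers m).rowLens : Multiset ℕ) = m := by
  rw [ferrers, YoungDiagram.rowLens_ofRowLens_eq_self, Multiset.sort_eq]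
  intro x hx
  exact hm x ((Multiset.mem_sort (· ≥ ·)).mp hx)

lemma ferrers_rowLens (μ : YoungDiagram) : ferrers μ.rowLens = μ := by
  have h : Multiset.sort (μ.rowLens : Multiset ℕ) (· ≥ ·) = μ.rowLens :=
    List.Perm.eq_of_pairwise' (r := (· ≥ ·)) (Multiset.pairwise_sort _ _)
      μ.rowLens_sorted.pairwise (Multiset.coe_eq_coe.mp (Multiset.sort_eq _ _))
  unfold ferrers
  conv_rhs => rw [← YoungDiagram.ofRowLens_to_rowLens_eq_self (μ := μ)]
  congr 1

lemma sum_rowLens (μ : YoungDiagram) : μ.rowLens.sum = μ.card := by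
  have h := Finset.card_eq_sum_card_fiberwise (s := μ.cells) (t := Finset.range (μ.colLen 0))
    (f := Prod.fst) (by
      rintro ⟨i, j⟩ h
      have h : (i, j) ∈ μ := h
      have h0 : (i, 0) ∈ μ := μ.up_left_mem le_rfl (Nat.zero_le j) h
      exact Finset.mem_coe.mpr (Finset.mem_range.mpr (YoungDiagram.mem_iff_lt_colLen.mp h0)))
  rw [YoungDiagram.rowLens, YoungDiagram.card, h]
  change ∑ i ∈ Finset.range (μ.colLen 0), μ.rowLen i = _
  exact Finset.sum_congr rfl fun i _ => μ.rowLen_eq_card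

lemma sup_rowLens (μ : YoungDiagram) : (μ.rowLens : Multiset ℕ).sup = μ.rowLen 0 := by
  refine le_antisymm (Multiset.sup_le.mpr fun b hb => ?_) ?_
  · obtain ⟨i, -, rfl⟩ := List.mem_map.mp (Multiset.mem_coe.mp hb)
    exact μ.rowLen_anti 0 i (Nat.zero_le i)
  · rcases Nat.eq_zero_or_pos (μ.rowLen 0) with h | h
    · rw [h]; exact Nat.zero_le _
    · refine Multiset.le_sup (Multiset.mem_coe.mpr (List.mem_map.mpr ⟨0, ?_, rfl⟩))
      rw [List.mem_range, ← YoungDiagram.mem_iff_lt_colLen, YoungDiagram.mem_iff_lt_rowLen]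
      exact h

lemma card_rowLens (μ : YoungDiagram) : Multiset.card (μ.rowLens : Multiset ℕ) = μ.colLen 0 := by
  rw [Multiset.coe_card, YoungDiagram.length_rowLens]

lemma card_transpose (μ : YoungDiagram) : μ.transpose.card = μ.card := by
  rw [YoungDiagram.card, YoungDiagram.card, YoungDiagram.transpose]
  exact Finset.card_map _

lemma sum_conjParts {m : Multiset ℕ} (hm : ∀ x ∈ m, 0 < x) : (conjParts m).sum = m.sum := by
  rw [conjParts, Multiset.sum_coe, sum_rowLens, card_transpose, ← sum_rowLens, ← Multiset.sum_coe,
    rowLens_ferrers hm]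

lemma sup_conjParts {m : Multiset ℕ} (hm : ∀ x ∈ m, 0 < x) :
    (conjParts m).sup = Multiset.card m := by
  rw [conjParts, sup_rowLens, YoungDiagram.rowLen_transpose, ← card_rowLens, rowLens_ferrers hm]

lemma card_conjParts {m : Multiset ℕ} (hm : ∀ x ∈ m, 0 < x) :
    Multiset.card (conjParts m) = m.sup := by
  rw [conjParts, card_rowLens, YoungDiagram.colLen_transpose, ← sup_rowLens, rowLens_ferrers hm]

lemma conjParts_conjParts {m : Multiset ℕ} (hm : ∀ x ∈ m, 0 < x) :
    conjParts (conjParts m) = m := by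
  rw [conjParts, conjParts, ferrers_rowLens, YoungDiagram.transpose_transpose, rowLens_ferrers hm]

/-- conjugation of partitions -/
def conj {n : ℕ} (π : n.Partition) : n.Partition where
  parts := conjParts π.parts
  parts_pos {i} hi := (ferrers π.parts).transpose.pos_of_mem_rowLens i (Multiset.mem_coe.mp hi)
  parts_sum := (sum_conjParts fun _ h => π.parts_pos h).trans π.parts_sum

lemma conj_involutive (n : ℕ) : Function.Involutive (conj : n.Partition → n.Partition) :=
  fun π => Nat.Partition.ext (conjParts_conjParts fun _ h => π.parts_pos h)

lemma numParts_conj {n : ℕ} (π : n.Partition) : numParts (conj π) = largestPart π :=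
  card_conjParts fun _ h => π.parts_pos h

lemma largestPart_conj {n : ℕ} (π : n.Partition) : largestPart (conj π) = numParts π :=
  sup_conjParts fun _ h => π.parts_pos h

lemma rank_conj {n : ℕ} (π : n.Partition) : rank (conj π) = -rank π := by
  rw [rank, rank, numParts_conj, largestPart_conj]
  ring

lemma sum_conj {n : ℕ} {M : Type*} [AddCommMonoid M] (f : n.Partition → M) :
    ∑ π : n.Partition, f (conj π) = ∑ π : n.Partition, f π :=
  Equiv.sum_comp (conj_involutive n).toPerm f

lemma NT_sub_NT (n : ℕ) :
    NT 1 5 n - NT 4 5 n = -∑ π : n.Partition, rankWeight (rank π) := by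
  have h4 : NT 4 5 n = ∑ π : n.Partition, if rank π % 5 = 1 then (largestPart π : ℤ) else 0 := by
    rw [NT, ← sum_conj]
    refine Finset.sum_congr rfl fun π _ => ?_
    rw [rank_conj, numParts_conj]
    have : (-rank π % ((5 : ℕ) : ℤ) = ((4 : ℕ) : ℤ) % ((5 : ℕ) : ℤ)) ↔ rank π % 5 = 1 := by
      push_cast; omega
    simp only [this]
  have hw : ∑ π : n.Partition, rankWeight (rank π) =
      ∑ π : n.Partition, if rank π % 5 = 1 then rank π else 0 := by
    have e : ∀ k : ℤ, rankWeight k = (if 0 < k ∧ k % 5 = 1 then k else 0) +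
        (if 0 < k ∧ k % 5 = 4 then -k else 0) := by
      intro k
      unfold rankWeight
      split_ifs <;> omega
    simp only [e]
    rw [Finset.sum_add_distrib, ← sum_conj fun π : n.Partition =>
      if 0 < rank π ∧ rank π % 5 = 4 then -rank π else 0, ← Finset.sum_add_distrib]
    refine Finset.sum_congr rfl fun π _ => ?_
    rw [rank_conj]
    split_ifs <;> omega
  rw [h4, hw, NT, ← Finset.sum_sub_distrib, ← Finset.sum_neg_distrib]
  refine Finset.sum_congr rfl fun π _ => ?_
  have : (rank π % ((5 : ℕ) : ℤ) = ((1 : ℕ) : ℤ) % ((5 : ℕ) : ℤ)) ↔ rank π % 5 = 1 := by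
    push_cast; omega
  simp only [this]
  split_ifs with h
  · rw [rank]; ring
  · simp

end Conjugation

section Assembly

lemma coeff_eq_zero {c : ℕ → ℂ} {r : ℝ} (hr : 0 < r) (hs : Summable fun n => ‖c n‖ * r ^ n)
    (h : ∀ Q : ℂ, Q ≠ 0 → ‖Q‖ < r → ∑' n, c n * Q ^ n = 0) (n : ℕ) : c n = 0 := by
  induction n using Nat.strong_induction_on with
  | _ k ih =>
  have hs' : Summable fun n => ‖c (n + k)‖ * r ^ n := by
    have := ((summable_nat_add_iff k).mpr hs).mul_right (r ^ k)⁻¹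
    refine this.congr fun n => ?_
    rw [pow_add]
    field_simp
  have lim : Tendsto (fun Q : ℂ => ∑' n, c (n + k) * Q ^ n) (𝓝[≠] 0)
      (𝓝 (∑' n, c (n + k) * 0 ^ n)) := by
    refine tendsto_tsum_of_dominated_convergence hs' (fun n => ?_) ?_
    · exact ((continuous_const.mul (continuous_pow n)).tendsto' _ _ rfl).mono_left
        nhdsWithin_le_nhds
    · filter_upwards [nhdsWithin_le_nhds (Metric.ball_mem_nhds (0 : ℂ) hr)] with Q hQ n
      rw [norm_mul, norm_pow]
      have := (mem_ball_zero_iff.mp hQ).le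
      gcongr
  rw [tsum_eq_single 0 (fun n hn => by rw [zero_pow hn, mul_zero])] at lim
  have z : Tendsto (fun Q : ℂ => ∑' n, c (n + k) * Q ^ n) (𝓝[≠] 0) (𝓝 0) := by
    refine tendsto_const_nhds.congr' ?_
    filter_upwards [nhdsWithin_le_nhds (Metric.ball_mem_nhds (0 : ℂ) hr), self_mem_nhdsWithin]
      with Q hQ hQ0
    have hQ0 : Q ≠ 0 := hQ0
    have e := h Q hQ0 (mem_ball_zero_iff.mp hQ)
    have sQ : Summable fun n => c n * Q ^ n := by
      refine Summable.of_norm_bounded hs fun n => ?_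
      rw [norm_mul, norm_pow]
      have := (mem_ball_zero_iff.mp hQ).le
      gcongr
    rw [← sQ.sum_add_tsum_nat_add k, Finset.sum_eq_zero fun i hi => by
      rw [ih i (Finset.mem_range.mp hi), zero_mul], zero_add] at e
    simp only [pow_add, ← mul_assoc] at e
    rw [tsum_mul_right] at e
    exact ((mul_eq_zero.mp e).resolve_right (pow_ne_zero k hQ0)).symm
  simpa using tendsto_nhds_unique lim z

lemma topCoeff_tsum {c : ℕ → ℂ} {Q : ℂ} (hs : ∀ q : ℂ, q ^ 5 = Q → Summable fun n => c n * q ^ n) :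
    TopCoeff Q (fun q => ∑' n, c n * q ^ n) (∑' n, c (4 + 5 * n) * Q ^ n) := by
  refine ⟨∑' n, c (5 * n) * Q ^ n, ∑' n, c (1 + 5 * n) * Q ^ n, ∑' n, c (2 + 5 * n) * Q ^ n,
    ∑' n, c (3 + 5 * n) * Q ^ n, fun q hq => ?_⟩
  have key : ∀ r : ℕ, ∑' n, c (r + 5 * n) * q ^ (r + 5 * n) = (∑' n, c (r + 5 * n) * Q ^ n) * q ^ r := by
    intro r
    rw [← tsum_mul_right]
    refine tsum_congr fun n => ?_
    rw [pow_add, pow_mul, hq]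
    ring
  have H := Nat.sumByResidueClasses (hs q hq) 5
  have E : ∑ j : ZMod 5, ∑' n, c (j.val + 5 * n) * q ^ (j.val + 5 * n) =
      ∑ j : Fin 5, ∑' n, c ((j : ℕ) + 5 * n) * q ^ ((j : ℕ) + 5 * n) := rfl
  change ∑' n, c n * q ^ n = _
  rw [H, E]
  simp only [key]
  rw [Fin.sum_univ_five]
  simp

lemma zpow_emod_five {z : ℂ} (hz : z ^ 5 = 1) (k : ℤ) : z ^ k = z ^ (k % 5) := by
  have h0 : z ≠ 0 := by rintro rfl; norm_num at hz
  conv_lhs => rw [← Int.emod_add_mul_ediv k 5]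
  rw [zpow_add₀ h0, zpow_mul, zpow_ofNat, hz, one_zpow, mul_one]

lemma zpow_sub_inv_zpow {z : ℂ} (hz : z ^ 5 = 1) (k : ℤ) :
    z ^ k - z⁻¹ ^ k = (z - z ^ 4) * ((if k % 5 = 1 then 1 else 0) - (if k % 5 = 4 then 1 else 0)) +
      (z ^ 2 - z ^ 3) * ((if k % 5 = 2 then 1 else 0) - (if k % 5 = 3 then 1 else 0)) := by
  have hi : z⁻¹ ^ 5 = 1 := by rw [inv_pow, hz, inv_one]
  have h0 : z ≠ 0 := by rintro rfl; norm_num at hz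
  have e1 : z⁻¹ = z ^ 4 := by
    exact inv_eq_of_mul_eq_one_right (by rw [← hz]; ring)
  rw [zpow_emod_five hz, zpow_emod_five hi, e1]
  have h5 : k % 5 = 0 ∨ k % 5 = 1 ∨ k % 5 = 2 ∨ k % 5 = 3 ∨ k % 5 = 4 := by omega
  rcases h5 with h | h | h | h | h <;> rw [h] <;> norm_num [zpow_ofNat]
  · linear_combination z ^ 3 * hz
  · linear_combination (z ^ 7 + z ^ 2) * hz
  · linear_combination (z ^ 11 + z ^ 6 + z) * hz

lemma sum_omegaOnes_mul {z : ℂ} (hz : z ^ 5 = 1) (n : ℕ) :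
    ∑ π : n.Partition, (π.parts.count 1 : ℂ) * (z ^ mcrank π.parts - z⁻¹ ^ mcrank π.parts) =
      (z - z ^ 4) * ((Mw 1 5 n : ℂ) - Mw 4 5 n) + (z ^ 2 - z ^ 3) * ((Mw 2 5 n : ℂ) - Mw 3 5 n) := by
  unfold Mw
  push_cast
  rw [← Finset.sum_sub_distrib, ← Finset.sum_sub_distrib, Finset.mul_sum, Finset.mul_sum,
    ← Finset.sum_add_distrib]
  refine Finset.sum_congr rfl fun π _ => ?_
  rw [zpow_sub_inv_zpow hz]
  change (omegaOnes π : ℂ) * _ = _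
  have : mcrank π.parts = crank π := rfl
  rw [this]
  split_ifs <;> ring

/-- the weight combining crank and rank contributions at a fifth root of unity -/
noncomputable def beckWeight (z : ℂ) (m : Multiset ℕ) : ℂ :=
  (m.count 1 : ℂ) * (z ^ mcrank m - z⁻¹ ^ mcrank m) +
    (2 * (z ^ 2 - z ^ 3) - 4 * (z - z ^ 4)) * (rankWeight (mrank m) : ℂ)

lemma hasSum_beckWeight {q z : ℂ} (hq0 : q ≠ 0) (hq : ‖q‖ < 1 / 2) (hz : ‖z‖ = 1) :
    HasSum (fun n : ℕ => (∑ π : n.Partition, beckWeight z π.parts) * q ^ n)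
      (-(poch q q / (poch (z * q) q * poch (z⁻¹ * q) q) * lambert z q) +
        (2 * (z ^ 2 - z ^ 3) - 4 * (z - z ^ 4)) * ((poch q q)⁻¹ * dmock q)) := by
  have s1 := (summable_crankGen hq hz).of_norm
  have s2 := (summable_crankGen hq (z := z⁻¹) (by rw [norm_inv, hz, inv_one])).of_norm
  have s3 := (summable_rankWeight hq).of_norm
  have e : ∀ x : Ptn, beckWeight z x.parts * q ^ x.parts.sum =
      ((x.parts.count 1 : ℂ) * z ^ mcrank x.parts * q ^ x.parts.sum -
        (x.parts.count 1 : ℂ) * z⁻¹ ^ mcrank x.parts * q ^ x.parts.sum) +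
      (2 * (z ^ 2 - z ^ 3) - 4 * (z - z ^ 4)) *
        ((rankWeight (mrank x.parts) : ℂ) * q ^ x.parts.sum) := by
    intro x; unfold beckWeight; ring
  have hs : Summable fun x : Ptn => beckWeight z x.parts * q ^ x.parts.sum :=
    ((s1.sub s2).add (s3.mul_left _)).congr fun x => (e x).symm
  have H := hasSum_ptn (F := fun m => beckWeight z m * q ^ m.sum) hs
  have E : ∑' x : Ptn, beckWeight z x.parts * q ^ x.parts.sum =
      -(poch q q / (poch (z * q) q * poch (z⁻¹ * q) q) * lambert z q) +
        (2 * (z ^ 2 - z ^ 3) - 4 * (z - z ^ 4)) * ((poch q q)⁻¹ * dmock q) := by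
    rw [tsum_congr e, (s1.sub s2).tsum_add (s3.mul_left _), s1.tsum_sub s2, tsum_mul_left,
      tsum_rankWeight_eq hq0 hq, ← crankGen_sub hq0 hq hz]
    rfl
  rw [← E]
  refine H.congr_fun fun n => ?_
  rw [Finset.sum_mul]
  refine Finset.sum_congr rfl fun π _ => ?_
  rw [π.parts_sum]

lemma sum_beckWeight_eq_zero {z : ℂ} (hz : 1 + z + z ^ 2 + z ^ 3 + z ^ 4 = 0) (n : ℕ) :
    ∑ π : (4 + 5 * n).Partition, beckWeight z π.parts = 0 := by
  have hz5 : z ^ 5 = 1 := by linear_combination (z - 1) * hz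
  have hz1 : ‖z‖ = 1 := Complex.norm_eq_one_of_pow_eq_one hz5 (by norm_num)
  set c : ℕ → ℂ := fun N => ∑ π : N.Partition, beckWeight z π.parts with hc
  have small : ∀ {Q q : ℂ}, ‖Q‖ < (1 / 4) ^ 5 → q ^ 5 = Q → ‖q‖ < 1 / 2 := by
    intro Q q hQ h
    rw [← h, norm_pow] at hQ
    exact (lt_of_pow_lt_pow_left₀ 5 (by norm_num) hQ).trans (by norm_num)
  refine coeff_eq_zero (c := fun n => c (4 + 5 * n)) (r := (1 / 4) ^ 5) (by norm_num) ?_ ?_ n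
  · have s := (hasSum_beckWeight (q := 1 / 4) (by norm_num) (by norm_num) hz1).summable.norm
    have s' := (s.comp_injective (i := fun n => 4 + 5 * n) (fun a b h => by
      simpa using h)).mul_right (4 ^ 4)
    refine s'.congr fun n => ?_
    simp only [Function.comp, norm_mul, norm_pow, pow_add, pow_mul]
    rw [show ‖(1 / 4 : ℂ)‖ = 1 / 4 by norm_num]
    ring
  · intro Q hQ hQr
    have hQ1 : ‖Q‖ < 1 := hQr.trans (by norm_num)
    have T1 := topCoeff_tsum (c := c) (Q := Q) fun q h =>
      (hasSum_beckWeight (ne_zero_norm_lt_of_pow hQ hQ1 h).1 (small hQr h) hz1).summable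
    obtain ⟨t0, t1, t2, t3, ht⟩ := crank_component hQ hQ1 hz
    obtain ⟨r0, r1, r2, r3, hr⟩ := rank_component hQ hQ1
    refine T1.unique hQ ⟨-t0 + (2 * (z ^ 2 - z ^ 3) - 4 * (z - z ^ 4)) * r0,
      -t1 + (2 * (z ^ 2 - z ^ 3) - 4 * (z - z ^ 4)) * r1,
      -t2 + (2 * (z ^ 2 - z ^ 3) - 4 * (z - z ^ 4)) * r2,
      -t3 + (2 * (z ^ 2 - z ^ 3) - 4 * (z - z ^ 4)) * r3, fun q h => ?_⟩
    change ∑' n, c n * q ^ n = _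
    rw [(hasSum_beckWeight (ne_zero_norm_lt_of_pow hQ hQ1 h).1 (small hQr h) hz1).tsum_eq,
      ht q h]
    have := hr q h
    simp only at this
    rw [this]
    ring

lemma crank_rank_relation {z : ℂ} (hz : 1 + z + z ^ 2 + z ^ 3 + z ^ 4 = 0) (n : ℕ) :
    (z - z ^ 4) * ((Mw 1 5 (5 * n + 4) : ℂ) - Mw 4 5 (5 * n + 4)) +
      (z ^ 2 - z ^ 3) * ((Mw 2 5 (5 * n + 4) : ℂ) - Mw 3 5 (5 * n + 4)) =
    (2 * (z ^ 2 - z ^ 3) - 4 * (z - z ^ 4)) *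
      ((NT 1 5 (5 * n + 4) : ℂ) - NT 4 5 (5 * n + 4)) := by
  have h := sum_beckWeight_eq_zero hz n
  have hz5 : z ^ 5 = 1 := by linear_combination (z - 1) * hz
  rw [add_comm 4] at h
  unfold beckWeight at h
  rw [Finset.sum_add_distrib, sum_omegaOnes_mul hz5, ← Finset.mul_sum] at h
  have e : ((NT 1 5 (5 * n + 4) : ℂ) - NT 4 5 (5 * n + 4)) =
      -∑ π : (5 * n + 4).Partition, (rankWeight (mrank π.parts) : ℂ) := by
    have := congrArg (Int.cast : ℤ → ℂ) (NT_sub_NT (5 * n + 4))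
    push_cast at this
    exact this
  rw [e]
  linear_combination h

end Assembly

/-- For every `n ≥ 0`,
`Mω(2,5,5n+4) − Mω(3,5,5n+4) = 2 NT(1,5,5n+4) − 2 NT(4,5,5n+4)`. -/
theorem statement_1 (n : ℕ) :
    Mw 2 5 (5 * n + 4) - Mw 3 5 (5 * n + 4)
      = 2 * NT 1 5 (5 * n + 4) - 2 * NT 4 5 (5 * n + 4) := by
  have hζ := Complex.isPrimitiveRoot_exp 5 (by norm_num)
  set z := Complex.exp (2 * Real.pi * Complex.I / (5 : ℕ))
  have h5 : z ^ 5 = 1 := hζ.pow_eq_one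
  have h1 : 1 + z + z ^ 2 + z ^ 3 + z ^ 4 = 0 := by
    have := hζ.geom_sum_eq_zero (by norm_num)
    simpa [Finset.sum_range_succ] using this
  have h2 : 1 + z ^ 2 + (z ^ 2) ^ 2 + (z ^ 2) ^ 3 + (z ^ 2) ^ 4 = 0 := by
    linear_combination h1 + (z + z ^ 3) * h5
  have A := crank_rank_relation h1 n
  have B := crank_rank_relation h2 n
  have B' : (z ^ 2 - z ^ 3) * ((Mw 1 5 (5 * n + 4) : ℂ) - Mw 4 5 (5 * n + 4)) -
      (z - z ^ 4) * ((Mw 2 5 (5 * n + 4) : ℂ) - Mw 3 5 (5 * n + 4)) =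
    (-2 * (z - z ^ 4) - 4 * (z ^ 2 - z ^ 3)) *
      ((NT 1 5 (5 * n + 4) : ℂ) - NT 4 5 (5 * n + 4)) := by
    have e3 : z ^ 2 - (z ^ 2) ^ 4 = z ^ 2 - z ^ 3 := by linear_combination -z ^ 3 * h5
    have e4 : (z ^ 2) ^ 2 - (z ^ 2) ^ 3 = -(z - z ^ 4) := by linear_combination -z * h5
    rw [e3, e4] at B
    linear_combination B
  have D : (z - z ^ 4) ^ 2 + (z ^ 2 - z ^ 3) ^ 2 = -5 := by
    linear_combination h1 + (z ^ 3 - 4 + z) * h5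
  have R : ((Mw 2 5 (5 * n + 4) : ℂ) - Mw 3 5 (5 * n + 4)) =
      2 * NT 1 5 (5 * n + 4) - 2 * NT 4 5 (5 * n + 4) := by
    refine mul_left_cancel₀ (show (-5 : ℂ) ≠ 0 by norm_num) ?_
    rw [← D]
    linear_combination (z ^ 2 - z ^ 3) * A - (z - z ^ 4) * B'
  exact_mod_cast R

end Beck
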